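/- arXiv:2308.10221 — 3 statements merged into one kernel-verified Lean document; each statement's English description precedes it below -/
import Mathlib

section
/- There exists a unique positive function f on (0,∞) such that r ↦ f(r)^m/m is twice continuously differentiable on (0,∞), (f^m/m)''(r) + ((n-1)/r)·(f^m/m)'(r) + α·f(r) + β·r·f'(r) = 0 for all r > 0, lim_{r→0+} r^{α/β}·f(r) = η, and, with w(r) = r^{α/β}·f(r) and z(s) = e^s·w'(e^s)/w(e^s), the bound 0 < z(s)·e^{-(ρ1/β)s} ≤ C4·η^{m-1} holds for all s ∈ ℝ. -/
open Real Set Filter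

/-- `z(s) = e^s w'(e^s) / w(e^s)` where `w(r) = r^{α/β} f(r)`. -/
noncomputable def Zfun (α β : ℝ) (f : ℝ → ℝ) (s : ℝ) : ℝ :=
  Real.exp s * deriv (fun r => r ^ (α / β) * f r) (Real.exp s) /
    (Real.exp s ^ (α / β) * f (Real.exp s))

/-- radially symmetric solution of `Δ(f^m/m) + α f + β x·∇f = 0` on `(0,∞)`
with `lim_{r→0+} r^{α/β} f(r) = η`. -/
def FDESol (n : ℕ) (m α β η : ℝ) (f : ℝ → ℝ) : Prop :=
  (∀ r ∈ Set.Ioi (0 : ℝ), 0 < f r) ∧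
  ContDiffOn ℝ 2 (fun r => f r ^ m / m) (Set.Ioi 0) ∧
  (∀ r ∈ Set.Ioi (0 : ℝ),
    deriv (deriv (fun r' => f r' ^ m / m)) r
      + (((n : ℝ) - 1) / r) * deriv (fun r' => f r' ^ m / m) r
      + α * f r + β * r * deriv f r = 0) ∧
  Filter.Tendsto (fun r => r ^ (α / β) * f r) (nhdsWithin 0 (Set.Ioi 0)) (nhds η)

/-- the bound `0 < z(s) e^{-(ρ1/β) s} ≤ C4 η^{m-1}` for all `s ∈ ℝ`. -/
def FDEZBound (m α β ρ1 η C4 : ℝ) (f : ℝ → ℝ) : Prop :=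
  ∀ s : ℝ, 0 < Zfun α β f s * Real.exp (-(ρ1 / β) * s) ∧
    Zfun α β f s * Real.exp (-(ρ1 / β) * s) ≤ C4 * η ^ (m - 1)

/-- Coefficients of the planar system `y' = z`,
`z' = c₀ - c₁ z - m z² - b e^{-κ s} e^{σ y} z`, with a barrier constant `M` for `z e^{-κ s}`. -/
structure RiccatiData where
  (c₀ c₁ m b κ σ M : ℝ)
  c₀_pos : 0 < c₀
  m_pos : 0 < m
  b_pos : 0 < b
  κ_pos : 0 < κ
  σ_pos : 0 < σ
  barrier : ∀ z, c₀ - c₁ * z - m * z ^ 2 ≤ b * M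

namespace RiccatiData

variable (P : RiccatiData)

/-- Right-hand side of the equation for `z`. -/
noncomputable def rhs (s y z : ℝ) : ℝ :=
  P.c₀ - P.c₁ * z - P.m * z ^ 2 - P.b * exp (-(P.κ * s)) * exp (P.σ * y) * z

/-- `(y, z)` solves the system on `I` and stays in the region
`0 ≤ y ≤ (M / κ) e^{κ s}`, `0 ≤ z ≤ M e^{κ s}`. -/
structure IsSolOn (I : Set ℝ) (y z : ℝ → ℝ) : Prop where
  deriv_y : ∀ s ∈ I, HasDerivWithinAt y (z s) I s
  deriv_z : ∀ s ∈ I, HasDerivWithinAt z (P.rhs s (y s) (z s)) I s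
  mem_y : ∀ s ∈ I, y s ∈ Icc 0 (P.M / P.κ * exp (P.κ * s))
  mem_z : ∀ s ∈ I, z s ∈ Icc 0 (P.M * exp (P.κ * s))

variable {P} in
lemma IsSolOn.mono {I J : Set ℝ} {y z : ℝ → ℝ} (h : P.IsSolOn I y z) (hJ : J ⊆ I) :
    P.IsSolOn J y z where
  deriv_y s hs := (h.deriv_y s (hJ hs)).mono hJ
  deriv_z s hs := (h.deriv_z s (hJ hs)).mono hJ
  mem_y s hs := h.mem_y s (hJ hs)
  mem_z s hs := h.mem_z s (hJ hs)

lemma M_pos : 0 < P.M := by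
  have h := P.barrier 0
  have h0 := P.c₀_pos
  have hb := P.b_pos
  by_contra! hM
  nlinarith

/-- The vector field of the system, as a function of `(s, (y, z))`. -/
noncomputable def field (p : ℝ × ℝ × ℝ) : ℝ × ℝ := (p.2.2, P.rhs p.1 p.2.1 p.2.2)

lemma contDiff_field : ContDiff ℝ 1 P.field := by
  unfold field rhs
  fun_prop

/-- The box `[S₁, S₂] × [0, Y] × [0, Z]`. -/
def box (S₁ S₂ Y Z : ℝ) : Set (ℝ × ℝ × ℝ) := Icc S₁ S₂ ×ˢ Icc 0 Y ×ˢ Icc 0 Z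

lemma exists_lipschitzOnWith_field (S₁ S₂ Y Z : ℝ) :
    ∃ K, LipschitzOnWith K P.field (box S₁ S₂ Y Z) :=
  P.contDiff_field.contDiffOn.exists_lipschitzOnWith one_ne_zero
    ((convex_Icc _ _).prod ((convex_Icc _ _).prod (convex_Icc _ _)))
    (isCompact_Icc.prod (isCompact_Icc.prod isCompact_Icc))

/-- Projection of the plane onto the rectangle `[0, Y] × [0, Z]`. -/
noncomputable def clamp (Y Z : ℝ) (x : ℝ × ℝ) : ℝ × ℝ := (max 0 (min x.1 Y), max 0 (min x.2 Z))

lemma clamp_mem {Y Z : ℝ} (hY : 0 ≤ Y) (hZ : 0 ≤ Z) (x : ℝ × ℝ) :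
    clamp Y Z x ∈ Icc 0 Y ×ˢ Icc 0 Z := by
  simp [clamp, hY, hZ]

lemma lipschitzWith_clamp (Y Z : ℝ) : LipschitzWith 1 (clamp Y Z) := by
  have h1 : LipschitzWith 1 fun x : ℝ × ℝ => max 0 (min x.1 Y) :=
    (LipschitzWith.prod_fst.min_const Y).const_max 0
  have h2 : LipschitzWith 1 fun x : ℝ × ℝ => max 0 (min x.2 Z) :=
    (LipschitzWith.prod_snd.min_const Z).const_max 0
  simpa using! h1.prodMk h2

/-- The system truncated to a rectangle has a solution with zero initial data on any interval. -/
lemma exists_truncated_solution {a c Y Z : ℝ} (hac : a ≤ c) (hY : 0 ≤ Y) (hZ : 0 ≤ Z) :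
    ∃ u : ℝ → ℝ × ℝ, u a = 0 ∧ ∀ t ∈ Icc a c,
      HasDerivWithinAt u (P.field (t, clamp Y Z (u t))) (Icc a c) t := by
  obtain ⟨K, hK⟩ := P.exists_lipschitzOnWith_field a c Y Z
  have hcomp : IsCompact (box a c Y Z) := isCompact_Icc.prod (isCompact_Icc.prod isCompact_Icc)
  obtain ⟨L, hL⟩ := hcomp.exists_bound_of_continuousOn P.contDiff_field.continuous.continuousOn
  have hmem : ∀ t ∈ Icc a c, ∀ x, (t, clamp Y Z x) ∈ box a c Y Z := fun t ht x =>
    ⟨ht, clamp_mem hY hZ x⟩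
  have hL0 : 0 ≤ L := (norm_nonneg _).trans (hL _ (hmem a (left_mem_Icc.2 hac) 0))
  have hPL : IsPicardLindelof (fun t x => P.field (t, clamp Y Z x))
      (⟨a, left_mem_Icc.2 hac⟩ : Icc a c) (0 : ℝ × ℝ) ⟨L * (c - a), by
        exact mul_nonneg hL0 (sub_nonneg.2 hac)⟩ 0 ⟨L, hL0⟩ K := by
    refine ⟨fun t ht => ?_, fun x _ => ?_, fun t ht x _ => hL _ (hmem t ht x), ?_⟩
    · refine LipschitzOnWith.of_dist_le_mul fun x _ x' _ => ?_
      refine (hK.dist_le_mul _ (hmem t ht x) _ (hmem t ht x')).trans ?_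
      gcongr
      have := (lipschitzWith_clamp Y Z).dist_le_mul x x'
      simpa [Prod.dist_eq] using! this
    · exact (P.contDiff_field.continuous.comp (by fun_prop)).continuousOn
    · simp only [max_eq_left (sub_nonneg.2 hac), sub_self, NNReal.coe_zero, sub_zero]
      exact le_refl (L * (c - a))
  exact hPL.exists_eq_forall_mem_Icc_hasDerivWithinAt₀

lemma exists_isSolOn_Icc {a c : ℝ} (hac : a ≤ c) : ∃ y z, P.IsSolOn (Icc a c) y z := by
  have hM := P.M_pos
  have hκ := P.κ_pos
  set Z := P.M * exp (P.κ * c) with hZ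
  set Y := P.M / P.κ * exp (P.κ * c) with hY
  have hZ0 : 0 ≤ Z := by positivity
  have hY0 : 0 ≤ Y := by positivity
  obtain ⟨u, hua, hu⟩ := P.exists_truncated_solution hac hY0 hZ0
  set y : ℝ → ℝ := fun t => (u t).1 with hy
  set z : ℝ → ℝ := fun t => (u t).2 with hz
  have hy' : ∀ t ∈ Icc a c, HasDerivWithinAt y (max 0 (min (z t) Z)) (Icc a c) t := fun t ht =>
    (hu t ht).fst
  have hz' : ∀ t ∈ Icc a c, HasDerivWithinAt z
      (P.rhs t (max 0 (min (y t) Y)) (max 0 (min (z t) Z))) (Icc a c) t := fun t ht =>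
    (hu t ht).snd
  have hycont : ContinuousOn y (Icc a c) := fun t ht => (hy' t ht).continuousWithinAt
  have hzcont : ContinuousOn z (Icc a c) := fun t ht => (hz' t ht).continuousWithinAt
  have right : ∀ {g : ℝ → ℝ} {g' t : ℝ}, t ∈ Ico a c → HasDerivWithinAt g g' (Icc a c) t →
      HasDerivWithinAt g g' (Ici t) t := fun ht h =>
    h.mono_of_mem_nhdsWithin (Icc_mem_nhdsGE_of_mem ht)
  have hexp : ∀ t, HasDerivAt (fun s => exp (P.κ * s)) (P.κ * exp (P.κ * t)) t := fun t => by
    simpa [mul_comm] using ((hasDerivAt_id t).const_mul P.κ).exp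
  have hz0 : ∀ t ∈ Icc a c, 0 ≤ z t := by
    intro t ht
    refine image_le_of_deriv_right_lt_deriv_boundary' (f := fun _ => 0) (f' := fun _ => 0)
      continuousOn_const (fun x _ => hasDerivWithinAt_const _ _ _) (by simp [hz, hua])
      hzcont (fun x hx => right hx (hz' x (Ico_subset_Icc_self hx))) (fun x _ hx => ?_) ht
    simp [← hx, rhs, hZ0, P.c₀_pos]
  have hzM : ∀ t ∈ Icc a c, z t ≤ P.M * exp (P.κ * t) := by
    intro t ht
    refine image_le_of_deriv_right_lt_deriv_boundary' (B := fun s => P.M * exp (P.κ * s))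
      (B' := fun s => P.M * (P.κ * exp (P.κ * s)))
      hzcont (fun x hx => right hx (hz' x (Ico_subset_Icc_self hx)))
      (by simp only [hz, hua, Prod.snd_zero]; positivity) (by fun_prop)
      (fun x hx => ((hexp x).const_mul _).hasDerivWithinAt) (fun x hx hzx => ?_) ht
    have hxZ : z x ≤ Z := by
      rw [hzx, hZ]
      have := hx.2.le
      gcongr
    have hzx0 := hz0 x (Ico_subset_Icc_self hx)
    rw [min_eq_left hxZ, max_eq_right hzx0]
    have h1 : 1 ≤ exp (P.σ * max 0 (min (y x) Y)) :=
      Real.one_le_exp (mul_nonneg P.σ_pos.le (le_max_left _ _))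
    have h2 : P.b * exp (-(P.κ * x)) * z x = P.b * P.M := by
      rw [hzx, Real.exp_neg]; field_simp
    have h3 : P.b * P.M ≤ P.b * exp (-(P.κ * x)) * exp (P.σ * max 0 (min (y x) Y)) * z x := by
      rw [← h2]
      have := P.b_pos
      have h4 : 0 ≤ P.b * exp (-(P.κ * x)) * z x := by positivity
      nlinarith
    have h5 := P.barrier (z x)
    have h6 : 0 < P.M * (P.κ * exp (P.κ * x)) := by positivity
    unfold rhs
    linarith
  have hzZ : ∀ t ∈ Icc a c, max 0 (min (z t) Z) = z t := fun t ht => by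
    rw [min_eq_left, max_eq_right (hz0 t ht)]
    refine (hzM t ht).trans ?_
    have := ht.2
    rw [hZ]; gcongr
  have hy'' : ∀ t ∈ Icc a c, HasDerivWithinAt y (z t) (Icc a c) t := fun t ht => by
    rw [← hzZ t ht]; exact hy' t ht
  have hy0 : ∀ t ∈ Icc a c, 0 ≤ y t := by
    intro t ht
    refine image_le_of_deriv_right_le_deriv_boundary (f := fun _ => 0) (f' := fun _ => 0)
      continuousOn_const (fun x _ => hasDerivWithinAt_const _ _ _) (by simp [hy, hua])
      hycont (fun x hx => right hx (hy'' x (Ico_subset_Icc_self hx)))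
      (fun x hx => hz0 x (Ico_subset_Icc_self hx)) ht
  have hyM : ∀ t ∈ Icc a c, y t ≤ P.M / P.κ * exp (P.κ * t) := by
    intro t ht
    refine image_le_of_deriv_right_le_deriv_boundary (B := fun s => P.M / P.κ * exp (P.κ * s))
      (B' := fun s => P.M / P.κ * (P.κ * exp (P.κ * s)))
      hycont (fun x hx => right hx (hy'' x (Ico_subset_Icc_self hx)))
      (by simp only [hy, hua, Prod.fst_zero]; positivity) (by fun_prop)
      (fun x hx => ((hexp x).const_mul _).hasDerivWithinAt) (fun x hx => ?_) ht
    rw [← mul_assoc, div_mul_cancel₀ _ hκ.ne']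
    exact hzM x (Ico_subset_Icc_self hx)
  refine ⟨y, z, hy'', fun t ht => ?_, fun t ht => ⟨hy0 t ht, hyM t ht⟩,
    fun t ht => ⟨hz0 t ht, hzM t ht⟩⟩
  have hyY : max 0 (min (y t) Y) = y t := by
    rw [min_eq_left, max_eq_right (hy0 t ht)]
    refine (hyM t ht).trans ?_
    have := ht.2
    rw [hY]; gcongr
  have := hz' t ht
  rwa [hyY, hzZ t ht] at this

lemma abs_exp_sub_exp_le {x y B : ℝ} (hx : x ≤ B) (hy : y ≤ B) :
    |exp x - exp y| ≤ exp B * |x - y| := by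
  have key : ∀ u v : ℝ, u ≤ B → exp u - exp v ≤ exp B * |u - v| := fun u v hu => by
    have h1 : exp u - exp v = exp u * (1 - exp (v - u)) := by
      rw [mul_sub, ← Real.exp_add]; ring_nf
    have h2 : 1 - exp (v - u) ≤ |u - v| := by
      have := Real.add_one_le_exp (v - u)
      have := le_abs_self (u - v)
      linarith
    rw [h1]
    exact (mul_le_mul_of_nonneg_left h2 (exp_pos u).le).trans
      (mul_le_mul_of_nonneg_right (Real.exp_le_exp.2 hu) (abs_nonneg _))
  rw [abs_le]
  have h1 := key x y hx
  have h2 := key y x hy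
  rw [abs_sub_comm y x] at h2
  constructor <;> linarith

lemma energy_deriv_le {b c₁ e i A D E R K : ℝ} (hb : 0 < b) (he : 0 < e) (hei : e * i = 1)
    (hA : b * i - |c₁| ≤ A) (hR : R ^ 2 ≤ K ^ 2 * E ^ 2) :
    2 * E * D + 2 / b * (2 * D * (-A * D + R)) ≤
      (1 + (2 / b) ^ 2 * K ^ 2 + 2 / b * c₁ ^ 2 / 2) * e * (E ^ 2 + 2 / b * D ^ 2) := by
  obtain ⟨θ, hθ⟩ : ∃ θ, θ = 2 / b := ⟨_, rfl⟩
  have hθ0 : 0 < θ := by rw [hθ]; positivity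
  have hθb : θ * b = 2 := by rw [hθ]; field_simp
  have hi : 0 < i := pos_of_mul_pos_right (by rw [hei]; exact one_pos) he.le
  rw [← hθ]
  have hA' : 2 * i - θ * |c₁| ≤ θ * A := by nlinarith
  have h1 : 2 * E * D ≤ e * E ^ 2 + i * D ^ 2 := by
    have : 0 ≤ i * (e * E - D) ^ 2 := by positivity
    have h : i * (e * E - D) ^ 2 = (e * i) * e * E ^ 2 - 2 * (e * i) * E * D + i * D ^ 2 := by ring
    rw [h, hei] at this
    linarith
  have h2 : 2 * θ * D * R ≤ i * D ^ 2 + θ ^ 2 * e * R ^ 2 := by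
    have : 0 ≤ i * (e * (θ * R) - D) ^ 2 := by positivity
    have h : i * (e * (θ * R) - D) ^ 2 =
        (e * i) * e * (θ * R) ^ 2 - 2 * (e * i) * (θ * R) * D + i * D ^ 2 := by ring
    rw [h, hei] at this
    linarith
  have h3 : 2 * (θ * |c₁|) ≤ 2 * i + θ ^ 2 * c₁ ^ 2 / 2 * e := by
    have : 0 ≤ i * (e * (θ * |c₁|) - 2) ^ 2 := by positivity
    have h : i * (e * (θ * |c₁|) - 2) ^ 2 =
        (e * i) * e * (θ ^ 2 * |c₁| ^ 2) - 4 * (e * i) * (θ * |c₁|) + 4 * i := by ring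
    rw [h, hei, sq_abs] at this
    linarith
  have h4 : θ ^ 2 * e * R ^ 2 ≤ θ ^ 2 * e * (K ^ 2 * E ^ 2) := by gcongr
  have h5 : (2 * i - θ * |c₁|) * D ^ 2 ≤ θ * A * D ^ 2 := by gcongr
  have h6 : 2 * (θ * |c₁|) * D ^ 2 ≤ (2 * i + θ ^ 2 * c₁ ^ 2 / 2 * e) * D ^ 2 := by gcongr
  have h7 : 0 ≤ (1 + θ ^ 2 * K ^ 2) * e * (θ * D ^ 2) + θ * c₁ ^ 2 / 2 * e * E ^ 2 := by positivity
  nlinarith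

/-- Two solutions on `[a, S]` in the invariant region differ by `O(e^{κ a})`, with a constant
that depends on `S` but not on `a`. -/
lemma exists_stability (S : ℝ) : ∃ C, ∀ a y₁ z₁ y₂ z₂,
    P.IsSolOn (Icc a S) y₁ z₁ → P.IsSolOn (Icc a S) y₂ z₂ → ∀ s ∈ Icc a S,
      |y₁ s - y₂ s| ≤ C * exp (P.κ * a) ∧ |z₁ s - z₂ s| ≤ C * exp (P.κ * a) := by
  have hM := P.M_pos
  have hκ := P.κ_pos
  have hb := P.b_pos
  have hσ := P.σ_pos
  have hm := P.m_pos
  set Y := P.M / P.κ * exp (P.κ * S) with hY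
  set K := P.b * P.M * (exp (P.σ * Y) * P.σ) with hK
  set θ := 2 / P.b with hθ
  have hθ0 : 0 < θ := by positivity
  set G := 1 + θ ^ 2 * K ^ 2 + θ * P.c₁ ^ 2 / 2 with hG
  have hG0 : 0 ≤ G := by positivity
  set W := ((P.M / P.κ) ^ 2 + θ * P.M ^ 2) * exp (G / P.κ * exp (P.κ * S)) with hW
  have hW0 : 0 ≤ W := by positivity
  refine ⟨√(W * (1 + P.b / 2)), fun a y₁ z₁ y₂ z₂ h₁ h₂ s hs => ?_⟩
  have haS : a ≤ S := hs.1.trans hs.2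
  have ha : a ∈ Icc a S := left_mem_Icc.2 haS
  set V : ℝ → ℝ := fun t => (y₁ t - y₂ t) ^ 2 + θ * (z₁ t - z₂ t) ^ 2 with hV
  set H : ℝ → ℝ := fun t => V t * exp (-(G / P.κ * exp (P.κ * t))) with hH
  have hexp : ∀ t, HasDerivAt (fun s => exp (P.κ * s)) (exp (P.κ * t) * P.κ) t := fun t => by
    simpa using ((hasDerivAt_id t).const_mul P.κ).exp
  set V' : ℝ → ℝ := fun t => 2 * (y₁ t - y₂ t) * (z₁ t - z₂ t) + θ * (2 * (z₁ t - z₂ t) *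
    (P.rhs t (y₁ t) (z₁ t) - P.rhs t (y₂ t) (z₂ t))) with hV'
  have hVd : ∀ t ∈ Icc a S, HasDerivWithinAt V (V' t) (Icc a S) t := fun t ht => by
    have e1 := ((h₁.deriv_y t ht).sub (h₂.deriv_y t ht)).pow 2
    have e2 := (((h₁.deriv_z t ht).sub (h₂.deriv_z t ht)).pow 2).const_mul θ
    refine (e1.add e2).congr_deriv ?_
    simp [hV']
  have hV'le : ∀ t ∈ Icc a S, V' t ≤ G * exp (P.κ * t) * V t := fun t ht => by
    have hy1 := h₁.mem_y t ht
    have hy2 := h₂.mem_y t ht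
    have hz1 := h₁.mem_z t ht
    have hz2 := h₂.mem_z t ht
    have htY : P.M / P.κ * exp (P.κ * t) ≤ Y := by
      have := ht.2
      rw [hY]; gcongr
    have hei : exp (P.κ * t) * exp (-(P.κ * t)) = 1 := by rw [← Real.exp_add]; simp
    set R := -(P.b * exp (-(P.κ * t)) * z₂ t * (exp (P.σ * y₁ t) - exp (P.σ * y₂ t))) with hR
    set A := P.c₁ + P.m * (z₁ t + z₂ t) + P.b * exp (-(P.κ * t)) * exp (P.σ * y₁ t) with hA
    have hdiff : P.rhs t (y₁ t) (z₁ t) - P.rhs t (y₂ t) (z₂ t) = -A * (z₁ t - z₂ t) + R := by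
      simp only [rhs, hA, hR]; ring
    have hAle : P.b * exp (-(P.κ * t)) - |P.c₁| ≤ A := by
      have i1 := neg_abs_le P.c₁
      have i2 : 0 ≤ P.m * (z₁ t + z₂ t) := mul_nonneg hm.le (add_nonneg hz1.1 hz2.1)
      have i3 : P.b * exp (-(P.κ * t)) * 1 ≤ P.b * exp (-(P.κ * t)) * exp (P.σ * y₁ t) := by
        gcongr
        exact Real.one_le_exp (mul_nonneg hσ.le hy1.1)
      rw [hA]; linarith
    have hRle : |R| ≤ K * |y₁ t - y₂ t| := by
      have i1 : |P.b * exp (-(P.κ * t)) * z₂ t| ≤ P.b * P.M := by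
        rw [abs_of_nonneg (mul_nonneg (by positivity) hz2.1)]
        calc P.b * exp (-(P.κ * t)) * z₂ t
            ≤ P.b * exp (-(P.κ * t)) * (P.M * exp (P.κ * t)) := by gcongr; exact hz2.2
          _ = P.b * P.M * (exp (P.κ * t) * exp (-(P.κ * t))) := by ring
          _ = P.b * P.M := by rw [hei, mul_one]
      have i2 : |exp (P.σ * y₁ t) - exp (P.σ * y₂ t)| ≤
          exp (P.σ * Y) * |P.σ * y₁ t - P.σ * y₂ t| :=
        abs_exp_sub_exp_le (mul_le_mul_of_nonneg_left (hy1.2.trans htY) hσ.le)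
          (mul_le_mul_of_nonneg_left (hy2.2.trans htY) hσ.le)
      rw [← mul_sub, abs_mul, abs_of_pos hσ, ← mul_assoc] at i2
      rw [hR, abs_neg, abs_mul, hK, mul_assoc (P.b * P.M)]
      exact mul_le_mul i1 i2 (abs_nonneg _) (by positivity)
    have hRsq : R ^ 2 ≤ K ^ 2 * (y₁ t - y₂ t) ^ 2 := by
      rw [← sq_abs R, ← sq_abs (y₁ t - y₂ t), ← mul_pow]
      gcongr
    simp only [hV', hV]
    rw [hdiff]
    exact energy_deriv_le hb (exp_pos _) hei hAle hRsq
  have hHd : ∀ t ∈ Icc a S, HasDerivWithinAt H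
      ((V' t - G * exp (P.κ * t) * V t) * exp (-(G / P.κ * exp (P.κ * t)))) (Icc a S) t :=
    fun t ht => by
      refine ((hVd t ht).mul (((hexp t).const_mul (G / P.κ)).neg.exp.hasDerivWithinAt)).congr_deriv
        ?_
      simp only [Pi.neg_apply]
      field_simp
      ring
  have hanti : AntitoneOn H (Icc a S) :=
    antitoneOn_of_hasDerivWithinAt_nonpos (convex_Icc _ _)
      (fun t ht => (hHd t ht).continuousWithinAt)
      (fun t ht => (hHd t (interior_subset ht)).mono interior_subset)
      (fun t ht => mul_nonpos_of_nonpos_of_nonneg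
        (sub_nonpos.2 (hV'le t (interior_subset ht))) (exp_pos _).le)
  have hHs : H s ≤ H a := hanti ha hs hs.1
  have sq_le : ∀ {u v B : ℝ}, u ∈ Icc 0 B → v ∈ Icc 0 B → (u - v) ^ 2 ≤ B ^ 2 := fun hu hv =>
    sq_le_sq' (by linarith [hu.1, hv.2]) (by linarith [hu.2, hv.1])
  have hVa : V a ≤ ((P.M / P.κ) ^ 2 + θ * P.M ^ 2) * exp (P.κ * a) ^ 2 := by
    have i1 := sq_le (h₁.mem_y a ha) (h₂.mem_y a ha)
    have i2 := mul_le_mul_of_nonneg_left (sq_le (h₁.mem_z a ha) (h₂.mem_z a ha)) hθ0.le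
    simp only [hV]
    rw [mul_pow] at i1 i2
    linarith
  have hV0 : ∀ t, 0 ≤ V t := fun t => by simp only [hV]; positivity
  have hVs : V s ≤ W * exp (P.κ * a) ^ 2 := by
    have e1 : V s = H s * exp (G / P.κ * exp (P.κ * s)) := by
      simp only [hH]; rw [mul_assoc, ← Real.exp_add]; simp
    have e2 : H a ≤ V a := by
      simp only [hH]
      refine mul_le_of_le_one_right (hV0 a) (Real.exp_le_one_iff.2 ?_)
      rw [neg_nonpos]; positivity
    have e3 : exp (G / P.κ * exp (P.κ * s)) ≤ exp (G / P.κ * exp (P.κ * S)) := by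
      have := hs.2
      gcongr
    calc V s = H s * exp (G / P.κ * exp (P.κ * s)) := e1
      _ ≤ V a * exp (G / P.κ * exp (P.κ * S)) :=
        mul_le_mul (hHs.trans e2) e3 (exp_pos _).le (hV0 a)
      _ ≤ _ := by
        rw [hW, mul_right_comm]
        gcongr
  have hsq : (√(W * (1 + P.b / 2)) * exp (P.κ * a)) ^ 2 =
      W * exp (P.κ * a) ^ 2 * (1 + P.b / 2) := by
    rw [mul_pow, Real.sq_sqrt (by positivity)]; ring
  have hX : 0 ≤ W * exp (P.κ * a) ^ 2 := by positivity
  have hθb : P.b / 2 * θ = 1 := by rw [hθ]; field_simp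
  constructor
  · refine abs_le_of_sq_le_sq ?_ (by positivity)
    rw [hsq]
    have : (y₁ s - y₂ s) ^ 2 ≤ V s := le_add_of_nonneg_right (by positivity)
    have := mul_nonneg hX (by positivity : 0 ≤ P.b / 2)
    linarith
  · refine abs_le_of_sq_le_sq ?_ (by positivity)
    rw [hsq]
    have : (z₁ s - z₂ s) ^ 2 ≤ P.b / 2 * V s := by
      have : 0 ≤ P.b / 2 * (y₁ s - y₂ s) ^ 2 := by positivity
      simp only [hV]
      rw [mul_add, ← mul_assoc, hθb]
      linarith
    have := mul_le_mul_of_nonneg_left hVs (by positivity : 0 ≤ P.b / 2)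
    linarith

lemma exists_isSolOn_univ : ∃ y z, P.IsSolOn univ y z := by
  have hsol : ∀ k : ℕ, ∃ y z, P.IsSolOn (Icc (-(k : ℝ)) k) y z := fun k =>
    P.exists_isSolOn_Icc (by linarith [k.cast_nonneg (α := ℝ)])
  choose y z h using hsol
  choose C hC using P.exists_stability
  set u : ℕ → ℝ → ℝ × ℝ := fun k s => (y k s, z k s) with hu
  set B : ℝ → ℕ → ℝ := fun S k => C S * exp (P.κ * (-(k : ℝ))) with hB
  have hBlim : ∀ S, Tendsto (B S) atTop (nhds 0) := fun S => by
    have h1 : Tendsto (fun k : ℕ => P.κ * (-(k : ℝ))) atTop atBot :=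
      (tendsto_neg_atTop_atBot.comp tendsto_natCast_atTop_atTop).const_mul_atBot P.κ_pos
    have h2 := (Real.tendsto_exp_atBot.comp h1).const_mul (C S)
    rwa [mul_zero] at h2
  have hdist : ∀ S : ℝ, ∀ k j : ℕ, S ≤ k → k ≤ j → ∀ s ∈ Icc (-(k : ℝ)) S,
      dist (u k s) (u j s) ≤ B S k := by
    intro S k j hSk hkj s hs
    have hkj' : (k : ℝ) ≤ j := Nat.cast_le.2 hkj
    have := hC S _ _ _ _ _ ((h k).mono (Icc_subset_Icc_right hSk))
      ((h j).mono (Icc_subset_Icc (neg_le_neg hkj') (hSk.trans hkj'))) s hs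
    rw [Prod.dist_eq]
    exact max_le this.1 this.2
  have hlim : ∀ s, ∃ l, Tendsto (fun k => u k s) atTop (nhds l) := by
    intro s
    obtain ⟨N, hN⟩ := exists_nat_ge |s|
    have hcs : CauchySeq fun k => u (k + N) s := by
      refine cauchySeq_of_le_tendsto_0' (fun k => B s (k + N)) (fun k j hkj => ?_)
        ((hBlim s).comp (tendsto_add_atTop_nat N))
      have hk : |s| ≤ ((k + N : ℕ) : ℝ) := by
        push_cast; linarith [k.cast_nonneg (α := ℝ)]
      exact hdist s _ _ ((le_abs_self s).trans hk) (by omega) s ⟨neg_le_of_abs_le hk, le_rfl⟩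
    obtain ⟨l, hl⟩ := cauchySeq_tendsto_of_complete hcs
    exact ⟨l, (tendsto_add_atTop_iff_nat (f := fun k => u k s) N).1 hl⟩
  choose v hv using hlim
  have hvy : ∀ s, Tendsto (fun k => y k s) atTop (nhds (v s).1) := fun s =>
    (continuous_fst.tendsto _).comp (hv s)
  have hvz : ∀ s, Tendsto (fun k => z k s) atTop (nhds (v s).2) := fun s =>
    (continuous_snd.tendsto _).comp (hv s)
  have hev : ∀ S : ℝ, ∀ᶠ k : ℕ in atTop, S ≤ k := fun S =>
    tendsto_natCast_atTop_atTop.eventually_ge_atTop S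
  have hmem : ∀ s, ∀ᶠ k : ℕ in atTop, s ∈ Icc (-(k : ℝ)) k := fun s => by
    filter_upwards [hev |s|] with k hk using abs_le.1 hk
  have hv1 : ∀ s, (v s).1 ∈ Icc 0 (P.M / P.κ * exp (P.κ * s)) := fun s =>
    isClosed_Icc.mem_of_tendsto (hvy s) ((hmem s).mono fun k hk => (h k).mem_y s hk)
  have hv2 : ∀ s, (v s).2 ∈ Icc 0 (P.M * exp (P.κ * s)) := fun s =>
    isClosed_Icc.mem_of_tendsto (hvz s) ((hmem s).mono fun k hk => (h k).mem_z s hk)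
  have hvd : ∀ s, HasDerivAt v (P.field (s, v s)) s := by
    intro s
    set S := |s| + 1 with hS
    have hsS : s ∈ Ioo (-S) S := abs_lt.1 (by rw [hS]; linarith)
    obtain ⟨K, hK⟩ := P.exists_lipschitzOnWith_field (-S) S (P.M / P.κ * exp (P.κ * S))
      (P.M * exp (P.κ * S))
    have hM := P.M_pos
    have hκ := P.κ_pos
    have hbox : ∀ t ∈ Ioo (-S) S, ∀ p : ℝ × ℝ, p.1 ∈ Icc 0 (P.M / P.κ * exp (P.κ * t)) →
        p.2 ∈ Icc 0 (P.M * exp (P.κ * t)) →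
        (t, p) ∈ box (-S) S (P.M / P.κ * exp (P.κ * S)) (P.M * exp (P.κ * S)) := by
      intro t ht p h1 h2
      have := ht.2.le
      refine ⟨Ioo_subset_Icc_self ht, ⟨h1.1, h1.2.trans ?_⟩, ⟨h2.1, h2.2.trans ?_⟩⟩ <;> gcongr
    refine hasDerivAt_of_tendstoLocallyUniformlyOn (l := atTop) (f := u)
      (f' := fun k t => P.field (t, u k t)) (g' := fun t => P.field (t, v t)) isOpen_Ioo ?_ ?_
      (fun t _ => hv t) hsS
    · refine TendstoUniformlyOn.tendstoLocallyUniformlyOn ?_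
      rw [Metric.tendstoUniformlyOn_iff]
      intro ε hε
      have hKB : Tendsto (fun k => (K : ℝ) * B S k) atTop (nhds 0) := by
        simpa using (hBlim S).const_mul (K : ℝ)
      filter_upwards [hev S, hKB.eventually_lt_const hε] with k hk hkε t ht
      have htk : t ∈ Icc (-(k : ℝ)) k := ⟨by linarith [ht.1], by linarith [ht.2]⟩
      refine lt_of_le_of_lt ?_ hkε
      rw [dist_comm]
      refine (hK.dist_le_mul _ (hbox t ht _ ((h k).mem_y t htk) ((h k).mem_z t htk)) _
        (hbox t ht _ (hv1 t) (hv2 t))).trans ?_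
      gcongr
      have hle : dist (u k t) (v t) ≤ B S k := by
        refine le_of_tendsto (tendsto_const_nhds.dist (hv t)) ?_
        filter_upwards [eventually_ge_atTop k] with j hj
        exact hdist S k j hk hj t ⟨htk.1, ht.2.le⟩
      simpa [Prod.dist_eq] using! hle
    · filter_upwards [hev S] with k hk t ht
      have htk : t ∈ Icc (-(k : ℝ)) k := ⟨by linarith [ht.1], by linarith [ht.2]⟩
      have hn : Icc (-(k : ℝ)) k ∈ nhds t := Icc_mem_nhds (by linarith [ht.1]) (by linarith [ht.2])
      exact (((h k).deriv_y t htk).hasDerivAt hn).prodMk (((h k).deriv_z t htk).hasDerivAt hn)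
  exact ⟨fun s => (v s).1, fun s => (v s).2, fun s _ => (hvd s).hasDerivWithinAt.fst,
    fun s _ => (hvd s).hasDerivWithinAt.snd, fun s _ => hv1 s, fun s _ => hv2 s⟩

variable {P}

lemma tendsto_const_mul_exp_atBot (c : ℝ) :
    Tendsto (fun a => c * exp (P.κ * a)) atBot (nhds 0) := by
  simpa using! (Real.tendsto_exp_atBot.comp (tendsto_id.const_mul_atBot P.κ_pos)).const_mul c

lemma IsSolOn.unique {y₁ z₁ y₂ z₂ : ℝ → ℝ} (h₁ : P.IsSolOn univ y₁ z₁)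
    (h₂ : P.IsSolOn univ y₂ z₂) : y₁ = y₂ := by
  funext s
  obtain ⟨C, hC⟩ := P.exists_stability s
  have hle : |y₁ s - y₂ s| ≤ 0 := by
    refine ge_of_tendsto (tendsto_const_mul_exp_atBot (P := P) C) ?_
    filter_upwards [eventually_le_atBot s] with a ha
    exact (hC a _ _ _ _ (h₁.mono (subset_univ _)) (h₂.mono (subset_univ _)) s ⟨ha, le_rfl⟩).1
  exact sub_eq_zero.1 (abs_nonpos_iff.1 hle)

lemma IsSolOn.hasDerivAt_y {y z : ℝ → ℝ} (h : P.IsSolOn univ y z) (s : ℝ) :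
    HasDerivAt y (z s) s := (h.deriv_y s trivial).hasDerivAt univ_mem

lemma IsSolOn.hasDerivAt_z {y z : ℝ → ℝ} (h : P.IsSolOn univ y z) (s : ℝ) :
    HasDerivAt z (P.rhs s (y s) (z s)) s := (h.deriv_z s trivial).hasDerivAt univ_mem

lemma IsSolOn.z_pos {y z : ℝ → ℝ} (h : P.IsSolOn univ y z) (s : ℝ) : 0 < z s := by
  refine (h.mem_z s trivial).1.lt_of_ne' fun h0 => ?_
  have hmin : IsLocalMin z s := Eventually.of_forall fun t => by
    rw [h0]; exact (h.mem_z t trivial).1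
  have := hmin.hasDerivAt_eq_zero (h.hasDerivAt_z s)
  simp [rhs, h0, P.c₀_pos.ne'] at this

lemma IsSolOn.tendsto_y {y z : ℝ → ℝ} (h : P.IsSolOn univ y z) : Tendsto y atBot (nhds 0) :=
  squeeze_zero (fun s => (h.mem_y s trivial).1) (fun s => (h.mem_y s trivial).2)
    (tendsto_const_mul_exp_atBot _)

lemma isSolOn_univ_of_tendsto {y z : ℝ → ℝ} (hy : ∀ s, HasDerivAt y (z s) s)
    (hz : ∀ s, HasDerivAt z (P.rhs s (y s) (z s)) s)
    (hmem : ∀ s, z s ∈ Icc 0 (P.M * exp (P.κ * s))) (hlim : Tendsto y atBot (nhds 0)) :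
    P.IsSolOn univ y z := by
  refine ⟨fun s _ => (hy s).hasDerivWithinAt, fun s _ => (hz s).hasDerivWithinAt,
    fun s _ => ⟨?_, ?_⟩, fun s _ => hmem s⟩
  · exact (monotone_of_hasDerivAt_nonneg hy fun s => (hmem s).1).le_of_tendsto hlim s
  · have hexp : ∀ t, HasDerivAt (fun s => P.M / P.κ * exp (P.κ * s)) (P.M * exp (P.κ * t)) t :=
      fun t => by
        refine (((hasDerivAt_id t).const_mul P.κ).exp.const_mul (P.M / P.κ)).congr_deriv ?_
        have := P.κ_pos
        simp only [id]
        field_simp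
    have hmono : Monotone fun s => P.M / P.κ * exp (P.κ * s) - y s :=
      monotone_of_hasDerivAt_nonneg (fun s => (hexp s).sub (hy s))
        fun s => sub_nonneg.2 (hmem s).2
    have hl : Tendsto (fun s => P.M / P.κ * exp (P.κ * s) - y s) atBot (nhds 0) := by
      simpa using (tendsto_const_mul_exp_atBot (P := P) _).sub hlim
    exact sub_nonneg.1 (hmono.le_of_tendsto hl s)

end RiccatiData

/-- `f` is the function with `r^γ f(r) = η e^{y(log r)}` on `(0, ∞)`. -/
def IsProfile (η γ : ℝ) (y f : ℝ → ℝ) : Prop :=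
  ∀ r, 0 < r → f r = η * exp (y (log r) - γ * log r)

namespace IsProfile

variable {η γ : ℝ} {y z ζ f : ℝ → ℝ}

lemma pos (hf : IsProfile η γ y f) (hη : 0 < η) {r : ℝ} (hr : 0 < r) : 0 < f r := by
  rw [hf r hr]; positivity

lemma rpow_mul_eq (hf : IsProfile η γ y f) {r : ℝ} (hr : 0 < r) :
    r ^ γ * f r = η * exp (y (log r)) := by
  rw [hf r hr, Real.rpow_def_of_pos hr, mul_left_comm, ← Real.exp_add]
  ring_nf

lemma hasDerivAt (hf : IsProfile η γ y f) (hy : ∀ s, HasDerivAt y (z s) s) {r : ℝ} (hr : 0 < r) :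
    HasDerivAt f (f r * (z (log r) - γ) / r) r := by
  have hlog := Real.hasDerivAt_log hr.ne'
  have h := (((hy (log r)).comp r hlog).sub (hlog.const_mul γ)).exp.const_mul η
  have hev : f =ᶠ[nhds r] fun r => η * exp (y (log r) - γ * log r) :=
    eventually_of_mem (Ioi_mem_nhds hr) hf
  refine (h.congr_of_eventuallyEq hev).congr_deriv ?_
  rw [hf r hr]
  simp only [Function.comp_apply, Pi.sub_apply]
  ring

lemma hasDerivAt_rpow (hf : IsProfile η γ y f) (hη : 0 < η) (hy : ∀ s, HasDerivAt y (z s) s)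
    (m : ℝ) {r : ℝ} (hr : 0 < r) :
    HasDerivAt (fun r => f r ^ m) (m * (f r ^ m * (z (log r) - γ) / r)) r := by
  have hfr := hf.pos hη hr
  refine ((hf.hasDerivAt hy hr).rpow_const (Or.inl hfr.ne')).congr_deriv ?_
  rw [Real.rpow_sub_one hfr.ne']
  field_simp

lemma deriv_rpow_div (hf : IsProfile η γ y f) (hη : 0 < η) (hy : ∀ s, HasDerivAt y (z s) s)
    {m : ℝ} (hm : 0 < m) {r : ℝ} (hr : 0 < r) :
    deriv (fun r => f r ^ m / m) r = f r ^ m * (z (log r) - γ) / r := by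
  rw [((hf.hasDerivAt_rpow hη hy m hr).div_const m).deriv, mul_div_cancel_left₀ _ hm.ne']

lemma deriv_deriv_rpow_div (hf : IsProfile η γ y f) (hη : 0 < η)
    (hy : ∀ s, HasDerivAt y (z s) s) (hz : ∀ s, HasDerivAt z (ζ s) s)
    {m : ℝ} (hm : 0 < m) {r : ℝ} (hr : 0 < r) :
    deriv (deriv fun r => f r ^ m / m) r =
      f r ^ m * (m * (z (log r) - γ) ^ 2 + ζ (log r) - (z (log r) - γ)) / r ^ 2 := by
  have hev : (deriv fun r => f r ^ m / m) =ᶠ[nhds r] fun r => f r ^ m * (z (log r) - γ) / r :=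
    eventually_of_mem (Ioi_mem_nhds hr) fun x hx => hf.deriv_rpow_div hη hy hm hx
  have hlog := Real.hasDerivAt_log hr.ne'
  have h := ((hf.hasDerivAt_rpow hη hy m hr).mul
    (((hz (log r)).comp r hlog).sub_const γ)).div (hasDerivAt_id r) hr.ne'
  rw [hev.deriv_eq]
  refine (h.congr_deriv ?_).deriv
  simp only [Function.comp_apply, Pi.mul_apply, id]
  field_simp

lemma contDiffOn (hf : IsProfile η γ y f) (hη : 0 < η) (hy : ContDiff ℝ 2 y) {m : ℝ} :
    ContDiffOn ℝ 2 (fun r => f r ^ m / m) (Ioi 0) := by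
  have hlog : ContDiffOn ℝ 2 log (Ioi 0) := Real.contDiffOn_log.mono fun r hr => ne_of_gt hr
  have h : ContDiffOn ℝ 2 f (Ioi 0) :=
    ((contDiffOn_const.mul ((hy.comp_contDiffOn hlog).sub (contDiffOn_const.mul hlog)).exp).congr
      fun r hr => hf r hr)
  exact (h.rpow_const_of_ne fun r hr => (hf.pos hη hr).ne').div_const m

lemma zfun_eq {α β : ℝ} (hf : IsProfile η (α / β) y f) (hη : 0 < η)
    (hy : ∀ s, HasDerivAt y (z s) s) (s : ℝ) : Zfun α β f s = z s := by
  have hev : (fun r => r ^ (α / β) * f r) =ᶠ[nhds (exp s)] fun r => η * exp (y (log r)) :=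
    eventually_of_mem (Ioi_mem_nhds (exp_pos s)) fun r hr => hf.rpow_mul_eq hr
  have h := ((hy (log (exp s))).comp (exp s)
    (Real.hasDerivAt_log (exp_pos s).ne')).exp.const_mul η
  rw [Zfun, hev.deriv_eq, hf.rpow_mul_eq (exp_pos s)]
  erw [h.deriv]
  simp only [Function.comp_apply, Real.log_exp]
  field_simp

/-- The profile equation for `f` is equivalent to the first-order equation for the logarithmic
derivative `z`. -/
lemma ode_iff (hη : 0 < η) {m α β N : ℝ} (hm : 0 < m) (hβ : 0 < β)
    (hf : IsProfile η (α / β) y f) (hy : ∀ s, HasDerivAt y (z s) s)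
    (hz : ∀ s, HasDerivAt z (ζ s) s) (P : RiccatiData)
    (h₀ : P.c₀ = α / β * (N - 2 - m * (α / β))) (h₁ : P.c₁ = N - 2 - 2 * m * (α / β))
    (h₂ : P.m = m) (h₃ : P.b = β * η ^ (1 - m)) (h₄ : P.κ = (1 - m) * (α / β) - 2)
    (h₅ : P.σ = 1 - m) (s : ℝ) :
    deriv (deriv fun r => f r ^ m / m) (exp s)
      + (N - 1) / exp s * deriv (fun r => f r ^ m / m) (exp s)
      + α * f (exp s) + β * exp s * deriv f (exp s) = 0 ↔ ζ s = P.rhs s (y s) (z s) := by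
  have hr := exp_pos s
  have hfr := hf.pos hη hr
  rw [hf.deriv_deriv_rpow_div hη hy hz hm hr, hf.deriv_rpow_div hη hy hm hr,
    (hf.hasDerivAt hy hr).deriv, Real.log_exp]
  have hkey : exp s ^ 2 * f (exp s) ^ (1 - m) =
      η ^ (1 - m) * (exp (-(P.κ * s)) * exp (P.σ * y s)) := by
    rw [hf _ hr, Real.log_exp, Real.mul_rpow hη.le (exp_pos _).le, ← Real.exp_mul,
      ← Real.exp_nat_mul, mul_left_comm, ← Real.exp_add, ← Real.exp_add, h₄, h₅]
    congr 2
    push_cast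
    ring
  have hsplit : f (exp s) = f (exp s) ^ m * f (exp s) ^ (1 - m) := by
    rw [← Real.rpow_add hfr]; simp
  have hfm : 0 < f (exp s) ^ m := Real.rpow_pos_of_pos hfr m
  have hres : f (exp s) ^ m * (m * (z s - α / β) ^ 2 + ζ s - (z s - α / β)) / exp s ^ 2
      + (N - 1) / exp s * (f (exp s) ^ m * (z s - α / β) / exp s) + α * f (exp s)
      + β * exp s * (f (exp s) * (z s - α / β) / exp s) =
      f (exp s) ^ m / exp s ^ 2 * (ζ s - P.rhs s (y s) (z s)) := by
    have hrhs : P.rhs s (y s) (z s) = -(m * (z s - α / β) ^ 2) - (N - 2) * (z s - α / β)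
        - β * (exp s ^ 2 * f (exp s) ^ (1 - m)) * z s := by
      rw [hkey, RiccatiData.rhs, h₀, h₁, h₂, h₃]
      ring
    have hlin : α * f (exp s) + β * exp s * (f (exp s) * (z s - α / β) / exp s) =
        β * (f (exp s) ^ m * f (exp s) ^ (1 - m)) * z s := by
      rw [← hsplit]
      field_simp
      ring
    rw [add_assoc, hlin, hrhs]
    field_simp
    ring
  rw [hres, mul_eq_zero, sub_eq_zero, or_iff_right (by positivity)]

end IsProfile

/-- Logarithmic coordinates turn a positive `C²` profile into a `C²` function on the line. -/
lemma FDESol.exists_isProfile {n : ℕ} {m α β η : ℝ} {f : ℝ → ℝ} (hη : 0 < η) (hm : 0 < m)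
    (hf : FDESol n m α β η f) : ∃ y, ContDiff ℝ 2 y ∧ IsProfile η (α / β) y f ∧
      Tendsto y atBot (nhds 0) := by
  obtain ⟨hpos, hsmooth, -, hlim⟩ := hf
  have hfs : ContDiffOn ℝ 2 f (Ioi 0) := by
    refine ((contDiffOn_const.mul hsmooth).rpow_const_of_ne (p := m⁻¹)
      (f := fun r => m * (f r ^ m / m)) fun r hr => ?_).congr fun r hr => ?_
    · have := Real.rpow_pos_of_pos (hpos r hr) m
      positivity
    · have := hpos r hr
      rw [mul_div_cancel₀ _ hm.ne', Real.rpow_rpow_inv this.le hm.ne']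
  refine ⟨fun s => log (exp s ^ (α / β) * f (exp s)) - log η, ?_, fun r hr => ?_, ?_⟩
  · have h1 : ContDiff ℝ 2 fun s => f (exp s) := by
      rw [← contDiffOn_univ]
      exact hfs.comp Real.contDiff_exp.contDiffOn fun s _ => exp_pos s
    refine ContDiff.sub (ContDiff.log (ContDiff.mul ?_ h1) fun s => ?_) contDiff_const
    · exact Real.contDiff_exp.rpow_const_of_ne fun s => (exp_pos s).ne'
    · have := hpos _ (exp_pos s)
      positivity
  · have hfr := hpos r hr
    have hrp := Real.rpow_pos_of_pos hr (α / β)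
    simp only
    rw [Real.exp_log hr, Real.log_mul hrp.ne' hfr.ne', Real.log_rpow hr,
      show α / β * log r + log (f r) - log η - α / β * log r = log (f r) - log η by ring,
      Real.exp_sub, Real.exp_log hfr, Real.exp_log hη]
    field_simp
  · have h1 : Tendsto (fun s => exp s ^ (α / β) * f (exp s)) atBot (nhds η) :=
      hlim.comp Real.tendsto_exp_atBot_nhdsGT
    simpa using! ((Real.continuousAt_log hη.ne').tendsto.comp h1).sub_const (log η)

theorem stmt0 (n : ℕ) (m ρ1 η β α C1 C2 C3 C4 : ℝ)
    (hn : 3 ≤ n) (hm0 : 0 < m) (hm1 : m < ((n : ℝ) - 2) / (n : ℝ))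
    (hρ1 : 0 < ρ1) (hη : 0 < η)
    (hβ : m * ρ1 / ((n : ℝ) - 2 - (n : ℝ) * m) < β)
    (hα : α = (2 * β + ρ1) / (1 - m))
    (hC1 : C1 = 1 / (2 * m) * ((n : ℝ) - 2 - 2 * m * α / β))
    (hC2 : C2 = α / β * ((n : ℝ) - 2 - m * α / β))
    (hC3 : C3 = C2 + m * C1 ^ 2)
    (hC4 : C4 = C3 / β) :
    ∃ f : ℝ → ℝ, (FDESol n m α β η f ∧ FDEZBound m α β ρ1 η C4 f) ∧
      ∀ f' : ℝ → ℝ, FDESol n m α β η f' ∧ FDEZBound m α β ρ1 η C4 f' →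
        Set.EqOn f' f (Set.Ioi 0) := by
  have hn' : (3 : ℝ) ≤ n := by exact_mod_cast hn
  have hnm : 0 < (n : ℝ) - 2 - n * m := by
    rw [lt_div_iff₀ (by linarith)] at hm1
    linarith
  have hm1' : 0 < 1 - m := by nlinarith
  have hβ0 : 0 < β := lt_trans (by positivity) hβ
  have hα0 : 0 < α := by rw [hα]; positivity
  have hκ : ρ1 / β = (1 - m) * (α / β) - 2 := by
    rw [hα]; field_simp; ring
  have hC2pos : 0 < C2 := by
    have h1 : m * (α / β) < n - 2 := by
      rw [div_lt_iff₀ hnm] at hβ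
      rw [hα, ← mul_div_assoc, div_lt_iff₀ hβ0, ← mul_div_assoc, div_lt_iff₀ hm1']
      nlinarith
    rw [hC2, mul_div_assoc]
    exact mul_pos (by positivity) (by linarith)
  have hηm : 0 < η ^ (1 - m) := Real.rpow_pos_of_pos hη _
  have hbM : β * η ^ (1 - m) * (C4 * η ^ (m - 1)) = C3 := by
    have : η ^ (1 - m) * η ^ (m - 1) = 1 := by rw [← Real.rpow_add hη]; simp
    calc β * η ^ (1 - m) * (C4 * η ^ (m - 1)) = β * C4 * (η ^ (1 - m) * η ^ (m - 1)) := by ring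
      _ = C3 := by rw [this, hC4]; field_simp
  let P : RiccatiData :=
    { c₀ := C2, c₁ := n - 2 - 2 * m * (α / β), m := m, b := β * η ^ (1 - m), κ := ρ1 / β
      σ := 1 - m, M := C4 * η ^ (m - 1)
      c₀_pos := hC2pos, m_pos := hm0, b_pos := by positivity, κ_pos := by positivity
      σ_pos := hm1'
      barrier := fun z => by
        have h1 : (n : ℝ) - 2 - 2 * m * (α / β) = 2 * m * C1 := by
          rw [hC1]; field_simp
        rw [hbM, hC3, h1]
        nlinarith [mul_nonneg hm0.le (sq_nonneg (z + C1))] }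
  have hode : ∀ {y z ζ f : ℝ → ℝ}, IsProfile η (α / β) y f → (∀ s, HasDerivAt y (z s) s) →
      (∀ s, HasDerivAt z (ζ s) s) → ∀ s,
      (deriv (deriv fun r => f r ^ m / m) (exp s)
        + ((n : ℝ) - 1) / exp s * deriv (fun r => f r ^ m / m) (exp s)
        + α * f (exp s) + β * exp s * deriv f (exp s) = 0 ↔ ζ s = P.rhs s (y s) (z s)) :=
    fun hf hy hz => hf.ode_iff hη hm0 hβ0 hy hz P (by simp only [P, hC2]; ring) rfl rfl rfl hκ rfl
  have hscale : ∀ Z s : ℝ, Z * exp (-(ρ1 / β) * s) ≤ P.M ↔ Z ≤ P.M * exp (P.κ * s) := fun Z s => by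
    rw [neg_mul, Real.exp_neg, ← div_eq_mul_inv, div_le_iff₀ (exp_pos _)]
  obtain ⟨y, z, h⟩ := P.exists_isSolOn_univ
  set f : ℝ → ℝ := fun r => η * exp (y (log r) - α / β * log r)
  have hf : IsProfile η (α / β) y f := fun r _ => rfl
  have hy2 : ContDiff ℝ 2 y := by
    have hdy : deriv y = z := funext fun s => (h.hasDerivAt_y s).deriv
    have hdz : deriv z = fun s => P.rhs s (y s) (z s) := funext fun s => (h.hasDerivAt_z s).deriv
    have hyd : Differentiable ℝ y := fun s => (h.hasDerivAt_y s).differentiableAt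
    have hzd : Differentiable ℝ z := fun s => (h.hasDerivAt_z s).differentiableAt
    have hyc := hyd.continuous
    have hzc := hzd.continuous
    refine (contDiff_succ_iff_deriv (n := 1)).2 ⟨hyd, by simp, ?_⟩
    rw [hdy, contDiff_one_iff_deriv, hdz]
    refine ⟨hzd, ?_⟩
    unfold RiccatiData.rhs
    fun_prop
  refine ⟨f, ⟨⟨fun r hr => hf.pos hη hr, hf.contDiffOn hη hy2, fun r hr => ?_, ?_⟩, fun s => ?_⟩,
    fun g ⟨hg, hgZ⟩ => ?_⟩
  · have := (hode hf h.hasDerivAt_y h.hasDerivAt_z (log r)).2 rfl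
    rwa [Real.exp_log hr] at this
  · have hlim : Tendsto (fun r => η * exp (y (log r))) (nhdsWithin 0 (Ioi 0)) (nhds η) := by
      have h1 := (h.tendsto_y.comp Real.tendsto_log_nhdsGT_zero).rexp.const_mul η
      rwa [Real.exp_zero, mul_one] at h1
    refine hlim.congr' ?_
    filter_upwards [self_mem_nhdsWithin] with r hr using (hf.rpow_mul_eq hr).symm
  · rw [hf.zfun_eq hη h.hasDerivAt_y]
    exact ⟨mul_pos (h.z_pos s) (exp_pos _), (hscale _ s).2 (h.mem_z s trivial).2⟩
  · obtain ⟨y', hy', hgy, hlim⟩ := hg.exists_isProfile hη hm0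
    have hy'1 : ∀ s, HasDerivAt y' (deriv y' s) s := fun s =>
      (hy'.differentiable two_ne_zero s).hasDerivAt
    have hy'2 : ∀ s, HasDerivAt (deriv y') (deriv (deriv y') s) s := fun s =>
      (((contDiff_succ_iff_deriv (n := 1)).1 hy').2.2.differentiable one_ne_zero s).hasDerivAt
    have hrhs : ∀ s, deriv (deriv y') s = P.rhs s (y' s) (deriv y' s) := fun s =>
      (hode hgy hy'1 hy'2 s).1 (hg.2.2.1 _ (exp_pos s))
    have h' : P.IsSolOn univ y' (deriv y') := by
      refine RiccatiData.isSolOn_univ_of_tendsto hy'1 (fun s => hrhs s ▸ hy'2 s) (fun s => ?_) hlim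
      have hb := hgZ s
      rw [hgy.zfun_eq hη hy'1] at hb
      exact ⟨(pos_of_mul_pos_left hb.1 (exp_pos _).le).le, (hscale _ s).1 hb.2⟩
    intro r hr
    rw [hgy r hr, hf r hr, h'.unique h]
end

section
/- There exists a unique positive function f on (0,∞) such that r ↦ f(r)^m/m is twice continuously differentiable on (0,∞), (f^m/m)''(r) + ((n-1)/r)·(f^m/m)'(r) + α·f(r) + β·r·f'(r) = 0 for all r > 0, and lim_{r→0+} r^{α/β}·f(r) = η. -/
open Real Set Filter

/-- `v` is a positive solution on `(-∞, T)` of `v'' + (A + e^{-κ s} G(v)) v' = B v`, with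
derivative `p`, which tends to `v₀` at `-∞`. -/
structure IsProfileOn (κ A B : ℝ) (G : ℝ → ℝ) (v₀ T : ℝ) (v p : ℝ → ℝ) : Prop where
  pos : ∀ s < T, 0 < v s
  hasDerivAt : ∀ s < T, HasDerivAt v (p s) s
  hasDerivAt_deriv : ∀ s < T, HasDerivAt p (B * v s - (A + exp (-κ * s) * G (v s)) * p s) s
  tendsto : Tendsto v atBot (nhds v₀)

theorem exists_bounds_on_Icc {G : ℝ → ℝ} (hGc : ContinuousOn G (Ioi 0))
    (hGpos : ∀ x > 0, 0 < G x) {a b : ℝ} (ha : 0 < a) (hab : a ≤ b) :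
    ∃ g₀ g₁ : ℝ, 0 < g₀ ∧ g₀ ≤ g₁ ∧ ∀ x ∈ Icc a b, g₀ ≤ G x ∧ G x ≤ g₁ := by
  have hsub : Icc a b ⊆ Ioi 0 := fun x hx => lt_of_lt_of_le ha hx.1
  have hne : (Icc a b).Nonempty := ⟨a, le_rfl, hab⟩
  obtain ⟨x₀, hx₀, h₀⟩ := isCompact_Icc.exists_isMinOn hne (hGc.mono hsub)
  obtain ⟨x₁, hx₁, h₁⟩ := isCompact_Icc.exists_isMaxOn hne (hGc.mono hsub)
  exact ⟨G x₀, G x₁, hGpos _ (hsub hx₀), h₀ hx₁, fun x hx => ⟨h₀ hx, h₁ hx⟩⟩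

theorem abs_sub_le_of_deriv_bounds {H G : ℝ → ℝ} {a b g₁ : ℝ}
    (hH : ∀ x ∈ Icc a b, HasDerivAt H (G x) x) (hG : ∀ x ∈ Icc a b, |G x| ≤ g₁)
    {x y : ℝ} (hx : x ∈ Icc a b) (hy : y ∈ Icc a b) : |H x - H y| ≤ g₁ * |x - y| := by
  simpa [Real.norm_eq_abs] using (convex_Icc a b).norm_image_sub_le_of_norm_hasDerivWithin_le
    (fun z hz => (hH z hz).hasDerivWithinAt) (fun z hz => by simpa using hG z hz) hy hx

theorem mul_sub_le_sub_of_deriv_bounds {H G : ℝ → ℝ} {a b g₀ : ℝ}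
    (hH : ∀ x ∈ Icc a b, HasDerivAt H (G x) x) (hG : ∀ x ∈ Icc a b, g₀ ≤ G x)
    {x y : ℝ} (hx : x ∈ Icc a b) (hy : y ∈ Icc a b) (hyx : y ≤ x) :
    g₀ * (x - y) ≤ H x - H y := by
  refine (convex_Icc a b).mul_sub_le_image_sub_of_le_deriv
    (fun z hz => (hH z hz).continuousAt.continuousWithinAt)
    (fun z hz => (hH z (interior_subset hz)).differentiableAt.differentiableWithinAt)
    (fun z hz => ?_) y hy x hx hyx
  rw [(hH z (interior_subset hz)).deriv]
  exact hG z (interior_subset hz)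

theorem deriv_nonneg_of_le_left {w : ℝ → ℝ} {w' s : ℝ} (h : HasDerivAt w w' s)
    (hw : ∀ σ ≤ s, w σ ≤ w s) : 0 ≤ w' := by
  have h1 := (hasDerivAt_iff_tendsto_slope_left_right.1 h).1
  refine ge_of_tendsto h1 ?_
  filter_upwards [self_mem_nhdsWithin] with σ hσ
  rw [slope_def_field]
  exact div_nonneg_of_nonpos (sub_nonpos.2 (hw σ (le_of_lt hσ))) (sub_nonpos.2 (le_of_lt hσ))

/-- A first integral of the profile equation up to a zeroth order term. -/
noncomputable def profileFlux (κ A : ℝ) (H v p : ℝ → ℝ) (s : ℝ) : ℝ :=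
  exp (κ * s) * p s + H (v s) - (κ - A) * exp (κ * s) * v s

namespace IsProfileOn

variable {κ A B v₀ T : ℝ} {G H : ℝ → ℝ} {v p v₁ p₁ v₂ p₂ : ℝ → ℝ}

theorem mono (h : IsProfileOn κ A B G v₀ T v p) {T' : ℝ} (hT : T' ≤ T) :
    IsProfileOn κ A B G v₀ T' v p :=
  ⟨fun s hs => h.pos s (hs.trans_le hT), fun s hs => h.hasDerivAt s (hs.trans_le hT),
    fun s hs => h.hasDerivAt_deriv s (hs.trans_le hT), h.tendsto⟩

theorem hasDerivAt_exp_mul (κ s : ℝ) : HasDerivAt (fun s => exp (κ * s)) (κ * exp (κ * s)) s := by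
  have := ((hasDerivAt_id s).const_mul κ).exp
  simpa [mul_comm] using this

theorem hasDerivAt_flux (h : IsProfileOn κ A B G v₀ T v p)
    (hH : ∀ x > 0, HasDerivAt H (G x) x) {s : ℝ} (hs : s < T) :
    HasDerivAt (profileFlux κ A H v p) ((B - κ ^ 2 + A * κ) * exp (κ * s) * v s) s := by
  have he := hasDerivAt_exp_mul κ s
  have h1 := (he.mul (h.hasDerivAt_deriv s hs)).add
    ((hH _ (h.pos s hs)).comp s (h.hasDerivAt s hs))
  have h2 := h1.sub ((he.const_mul (κ - A)).mul (h.hasDerivAt s hs))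
  refine h2.congr_deriv ?_
  have : exp (κ * s) * exp (-κ * s) = 1 := by rw [← exp_add]; simp
  linear_combination (-(G (v s)) * p s) * this

theorem exists_flux_sub_lt (h₁ : IsProfileOn κ A B G v₀ T v₁ p₁)
    (h₂ : IsProfileOn κ A B G v₀ T v₂ p₂) (hκ : 0 < κ)
    (hH : ContinuousAt H v₀) (s : ℝ) {ε : ℝ} (hε : 0 < ε) :
    ∃ σ < s, |profileFlux κ A H v₁ p₁ σ - profileFlux κ A H v₂ p₂ σ| < ε := by
  set δ := ε / (4 + |κ - A|) with hδ
  have hd : 0 < 4 + |κ - A| := by positivity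
  have hδ0 : 0 < δ := by positivity
  have hδε : δ * (4 + |κ - A|) = ε := by rw [hδ]; field_simp
  have t1 : Tendsto (fun s => v₁ s - v₂ s) atBot (nhds 0) := by
    simpa using h₁.tendsto.sub h₂.tendsto
  have t2 : Tendsto (fun s => H (v₁ s) - H (v₂ s)) atBot (nhds 0) := by
    simpa using (hH.tendsto.comp h₁.tendsto).sub (hH.tendsto.comp h₂.tendsto)
  have e1 := (Metric.tendsto_nhds.1 t1 δ hδ0)
  have e2 := (Metric.tendsto_nhds.1 t2 δ hδ0)
  obtain ⟨N, hN⟩ := eventually_atBot.1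
    ((e1.and e2).and ((eventually_le_atBot 0).and ((eventually_lt_atBot s).and
      (eventually_lt_atBot T))))
  have hNT := (hN N le_rfl).2.2.2
  obtain ⟨ξ, hξ, hξ'⟩ := exists_hasDerivAt_eq_slope (fun s => v₁ s - v₂ s)
    (fun s => p₁ s - p₂ s) (sub_one_lt N)
    (fun x hx => ((h₁.hasDerivAt x (hx.2.trans_lt hNT)).sub
      (h₂.hasDerivAt x (hx.2.trans_lt hNT))).continuousAt.continuousWithinAt)
    (fun x hx => (h₁.hasDerivAt x (hx.2.trans hNT)).sub (h₂.hasDerivAt x (hx.2.trans hNT)))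
  obtain ⟨⟨a1, a2⟩, a3, a4, -⟩ := hN ξ hξ.2.le
  have b1 := (hN N le_rfl).1.1
  have b2 := (hN (N - 1) (by linarith)).1.1
  simp only [dist_zero_right, Real.norm_eq_abs] at a1 a2 b1 b2
  refine ⟨ξ, a4, ?_⟩
  have hp : |p₁ ξ - p₂ ξ| < 2 * δ := by
    simp only [hξ', sub_sub_cancel, div_one]
    rw [abs_lt] at *
    constructor <;> linarith
  have he : exp (κ * ξ) ≤ 1 := exp_le_one_iff.2 (mul_nonpos_of_nonneg_of_nonpos hκ.le a3)
  have he0 := exp_pos (κ * ξ)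
  have key : profileFlux κ A H v₁ p₁ ξ - profileFlux κ A H v₂ p₂ ξ
      = exp (κ * ξ) * (p₁ ξ - p₂ ξ) + (H (v₁ ξ) - H (v₂ ξ))
        - (κ - A) * (exp (κ * ξ) * (v₁ ξ - v₂ ξ)) := by
    unfold profileFlux; ring
  have q1 : |exp (κ * ξ) * (p₁ ξ - p₂ ξ)| ≤ 2 * δ := by
    rw [abs_mul, abs_of_pos he0]; nlinarith [abs_nonneg (p₁ ξ - p₂ ξ)]
  have q2 : |(κ - A) * (exp (κ * ξ) * (v₁ ξ - v₂ ξ))| ≤ |κ - A| * δ := by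
    rw [abs_mul, abs_mul, abs_of_pos he0]
    refine mul_le_mul_of_nonneg_left ?_ (abs_nonneg _)
    nlinarith [abs_nonneg (v₁ ξ - v₂ ξ)]
  rw [key]
  calc _ ≤ |exp (κ * ξ) * (p₁ ξ - p₂ ξ)| + |H (v₁ ξ) - H (v₂ ξ)|
        + |(κ - A) * (exp (κ * ξ) * (v₁ ξ - v₂ ξ))| :=
        (abs_sub _ _).trans (add_le_add_left (abs_add_le _ _) _)
    _ < ε := by nlinarith

theorem abs_flux_sub_le (h₁ : IsProfileOn κ A B G v₀ T v₁ p₁)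
    (h₂ : IsProfileOn κ A B G v₀ T v₂ p₂) (hκ : 0 < κ) (hv₀ : 0 < v₀)
    (hH : ∀ x > 0, HasDerivAt H (G x) x) {s M : ℝ} (hs : s < T)
    (hM : ∀ σ ≤ s, |v₁ σ - v₂ σ| ≤ M) :
    |profileFlux κ A H v₁ p₁ s - profileFlux κ A H v₂ p₂ s|
      ≤ |B - κ ^ 2 + A * κ| * M * exp (κ * s) / κ := by
  set C := B - κ ^ 2 + A * κ with hC
  refine le_of_forall_pos_le_add fun ε hε => ?_
  obtain ⟨σ, hσ, hσε⟩ := h₁.exists_flux_sub_lt h₂ hκ (hH v₀ hv₀).continuousAt s hε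
  have hM0 : 0 ≤ M := (abs_nonneg _).trans (hM s le_rfl)
  have hd : ∀ x ≤ s, HasDerivAt
      (fun x => profileFlux κ A H v₁ p₁ x - profileFlux κ A H v₂ p₂ x)
      (C * exp (κ * x) * (v₁ x - v₂ x)) x := fun x hx =>
    ((h₁.hasDerivAt_flux hH (hx.trans_lt hs)).sub
      (h₂.hasDerivAt_flux hH (hx.trans_lt hs))).congr_deriv (by ring)
  have := image_norm_le_of_norm_deriv_right_le_deriv_boundary (a := σ) (b := s)
    (f := fun x => profileFlux κ A H v₁ p₁ x - profileFlux κ A H v₂ p₂ x)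
    (f' := fun x => C * exp (κ * x) * (v₁ x - v₂ x))
    (B := fun x => ε + |C| * M / κ * (exp (κ * x) - exp (κ * σ)))
    (B' := fun x => |C| * M * exp (κ * x))
    (fun x hx => (hd x hx.2).continuousAt.continuousWithinAt)
    (fun x hx => (hd x hx.2.le).hasDerivWithinAt)
    (by simpa using hσε.le)
    (fun x => ((((hasDerivAt_exp_mul κ x).sub_const _).const_mul _).const_add _).congr_deriv
      (by field_simp))
    (fun x hx => by
      rw [Real.norm_eq_abs, abs_mul, abs_mul, abs_of_pos (exp_pos _)]
      nlinarith [hM x hx.2.le, mul_nonneg (abs_nonneg C) (exp_pos (κ * x)).le])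
    (right_mem_Icc.2 hσ.le)
  simp only [Real.norm_eq_abs] at this
  refine this.trans ?_
  have h3 : 0 ≤ |C| * M / κ * exp (κ * σ) := by positivity
  have h4 : |C| * M * exp (κ * s) / κ = |C| * M / κ * exp (κ * s) := by ring
  rw [h4]; linarith

theorem sub_nonpos_of_isMax (h₁ : IsProfileOn κ A B G v₀ T v₁ p₁)
    (h₂ : IsProfileOn κ A B G v₀ T v₂ p₂) (hκ : 0 < κ) (hv₀ : 0 < v₀)
    (hH : ∀ x > 0, HasDerivAt H (G x) x) {a b g₀ : ℝ} (ha : 0 < a)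
    (hG : ∀ x ∈ Icc a b, g₀ ≤ G x) {s : ℝ} (hs : s < T)
    (hmem₁ : v₁ s ∈ Icc a b) (hmem₂ : v₂ s ∈ Icc a b)
    (hsmall : exp (κ * s) * (|κ - A| + |B - κ ^ 2 + A * κ| / κ) < g₀)
    (hmax : ∀ σ ≤ s, |v₁ σ - v₂ σ| ≤ v₁ s - v₂ s) : v₁ s - v₂ s ≤ 0 := by
  by_contra! hpos
  have hp : 0 ≤ p₁ s - p₂ s := deriv_nonneg_of_le_left
    ((h₁.hasDerivAt s hs).sub (h₂.hasDerivAt s hs)) fun σ hσ => (le_abs_self _).trans (hmax σ hσ)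
  have hF := (le_abs_self _).trans (h₁.abs_flux_sub_le h₂ hκ hv₀ hH hs hmax)
  have hHl := mul_sub_le_sub_of_deriv_bounds (fun x hx => hH x (ha.trans_le hx.1)) hG
    hmem₁ hmem₂ (by linarith)
  have key : profileFlux κ A H v₁ p₁ s - profileFlux κ A H v₂ p₂ s
      = exp (κ * s) * (p₁ s - p₂ s) + (H (v₁ s) - H (v₂ s))
        - (κ - A) * (exp (κ * s) * (v₁ s - v₂ s)) := by
    unfold profileFlux; ring
  have h5 : (κ - A) * (exp (κ * s) * (v₁ s - v₂ s)) ≤ |κ - A| * (exp (κ * s) * (v₁ s - v₂ s)) :=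
    mul_le_mul_of_nonneg_right (le_abs_self _) (by positivity)
  have h6 : 0 ≤ exp (κ * s) * (p₁ s - p₂ s) := by positivity
  have h7 := mul_lt_mul_of_pos_right hsmall hpos
  have h8 : exp (κ * s) * (|κ - A| + |B - κ ^ 2 + A * κ| / κ) * (v₁ s - v₂ s) =
     |κ - A| * (exp (κ * s) * (v₁ s - v₂ s)) +
     |B - κ ^ 2 + A * κ| * (v₁ s - v₂ s) * exp (κ * s) / κ := by ring
  linarith

theorem tendsto_exp_mul_atBot (hκ : 0 < κ) : Tendsto (fun s => exp (κ * s)) atBot (nhds 0) :=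
  tendsto_exp_atBot.comp (tendsto_id.const_mul_atBot hκ)

theorem eventually_eq (h₁ : IsProfileOn κ A B G v₀ T v₁ p₁)
    (h₂ : IsProfileOn κ A B G v₀ T v₂ p₂) (hκ : 0 < κ) (hv₀ : 0 < v₀)
    (hH : ∀ x > 0, HasDerivAt H (G x) x) (hGc : ContinuousOn G (Ioi 0))
    (hGpos : ∀ x > 0, 0 < G x) : ∃ Y < T, ∀ s ≤ Y, v₁ s = v₂ s := by
  obtain ⟨g₀, g₁, hg₀, -, hG⟩ := exists_bounds_on_Icc hGc hGpos
    (a := v₀ / 2) (b := 2 * v₀) (by positivity) (by linarith)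
  have hI : Icc (v₀ / 2) (2 * v₀) ∈ nhds v₀ := Icc_mem_nhds (by linarith) (by linarith)
  have hsm : Tendsto (fun s => exp (κ * s) * (|κ - A| + |B - κ ^ 2 + A * κ| / κ)) atBot
      (nhds 0) := by
    simpa using (tendsto_exp_mul_atBot hκ).mul_const (|κ - A| + |B - κ ^ 2 + A * κ| / κ)
  obtain ⟨Y, hY⟩ := eventually_atBot.1 ((h₁.tendsto.eventually hI).and
    ((h₂.tendsto.eventually hI).and ((hsm.eventually (gt_mem_nhds hg₀)).and
      (eventually_lt_atBot T))))
  refine ⟨Y, (hY Y le_rfl).2.2.2, fun s hs => ?_⟩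
  by_contra hne
  have hw : 0 < |v₁ s - v₂ s| := abs_pos.2 (sub_ne_zero.2 hne)
  have t1 : Tendsto (fun s => |v₁ s - v₂ s|) atBot (nhds 0) := by
    simpa using (h₁.tendsto.sub h₂.tendsto).abs
  obtain ⟨N, hN⟩ := eventually_atBot.1 ((t1.eventually (gt_mem_nhds hw)).and
    (eventually_le_atBot s))
  have hT : ∀ x ≤ s, x < T := fun x hx => (hY x (hx.trans hs)).2.2.2
  obtain ⟨s₁, hs₁, hmax⟩ := isCompact_Icc.exists_isMaxOn (nonempty_Icc.2 (hN N le_rfl).2)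
    (f := fun s => |v₁ s - v₂ s|) (fun x hx =>
      (((h₁.hasDerivAt x (hT x hx.2)).sub
        (h₂.hasDerivAt x (hT x hx.2))).continuousAt.abs).continuousWithinAt)
  have hmax' : ∀ σ ≤ s₁, |v₁ σ - v₂ σ| ≤ |v₁ s₁ - v₂ s₁| := by
    intro σ hσ
    rcases le_total N σ with h | h
    · exact hmax ⟨h, hσ.trans hs₁.2⟩
    · exact (hN σ h).1.le.trans (hmax (right_mem_Icc.2 (hN N le_rfl).2))
  have hpos : 0 < |v₁ s₁ - v₂ s₁| := hw.trans_le (hmax (right_mem_Icc.2 (hN N le_rfl).2))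
  obtain ⟨m1, m2, m3, m4⟩ := hY s₁ (hs₁.2.trans hs)
  rcases abs_cases (v₁ s₁ - v₂ s₁) with ⟨hc, -⟩ | ⟨hc, -⟩
  · have := h₁.sub_nonpos_of_isMax h₂ hκ hv₀ hH (by positivity) (fun x hx => (hG x hx).1) m4 m1 m2
      m3 (fun σ hσ => (hmax' σ hσ).trans_eq hc)
    linarith
  · have := h₂.sub_nonpos_of_isMax h₁ hκ hv₀ hH (by positivity) (fun x hx => (hG x hx).1) m4 m2 m1
      m3 (fun σ hσ => by rw [abs_sub_comm]; exact (hmax' σ hσ).trans_eq (by rw [hc]; ring))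
    linarith

theorem eqOn (h₁ : IsProfileOn κ A B G v₀ T v₁ p₁)
    (h₂ : IsProfileOn κ A B G v₀ T v₂ p₂) (hκ : 0 < κ) (hv₀ : 0 < v₀)
    (hH : ∀ x > 0, HasDerivAt H (G x) x) (hGc : ContinuousOn G (Ioi 0))
    (hGpos : ∀ x > 0, 0 < G x) : EqOn v₁ v₂ (Iio T) := by
  obtain ⟨Y, hYT, hY⟩ := h₁.eventually_eq h₂ hκ hv₀ hH hGc hGpos
  intro s hsT
  rcases le_total s Y with hs | hs
  · exact hY s hs
  have hT : ∀ x ∈ Icc (Y - 1) s, x < T := fun x hx => hx.2.trans_lt hsT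
  have hYs : Y - 1 ≤ s := by linarith
  have hc : ∀ {v p}, IsProfileOn κ A B G v₀ T v p → ContinuousOn v (Icc (Y - 1) s) :=
    fun h x hx => (h.hasDerivAt x (hT x hx)).continuousAt.continuousWithinAt
  have hne : (Icc (Y - 1) s).Nonempty := nonempty_Icc.2 hYs
  obtain ⟨x₁, hx₁, hm₁⟩ := isCompact_Icc.exists_isMinOn hne (hc h₁)
  obtain ⟨x₂, hx₂, hm₂⟩ := isCompact_Icc.exists_isMinOn hne (hc h₂)
  obtain ⟨y₁, hy₁, hM₁⟩ := isCompact_Icc.exists_isMaxOn hne (hc h₁)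
  obtain ⟨y₂, hy₂, hM₂⟩ := isCompact_Icc.exists_isMaxOn hne (hc h₂)
  set a := min (v₁ x₁) (v₂ x₂)
  set b := max (v₁ y₁) (v₂ y₂)
  have ha : 0 < a := lt_min (h₁.pos _ (hT _ hx₁)) (h₂.pos _ (hT _ hx₂))
  have hmem₁ : ∀ x ∈ Icc (Y - 1) s, v₁ x ∈ Icc a b := fun x hx =>
    ⟨(min_le_left _ _).trans (hm₁ hx), (hM₁ hx).trans (le_max_left _ _)⟩
  have hmem₂ : ∀ x ∈ Icc (Y - 1) s, v₂ x ∈ Icc a b := fun x hx =>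
    ⟨(min_le_right _ _).trans (hm₂ hx), (hM₂ hx).trans (le_max_right _ _)⟩
  have hab : a ≤ b := (hmem₁ _ hx₁).1.trans (hmem₁ _ hx₁).2
  obtain ⟨g₀, g₁, hg₀, hg₀₁, hG⟩ := exists_bounds_on_Icc hGc hGpos ha hab
  set C := B - κ ^ 2 + A * κ
  set Z : ℝ → ℝ := fun x => profileFlux κ A H v₁ p₁ x - profileFlux κ A H v₂ p₂ x with hZ
  have hpeq : ∀ x, p₁ x - p₂ x = exp (-κ * x) * (Z x - (H (v₁ x) - H (v₂ x)))
      + (κ - A) * (v₁ x - v₂ x) := by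
    intro x
    have : exp (κ * x) * exp (-κ * x) = 1 := by rw [← exp_add]; simp
    simp only [hZ, profileFlux]
    linear_combination (-(p₁ x - p₂ x) + (κ - A) * (v₁ x - v₂ x)) * this
  have hYm : ∀ x ≤ Y, v₁ x - v₂ x = 0 := fun x hx => sub_eq_zero.2 (hY x hx)
  have hZ0 : Z (Y - 1) = 0 := by
    have hlt : Y - 1 < T := by linarith
    have h1 := (h₁.hasDerivAt (Y - 1) hlt).sub (h₂.hasDerivAt (Y - 1) hlt)
    have h2 : HasDerivAt (v₁ - v₂) 0 (Y - 1) := by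
      refine (hasDerivAt_const (Y - 1) (0 : ℝ)).congr_of_eventuallyEq ?_
      filter_upwards [Iio_mem_nhds (sub_one_lt Y)] with x hx using hYm x (le_of_lt hx)
    have h3 := h1.unique h2
    have h4 := hpeq (Y - 1)
    rw [h3, hYm _ (by linarith), hY (Y - 1) (by linarith)] at h4
    have := exp_pos (-κ * (Y - 1))
    simpa [this.ne'] using h4.symm
  set K := exp (-κ * (Y - 1)) * (1 + g₁) + |κ - A| + |C| * exp (κ * s)
  have := eq_zero_of_abs_deriv_le_mul_abs_self_of_eq_zero_right (a := Y - 1) (b := s) (K := K)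
    (f := fun x => (v₁ x - v₂ x, Z x))
    (f' := fun x => (p₁ x - p₂ x, C * exp (κ * x) * (v₁ x - v₂ x)))
    (fun x hx => (ContinuousAt.prodMk
      ((h₁.hasDerivAt x (hT x hx)).sub (h₂.hasDerivAt x (hT x hx))).continuousAt
      ((h₁.hasDerivAt_flux hH (hT x hx)).sub
        (h₂.hasDerivAt_flux hH (hT x hx))).continuousAt).continuousWithinAt)
    (fun x hx => by
      have hx' := hT x (Ico_subset_Icc_self hx)
      exact (((h₁.hasDerivAt x hx').sub (h₂.hasDerivAt x hx')).prodMk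
        (((h₁.hasDerivAt_flux hH hx').sub
          (h₂.hasDerivAt_flux hH hx')).congr_deriv (by ring))).hasDerivWithinAt)
    (by simp [hZ0, hYm (Y - 1) (by linarith)])
    (fun x hx => by
      have hx' := Ico_subset_Icc_self hx
      set nrm := ‖(v₁ x - v₂ x, Z x)‖ with hnrm
      have n1 : |v₁ x - v₂ x| ≤ nrm := norm_fst_le (v₁ x - v₂ x, Z x)
      have n2 : |Z x| ≤ nrm := norm_snd_le (v₁ x - v₂ x, Z x)
      have n0 : 0 ≤ nrm := norm_nonneg _
      have hW := abs_sub_le_of_deriv_bounds (fun y hy => hH y (ha.trans_le hy.1))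
        (fun y hy => by
          rw [abs_of_pos (hGpos y (ha.trans_le hy.1))]; exact (hG y hy).2)
        (hmem₁ x hx') (hmem₂ x hx')
      have hg₁ : 0 ≤ g₁ := hg₀.le.trans hg₀₁
      have hκ0 : ∀ {x y : ℝ}, x ≤ y → κ * x ≤ κ * y := fun h => mul_le_mul_of_nonneg_left h hκ.le
      have e1 : exp (-κ * x) ≤ exp (-κ * (Y - 1)) :=
        exp_le_exp.2 (by have := hκ0 hx.1; linarith)
      have e2 : exp (κ * x) ≤ exp (κ * s) := exp_le_exp.2 (hκ0 hx.2.le)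
      refine norm_prod_le_iff.2 ⟨?_, ?_⟩
      · simp only [Real.norm_eq_abs]
        rw [hpeq]
        have i1 : |Z x - (H (v₁ x) - H (v₂ x))| ≤ (1 + g₁) * nrm := by
          refine (abs_sub _ _).trans ?_
          nlinarith
        have i2 : |exp (-κ * x) * (Z x - (H (v₁ x) - H (v₂ x)))|
            ≤ exp (-κ * (Y - 1)) * ((1 + g₁) * nrm) := by
          rw [abs_mul, abs_of_pos (exp_pos _)]
          exact mul_le_mul e1 i1 (abs_nonneg _) (exp_pos _).le
        have i3 : |(κ - A) * (v₁ x - v₂ x)| ≤ |κ - A| * nrm := by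
          rw [abs_mul]; exact mul_le_mul_of_nonneg_left n1 (abs_nonneg _)
        have i4 : 0 ≤ |C| * exp (κ * s) * nrm := by positivity
        refine (abs_add_le _ _).trans ?_
        simp only [K]
        linarith
      · simp only [Real.norm_eq_abs]
        rw [abs_mul, abs_mul, abs_of_pos (exp_pos _)]
        have i1 : |C| * exp (κ * x) * |v₁ x - v₂ x| ≤ |C| * exp (κ * s) * nrm := by
          gcongr
        have i4 : 0 ≤ (exp (-κ * (Y - 1)) * (1 + g₁) + |κ - A|) * nrm := by positivity
        simp only [K]
        linarith)
    s (right_mem_Icc.2 hYs)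
  exact sub_eq_zero.1 (Prod.mk.inj this).1

end IsProfileOn

theorem integrableOn_exp_neg_mul_Ioi {b : ℝ} (hb : 0 < b) (c : ℝ) :
    MeasureTheory.IntegrableOn (fun u : ℝ => exp (-b * u)) (Ioi c) :=
  integrableOn_exp_mul_Ioi (by linarith) c

/-- The exponential average `b ∫₀^∞ e^{-bu} R(τ / (1 + τ u)) du`, that is, in the variable
`y = 1 / τ`, the bounded solution of `V' = b (V - R)`. -/
noncomputable def expAverage (b : ℝ) (R : ℝ → ℝ) (τ : ℝ) : ℝ :=
  ∫ u in Ioi (0 : ℝ), b * exp (-b * u) * R (max τ 0 / (1 + max τ 0 * u))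

section expAverage

variable {b M : ℝ} {R R₁ R₂ : ℝ → ℝ}

theorem integral_exp_kernel (hb : 0 < b) : ∫ u in Ioi (0 : ℝ), b * exp (-b * u) = 1 := by
  rw [MeasureTheory.integral_const_mul, integral_exp_mul_Ioi (by linarith) 0]
  simp [hb.ne']

theorem aestronglyMeasurable_expAverage (hR : Continuous R) (τ : ℝ) :
    MeasureTheory.AEStronglyMeasurable
      (fun u : ℝ => b * exp (-b * u) * R (max τ 0 / (1 + max τ 0 * u)))
      (MeasureTheory.volume.restrict (Ioi 0)) := by
  refine Measurable.aestronglyMeasurable ?_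
  refine Measurable.mul (by fun_prop) (hR.measurable.comp (by fun_prop))

theorem norm_expAverage_integrand_le (hb : 0 < b) (hM : ∀ τ, |R τ| ≤ M) (τ u : ℝ) :
    ‖b * exp (-b * u) * R (max τ 0 / (1 + max τ 0 * u))‖ ≤ b * exp (-b * u) * M := by
  rw [norm_mul, Real.norm_of_nonneg (by positivity)]
  exact mul_le_mul_of_nonneg_left (hM _) (by positivity)

theorem integrable_expAverage (hb : 0 < b) (hR : Continuous R) (hM : ∀ τ, |R τ| ≤ M) (τ : ℝ) :
    MeasureTheory.IntegrableOn
      (fun u : ℝ => b * exp (-b * u) * R (max τ 0 / (1 + max τ 0 * u))) (Ioi 0) :=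
  (((integrableOn_exp_neg_mul_Ioi hb 0).const_mul b).mul_const M).mono'
    (aestronglyMeasurable_expAverage hR τ)
    (Eventually.of_forall fun u => norm_expAverage_integrand_le hb hM τ u)

theorem continuous_expAverage (hb : 0 < b) (hR : Continuous R) (hM : ∀ τ, |R τ| ≤ M) :
    Continuous (expAverage b R) := by
  refine MeasureTheory.continuous_of_dominated (fun τ => aestronglyMeasurable_expAverage hR τ)
    (fun τ => Eventually.of_forall fun u => norm_expAverage_integrand_le hb hM τ u)
    (((integrableOn_exp_neg_mul_Ioi hb 0).const_mul b).mul_const M) ?_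
  filter_upwards [MeasureTheory.ae_restrict_mem measurableSet_Ioi] with u hu
  have hu0 : (0 : ℝ) < u := hu
  refine continuous_const.mul (hR.comp ?_)
  refine Continuous.div (by fun_prop) (by fun_prop) fun τ => ?_
  have : 0 ≤ max τ 0 * u := mul_nonneg (le_max_right _ _) hu0.le
  linarith

theorem abs_expAverage_sub_le (hb : 0 < b) (hR₁ : Continuous R₁) (hR₂ : Continuous R₂)
    {M₁ M₂ δ : ℝ} (hM₁ : ∀ τ, |R₁ τ| ≤ M₁) (hM₂ : ∀ τ, |R₂ τ| ≤ M₂)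
    (hδ : ∀ τ, |R₁ τ - R₂ τ| ≤ δ) (τ : ℝ) :
    |expAverage b R₁ τ - expAverage b R₂ τ| ≤ δ := by
  unfold expAverage
  rw [← MeasureTheory.integral_sub (integrable_expAverage hb hR₁ hM₁ τ)
    (integrable_expAverage hb hR₂ hM₂ τ)]
  have := MeasureTheory.norm_integral_le_of_norm_le
    (((integrableOn_exp_neg_mul_Ioi hb 0).const_mul b).mul_const δ)
    (f := fun u => b * exp (-b * u) * R₁ (max τ 0 / (1 + max τ 0 * u))
      - b * exp (-b * u) * R₂ (max τ 0 / (1 + max τ 0 * u)))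
    (Eventually.of_forall fun u => by
      rw [← mul_sub, norm_mul, Real.norm_of_nonneg (by positivity)]
      exact mul_le_mul_of_nonneg_left (hδ _) (by positivity))
  rwa [MeasureTheory.integral_mul_const, integral_exp_kernel hb, one_mul] at this

theorem abs_expAverage_le (hb : 0 < b) (hM : ∀ τ, |R τ| ≤ M) (τ : ℝ) :
    |expAverage b R τ| ≤ M := by
  have := MeasureTheory.norm_integral_le_of_norm_le
    (((integrableOn_exp_neg_mul_Ioi hb 0).const_mul b).mul_const M)
    (Eventually.of_forall fun u => norm_expAverage_integrand_le hb hM τ u)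
  rwa [MeasureTheory.integral_mul_const, integral_exp_kernel hb, one_mul] at this

theorem expAverage_zero (hb : 0 < b) : expAverage b R 0 = R 0 := by
  unfold expAverage
  simp only [max_self, zero_div]
  rw [MeasureTheory.integral_mul_const, integral_exp_kernel hb, one_mul]

theorem expAverage_inv {y : ℝ} (hy : 0 < y) :
    expAverage b R y⁻¹ = b * exp (b * y) * ∫ x in Ioi y, exp (-b * x) * R x⁻¹ := by
  have h1 : (∫ x in Ioi y, exp (-b * x) * R x⁻¹)
      = ∫ u in Ioi (0 : ℝ), exp (-b * (u + y)) * R (u + y)⁻¹ := by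
    have := (MeasureTheory.measurePreserving_add_right MeasureTheory.volume y).setIntegral_preimage_emb
      (measurableEmbedding_addRight y) (fun x => exp (-b * x) * R x⁻¹) (Ioi y)
    rw [← this, preimage_add_const_Ioi, sub_self]
  rw [h1, ← MeasureTheory.integral_const_mul]
  refine MeasureTheory.setIntegral_congr_fun measurableSet_Ioi fun u hu => ?_
  have hu0 : (0 : ℝ) < u := hu
  have h2 : y⁻¹ / (1 + y⁻¹ * u) = (u + y)⁻¹ := by field_simp; ring
  have h3 : exp (b * y) * exp (-b * (u + y)) = exp (-b * u) := by rw [← exp_add]; ring_nf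
  simp only [max_eq_left (inv_pos.2 hy).le, h2]
  rw [← h3]; ring

theorem hasDerivAt_expAverage_inv (hb : 0 < b) (hR : Continuous R) (hM : ∀ τ, |R τ| ≤ M)
    {y : ℝ} (hy : 0 < y) :
    HasDerivAt (fun y => expAverage b R y⁻¹) (b * (expAverage b R y⁻¹ - R y⁻¹)) y := by
  set g : ℝ → ℝ := fun x => exp (-b * x) * R x⁻¹ with hg
  have hgm : Measurable g := (by fun_prop : Measurable fun x : ℝ => exp (-b * x)).mul
    (hR.measurable.comp measurable_inv)
  have hint : ∀ c, MeasureTheory.IntegrableOn g (Ioi c) := fun c =>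
    ((integrableOn_exp_neg_mul_Ioi hb c).mul_const M).mono' hgm.aestronglyMeasurable
      (Eventually.of_forall fun u => by
        rw [hg, norm_mul, Real.norm_of_nonneg (exp_pos _).le]
        exact mul_le_mul_of_nonneg_left (hM _) (exp_pos _).le)
  have hgc : ContinuousAt g y :=
    (by fun_prop : ContinuousAt (fun x : ℝ => exp (-b * x)) y).mul
      (hR.continuousAt.comp (continuousAt_inv₀ hy.ne'))
  have hI : HasDerivAt (fun z => ∫ x in Ioi z, g x) (-g y) y := by
    have h1 : ∀ z, ∫ x in Ioi z, g x = (∫ x in Ioi (0 : ℝ), g x) - ∫ x in (0 : ℝ)..z, g x := by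
      intro z
      rw [← intervalIntegral.integral_Ioi_sub_Ioi' (hint 0) (hint z)]; ring
    rw [funext h1]
    refine (intervalIntegral.integral_hasDerivAt_right ?_ ?_ hgc).const_sub _
    · exact (intervalIntegrable_iff_integrableOn_Ioc_of_le hy.le).2
        ((hint 0).mono_set Ioc_subset_Ioi_self)
    · exact ⟨univ, univ_mem, hgm.aestronglyMeasurable⟩
  have he : HasDerivAt (fun z => b * exp (b * z)) (b * (b * exp (b * y))) y := by
    have := (((hasDerivAt_id y).const_mul b).exp).const_mul b
    refine this.congr_deriv ?_
    simp only [id_eq, mul_one]; ring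
  refine ((he.mul hI).congr_of_eventuallyEq ?_).congr_deriv ?_
  · filter_upwards [Ioi_mem_nhds hy] with z hz using expAverage_inv hz
  · rw [expAverage_inv hy]
    have : exp (b * y) * exp (-b * y) = 1 := by rw [← exp_add]; simp
    simp only [hg]
    linear_combination (-(b * R y⁻¹)) * this

end expAverage

open scoped BoundedContinuousFunction in
/-- A contraction argument for `φ = expAverage R(φ)` with `R(φ) = F(φ) + D τ c(φ) + E ∫₀^τ c(φ)`. -/
theorem exists_expAverage_fixedPoint {b θ D E MF Mc : ℝ} (hb : 0 < b) (hθ0 : 0 ≤ θ) (hθ : θ < 1)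
    {F c : ℝ → ℝ} (hF : ∀ x y, |F x - F y| ≤ θ * |x - y|) (hc : ∀ x y, |c x - c y| ≤ |x - y|)
    (hMF : ∀ x, |F x| ≤ MF) (hMc : ∀ x, |c x| ≤ Mc) :
    ∃ T > 0, ∃ φ R : ℝ → ℝ, Continuous φ ∧ Continuous R ∧ (∃ M, ∀ τ, |R τ| ≤ M) ∧
      (∀ τ, φ τ = expAverage b R τ) ∧
      ∀ τ ∈ Icc 0 T, R τ = F (φ τ) + D * τ * c (φ τ) + E * ∫ σ in (0 : ℝ)..τ, c (φ σ) := by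
  have hFc : Continuous F := (LipschitzWith.of_dist_le' (K := θ) hF).continuous
  have hcc : Continuous c :=
    (LipschitzWith.of_dist_le' (K := 1) (by simpa [Real.dist_eq] using hc)).continuous
  set T := (1 - θ) / (2 * (|D| + |E| + 1)) with hT
  have hT0 : 0 < T := div_pos (by linarith) (by positivity)
  have hTθ : θ + (|D| + |E|) * T < 1 := by
    have : T * (2 * (|D| + |E| + 1)) = 1 - θ := by rw [hT]; field_simp
    nlinarith [abs_nonneg D, abs_nonneg E]
  let cl : ℝ → ℝ := fun τ => max 0 (min τ T)
  have hcl0 : ∀ τ, 0 ≤ cl τ := fun τ => le_max_left _ _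
  have hclT : ∀ τ, cl τ ≤ T := fun τ => max_le hT0.le (min_le_right _ _)
  have hclc : Continuous cl := by fun_prop
  let S : (ℝ → ℝ) → ℝ → ℝ := fun φ τ =>
    F (φ τ) + D * cl τ * c (φ τ) + E * ∫ σ in (0 : ℝ)..cl τ, c (φ σ)
  have hScont : ∀ φ, Continuous φ → Continuous (S φ) := by
    intro φ hφ
    have h1 : Continuous fun x => ∫ σ in (0 : ℝ)..x, c (φ σ) :=
      intervalIntegral.continuous_primitive
        (fun a b => (hcc.comp hφ).intervalIntegrable a b) 0
    exact ((hFc.comp hφ).add ((continuous_const.mul hclc).mul (hcc.comp hφ))).add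
      (continuous_const.mul (h1.comp hclc))
  have hintle : ∀ (h : ℝ → ℝ) (δ : ℝ), 0 ≤ δ → (∀ σ, |h σ| ≤ δ) → ∀ τ,
      |∫ σ in (0 : ℝ)..cl τ, h σ| ≤ T * δ := by
    intro h δ hδ hh τ
    have := intervalIntegral.norm_integral_le_of_norm_le_const (a := 0) (b := cl τ) (C := δ)
      (f := h) (fun x _ => hh x)
    rw [sub_zero, abs_of_nonneg (hcl0 τ), Real.norm_eq_abs] at this
    nlinarith [hclT τ]
  have hSbd : ∀ φ τ, |S φ τ| ≤ MF + |D| * T * Mc + |E| * (T * Mc) := by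
    intro φ τ
    have hMc0 : 0 ≤ Mc := (abs_nonneg _).trans (hMc 0)
    refine (abs_add_le _ _).trans (add_le_add ((abs_add_le _ _).trans
      (add_le_add (hMF _) ?_)) ?_)
    · rw [abs_mul, abs_mul, abs_of_nonneg (hcl0 τ)]
      have := hclT τ
      have := hMc (φ τ)
      gcongr
    · rw [abs_mul]
      exact mul_le_mul_of_nonneg_left (hintle _ _ hMc0 (fun σ => hMc _) τ) (abs_nonneg _)
  have hSlip : ∀ φ ψ : ℝ → ℝ, Continuous φ → Continuous ψ → ∀ δ, (∀ τ, |φ τ - ψ τ| ≤ δ) →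
      ∀ τ, |S φ τ - S ψ τ| ≤ (θ + (|D| + |E|) * T) * δ := by
    intro φ ψ hφ hψ δ hδ τ
    have hδ0 : 0 ≤ δ := (abs_nonneg _).trans (hδ 0)
    have hcδ : ∀ σ, |c (φ σ) - c (ψ σ)| ≤ δ := fun σ => (hc _ _).trans (hδ σ)
    have e : S φ τ - S ψ τ = (F (φ τ) - F (ψ τ)) + D * cl τ * (c (φ τ) - c (ψ τ))
        + E * ∫ σ in (0 : ℝ)..cl τ, (c (φ σ) - c (ψ σ)) := by
      have := intervalIntegral.integral_sub (μ := MeasureTheory.volume) (a := 0) (b := cl τ)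
        ((hcc.comp hφ).intervalIntegrable _ _) ((hcc.comp hψ).intervalIntegrable _ _)
      simp only [Function.comp_apply] at this
      rw [this]
      simp only [S]; ring
    have e1 : |F (φ τ) - F (ψ τ)| ≤ θ * δ :=
      (hF _ _).trans (mul_le_mul_of_nonneg_left (hδ τ) hθ0)
    have e2 : |D * cl τ * (c (φ τ) - c (ψ τ))| ≤ |D| * T * δ := by
      rw [abs_mul, abs_mul, abs_of_nonneg (hcl0 τ)]
      have := hclT τ
      have := hcδ τ
      gcongr
    have e3 : |E * ∫ σ in (0 : ℝ)..cl τ, (c (φ σ) - c (ψ σ))| ≤ |E| * (T * δ) := by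
      rw [abs_mul]
      exact mul_le_mul_of_nonneg_left (hintle _ _ hδ0 hcδ τ) (abs_nonneg _)
    rw [e]
    refine (abs_add_le _ _).trans ((add_le_add (abs_add_le _ _) le_rfl).trans ?_)
    linarith
  let Φ : (ℝ →ᵇ ℝ) → (ℝ →ᵇ ℝ) := fun φ =>
    BoundedContinuousFunction.ofNormedAddCommGroup (expAverage b (S φ))
      (continuous_expAverage hb (hScont φ φ.continuous) (hSbd φ)) _
      (fun τ => abs_expAverage_le hb (hSbd φ) τ)
  have hK0 : 0 ≤ θ + (|D| + |E|) * T := by positivity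
  have hΦ : ContractingWith (θ + (|D| + |E|) * T).toNNReal Φ := by
    refine ⟨by rw [← NNReal.coe_lt_coe, Real.coe_toNNReal _ hK0]; simpa using hTθ, ?_⟩
    refine LipschitzWith.of_dist_le_mul fun φ ψ => ?_
    rw [Real.coe_toNNReal _ hK0]
    refine (BoundedContinuousFunction.dist_le (by positivity)).2 fun τ => ?_
    exact abs_expAverage_sub_le hb (hScont φ φ.continuous) (hScont ψ ψ.continuous) (hSbd φ)
      (hSbd ψ) (hSlip φ ψ φ.continuous ψ.continuous _
        (fun τ => BoundedContinuousFunction.dist_coe_le_dist (f := φ) (g := ψ) τ)) τ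
  set φ := ContractingWith.fixedPoint Φ hΦ
  have hfix : Φ φ = φ := hΦ.fixedPoint_isFixedPt
  refine ⟨T, hT0, φ, S φ, φ.continuous, hScont φ φ.continuous, ⟨_, hSbd φ⟩, fun τ => ?_,
    fun τ hτ => ?_⟩
  · exact (DFunLike.congr_fun hfix τ).symm
  · have : cl τ = τ := by simp [cl, hτ.1, hτ.2]
    simp only [S, this]

theorem exists_isProfileOn_local {κ A B v₀ : ℝ} {G H : ℝ → ℝ} (hκ : 0 < κ) (hv₀ : 0 < v₀)
    (hH : ∀ x > 0, HasDerivAt H (G x) x) (hGc : ContinuousOn G (Ioi 0))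
    (hGpos : ∀ x > 0, 0 < G x) : ∃ T v p, IsProfileOn κ A B G v₀ T v p := by
  have hle : v₀ / 2 ≤ 2 * v₀ := by linarith
  have hhalf : 0 < v₀ / 2 := by linarith
  obtain ⟨g₀, g₁, hg₀, hg₀₁, hG⟩ := exists_bounds_on_Icc hGc hGpos hhalf hle
  have hg₁ : 0 < g₁ := hg₀.trans_le hg₀₁
  set C := B - κ ^ 2 + A * κ with hC
  let N : ℝ → ℝ := fun x => x - (H x - H v₀) / g₁
  let c : ℝ → ℝ := fun x => (projIcc (v₀ / 2) (2 * v₀) hle x : ℝ)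
  have hcmem : ∀ x, c x ∈ Icc (v₀ / 2) (2 * v₀) := fun x => (projIcc _ _ hle x).2
  have hceq : ∀ x ∈ Icc (v₀ / 2) (2 * v₀), c x = x := fun x hx => by
    simp only [c, projIcc_of_mem hle hx]
  have hclip : ∀ x y, |c x - c y| ≤ |x - y| := fun x y => abs_projIcc_sub_projIcc hle
  set θ := 1 - g₀ / g₁ with hθ
  have hθ1 : θ < 1 := by have : 0 < g₀ / g₁ := by positivity
                         linarith
  have hθ0 : 0 ≤ θ := by have : g₀ / g₁ ≤ 1 := (div_le_one hg₁).2 hg₀₁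
                         linarith
  have hNlip : ∀ x ∈ Icc (v₀ / 2) (2 * v₀), ∀ y ∈ Icc (v₀ / 2) (2 * v₀),
      |N x - N y| ≤ θ * |x - y| := fun x hx y hy => by
    refine abs_sub_le_of_deriv_bounds (G := fun x => 1 - G x / g₁) (a := v₀ / 2) (b := 2 * v₀)
      (fun z hz => ?_) (fun z hz => ?_) hx hy
    · exact (hasDerivAt_id z).sub (((hH z (hhalf.trans_le hz.1)).sub_const _).div_const _)
    · obtain ⟨h1, h2⟩ := hG z hz
      have h3 : g₀ / g₁ ≤ G z / g₁ := by gcongr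
      have h4 : G z / g₁ ≤ 1 := (div_le_one hg₁).2 h2
      rw [abs_of_nonneg (by linarith)]
      linarith
  have hv₀mem : v₀ ∈ Icc (v₀ / 2) (2 * v₀) := ⟨by linarith, by linarith⟩
  have hNv₀ : N v₀ = v₀ := by simp [N]
  have hFlip : ∀ x y, |N (c x) - N (c y)| ≤ θ * |x - y| := fun x y =>
    (hNlip _ (hcmem x) _ (hcmem y)).trans (mul_le_mul_of_nonneg_left (hclip x y) hθ0)
  obtain ⟨T₀, hT₀, φ, R, hφ, hR, ⟨M, hM⟩, hfix, hReq⟩ :=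
    exists_expAverage_fixedPoint (b := g₁ / κ) (D := (κ - A) / g₁) (E := C / (κ * g₁))
      (F := fun x => N (c x)) (c := c) (MF := v₀ + 2 * v₀) (Mc := 2 * v₀) (by positivity)
      hθ0 hθ1 hFlip hclip
      (fun x => by
        have h1 := hNlip _ (hcmem x) _ hv₀mem
        rw [hNv₀] at h1
        have h2 : |c x - v₀| ≤ v₀ := by
          rw [abs_le]; constructor <;> linarith [(hcmem x).1, (hcmem x).2]
        have h3 : |N (c x) - v₀| ≤ v₀ := by nlinarith [abs_nonneg (c x - v₀)]
        rw [abs_le] at h3 ⊢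
        constructor <;> linarith)
      (fun x => by
        rw [abs_le]; constructor <;> linarith [(hcmem x).1, (hcmem x).2])
  have hφ0 : φ 0 = v₀ := by
    have h1 : φ 0 = N (c (φ 0)) := by
      have h := hfix 0
      rw [expAverage_zero (by positivity), hReq 0 ⟨le_rfl, hT₀.le⟩] at h
      simpa using h
    have h2 := hFlip (φ 0) v₀
    rw [← h1, hceq v₀ hv₀mem, hNv₀] at h2
    have h3 : |φ 0 - v₀| ≤ 0 := by nlinarith [abs_nonneg (φ 0 - v₀)]
    exact sub_eq_zero.1 (abs_nonpos_iff.1 h3)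
  have hnear : ∀ᶠ τ in nhds (0 : ℝ), φ τ ∈ Icc (v₀ / 2) (2 * v₀) :=
    hφ.continuousAt.eventually (by rw [hφ0]; exact Icc_mem_nhds (by linarith) (by linarith))
  obtain ⟨T₁, hT₁, hT₁mem⟩ := Metric.eventually_nhds_iff.1 hnear
  set T₂ := min T₀ T₁ with hT₂
  have hT₂0 : 0 < T₂ := lt_min hT₀ hT₁
  have hmem : ∀ τ, 0 ≤ τ → τ < T₂ → φ τ ∈ Icc (v₀ / 2) (2 * v₀) := fun τ h0 h1 =>
    hT₁mem (by rw [Real.dist_eq, sub_zero, abs_of_nonneg h0]; exact h1.trans_le (min_le_right _ _))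
  have hRφ : ∀ τ, 0 ≤ τ → τ < T₂ → R τ = φ τ - (H (φ τ) - H v₀) / g₁
      + (κ - A) / g₁ * τ * φ τ + C / (κ * g₁) * ∫ σ in (0 : ℝ)..τ, φ σ := fun τ h0 h1 => by
    rw [hReq τ ⟨h0, h1.le.trans (min_le_left _ _)⟩, hceq _ (hmem τ h0 h1),
      intervalIntegral.integral_congr (g := φ)]
    intro σ hσ
    rw [uIcc_of_le h0] at hσ
    exact hceq _ (hmem σ hσ.1 (hσ.2.trans_lt h1))
  have hexp : ∀ s, s < log T₂ / κ → exp (κ * s) < T₂ := fun s hs => by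
    rw [lt_div_iff₀ hκ] at hs
    rw [← lt_log_iff_exp_lt hT₂0]; linarith
  have hinv : ∀ s, (exp (-κ * s))⁻¹ = exp (κ * s) := fun s => by rw [← exp_neg]; ring_nf
  let v : ℝ → ℝ := fun s => φ (exp (κ * s))
  let p : ℝ → ℝ := fun s => exp (-κ * s) * (H v₀ - H (v s)) + (κ - A) * v s
    + C / κ * (exp (-κ * s) * ∫ σ in (0 : ℝ)..exp (κ * s), φ σ)
  have hv : ∀ s < log T₂ / κ, HasDerivAt v (p s) s := fun s hs => by
    have h1 := (hasDerivAt_expAverage_inv (b := g₁ / κ) (by positivity) hR hM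
      (exp_pos (-κ * s))).comp s (IsProfileOn.hasDerivAt_exp_mul (-κ) s)
    have h2 : ((fun y => expAverage (g₁ / κ) R y⁻¹) ∘ fun s => exp (-κ * s)) = v := by
      funext t
      simp only [Function.comp_apply, hinv, v, ← hfix]
    rw [h2] at h1
    refine h1.congr_deriv ?_
    rw [hinv, ← hfix, hRφ _ (exp_pos _).le (hexp s hs)]
    have h3 : exp (-κ * s) * exp (κ * s) = 1 := by rw [← exp_add]; simp
    simp only [p, v]
    generalize exp (-κ * s) = e at h3 ⊢
    field_simp
    linear_combination (κ * (κ - A) * φ (exp (κ * s))) * h3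
  refine ⟨log T₂ / κ, v, p, ⟨fun s hs => ?_, hv, fun s hs => ?_, ?_⟩⟩
  · exact hhalf.trans_le (hmem _ (exp_pos _).le (hexp s hs)).1
  · have hvpos : 0 < v s := hhalf.trans_le (hmem _ (exp_pos _).le (hexp s hs)).1
    have he := IsProfileOn.hasDerivAt_exp_mul (-κ) s
    have hJ : HasDerivAt (fun s => ∫ σ in (0 : ℝ)..exp (κ * s), φ σ)
        (v s * (κ * exp (κ * s))) s :=
      (intervalIntegral.integral_hasDerivAt_right (hφ.intervalIntegrable _ _)
        (hφ.stronglyMeasurableAtFilter _ _) hφ.continuousAt).comp s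
          (IsProfileOn.hasDerivAt_exp_mul κ s)
    have h1 := ((he.mul (((hH _ hvpos).comp s (hv s hs)).const_sub (H v₀))).add
      ((hv s hs).const_mul (κ - A))).add ((he.mul hJ).const_mul (C / κ))
    refine h1.congr_deriv ?_
    have h3 : exp (-κ * s) * exp (κ * s) = 1 := by rw [← exp_add]; simp
    have h4 : p s = exp (-κ * s) * (H v₀ - H (v s)) + (κ - A) * v s
      + C / κ * (exp (-κ * s) * ∫ σ in (0 : ℝ)..exp (κ * s), φ σ) := rfl
    have h5 : C / κ * κ = C := by field_simp
    have h6 : C = B - κ ^ 2 + A * κ := hC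
    simp only [Function.comp_apply]
    linear_combination (-κ) * h4 + (C / κ * κ * v s) * h3 + v s * h5 + v s * h6
  · have := hφ.tendsto 0
    rw [hφ0] at this
    exact this.comp (IsProfileOn.tendsto_exp_mul_atBot hκ)

theorem IsProfileOn.exists_deriv_nonneg {κ A B v₀ T : ℝ} {G v p : ℝ → ℝ}
    (h : IsProfileOn κ A B G v₀ T v p) (hκ : 0 < κ) (hB : 0 < B) (hv₀ : 0 < v₀)
    (hGc : ContinuousOn G (Ioi 0)) (hGpos : ∀ x > 0, 0 < G x) : ∃ s < T, 0 ≤ p s := by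
  by_contra! hneg
  have hG : Tendsto (fun s => G (v s)) atBot (nhds (G v₀)) :=
    ((hGc.continuousAt (Ioi_mem_nhds hv₀)).tendsto).comp h.tendsto
  have hexp : Tendsto (fun s => exp (-κ * s)) atBot atTop :=
    tendsto_exp_atTop.comp (tendsto_id.const_mul_atBot_of_neg (neg_lt_zero.2 hκ))
  have hev := (tendsto_atTop.1 (hexp.atTop_mul_pos (hGpos v₀ hv₀) hG) (-A)).and
    (eventually_lt_atBot T)
  obtain ⟨N, hN⟩ := eventually_atBot.1 hev
  have hmono : MonotoneOn p (Iic N) := by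
    refine monotoneOn_of_deriv_nonneg (convex_Iic N)
      (fun s hs => (h.hasDerivAt_deriv s (hN s hs).2).continuousAt.continuousWithinAt)
      (fun s hs => (h.hasDerivAt_deriv s (hN s (interior_subset (s := Iic N) hs)).2
        ).differentiableAt.differentiableWithinAt) fun s hs => ?_
    obtain ⟨h1, h2⟩ := hN s (interior_subset (s := Iic N) hs)
    rw [(h.hasDerivAt_deriv s h2).deriv]
    nlinarith [hneg s h2, h.pos s h2, mul_pos hB (h.pos s h2)]
  have hpN := hneg N (hN N le_rfl).2
  have ht : Tendsto (fun s => v s - v (s - 1)) atBot (nhds 0) := by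
    simpa [sub_eq_add_neg] using
      h.tendsto.sub (h.tendsto.comp (tendsto_atBot_add_const_right _ (-1) tendsto_id))
  obtain ⟨s, hs1, hs2⟩ := ((ht.eventually_const_lt hpN).and (eventually_le_atBot N)).exists
  obtain ⟨ξ, hξ, hξ'⟩ := exists_hasDerivAt_eq_slope v p (sub_one_lt s)
    (fun x hx => (h.hasDerivAt x (hN x (hx.2.trans hs2)).2).continuousAt.continuousWithinAt)
    (fun x hx => h.hasDerivAt x (hN x (hx.2.le.trans hs2)).2)
  have := hmono (hξ.2.le.trans hs2) self_mem_Iic (hξ.2.le.trans hs2)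
  rw [hξ'] at this
  simp at this
  linarith

theorem ContDiff.exists_forall_hasDerivWithinAt_projIcc {W : ℝ × ℝ × ℝ → ℝ × ℝ}
    (hW : ContDiff ℝ 1 W) {a b c d e f : ℝ} (hab : a ≤ b) (hcd : c ≤ d) (hef : e ≤ f)
    (x₀ : ℝ × ℝ) :
    ∃ y : ℝ → ℝ × ℝ, y a = x₀ ∧ ∀ t ∈ Icc a b, HasDerivWithinAt y
      (W (t, projIcc c d hcd (y t).1, projIcc e f hef (y t).2)) (Icc a b) t := by
  set S : Set (ℝ × ℝ × ℝ) := Icc a b ×ˢ Icc c d ×ˢ Icc e f with hS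
  have hSc : IsCompact S := isCompact_Icc.prod (isCompact_Icc.prod isCompact_Icc)
  have hSv : Convex ℝ S := (convex_Icc a b).prod ((convex_Icc c d).prod (convex_Icc e f))
  obtain ⟨K, hK⟩ := hW.contDiffOn.exists_lipschitzOnWith one_ne_zero hSv hSc
  obtain ⟨L, hL⟩ := hSc.exists_bound_of_continuousOn hW.continuous.continuousOn
  have hmem : ∀ t ∈ Icc a b, ∀ x : ℝ × ℝ,
      ((t, (projIcc c d hcd x.1 : ℝ), (projIcc e f hef x.2 : ℝ)) : ℝ × ℝ × ℝ) ∈ S :=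
    fun t ht x => ⟨ht, Subtype.coe_prop _, Subtype.coe_prop _⟩
  have hL0 : 0 ≤ L := (norm_nonneg _).trans (hL _ (hmem a ⟨le_rfl, hab⟩ x₀))
  have hclamp : LipschitzWith 1 fun x : ℝ × ℝ =>
      ((projIcc c d hcd x.1 : ℝ), (projIcc e f hef x.2 : ℝ)) := by
    have h1 := (LipschitzWith.subtype_val _).comp
      ((LipschitzWith.projIcc hcd).comp (LipschitzWith.prod_fst (α := ℝ) (β := ℝ)))
    have h2 := (LipschitzWith.subtype_val _).comp
      ((LipschitzWith.projIcc hef).comp (LipschitzWith.prod_snd (α := ℝ) (β := ℝ)))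
    simpa using h1.prodMk h2
  have hpl : IsPicardLindelof
      (fun t (x : ℝ × ℝ) => W (t, projIcc c d hcd x.1, projIcc e f hef x.2))
      (⟨a, le_rfl, hab⟩ : Icc a b) x₀ (L.toNNReal * (b - a).toNNReal) 0 L.toNNReal K := by
    refine ⟨fun t ht => ?_, fun x _ => ?_, fun t ht x _ => ?_, ?_⟩
    · refine LipschitzOnWith.of_dist_le_mul fun x _ y _ => ?_
      refine (hK.dist_le_mul _ (hmem t ht x) _ (hmem t ht y)).trans ?_
      refine mul_le_mul_of_nonneg_left ?_ K.2
      have := hclamp.dist_le_mul x y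
      rw [Prod.dist_eq, dist_self, max_eq_right dist_nonneg]
      simpa using this
    · exact (hW.continuous.comp (by fun_prop)).continuousOn
    · exact (hL _ (hmem t ht x)).trans (Real.le_coe_toNNReal L)
    · simp [hab]
  exact hpl.exists_eq_forall_mem_Icc_hasDerivWithinAt₀

theorem exists_hasDerivWithinAt_profile {κ A B : ℝ} {G : ℝ → ℝ} (hB : 0 < B)
    (hGexp : ContDiff ℝ 1 fun u => G (exp u)) (hGpos : ∀ x > 0, 0 < G x)
    {s₀ T x y : ℝ} (hT : s₀ ≤ T) (hx : 0 < x) (hy : 0 ≤ y) :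
    ∃ v p : ℝ → ℝ, v s₀ = x ∧ p s₀ = y ∧ ∀ s ∈ Icc s₀ T, 0 < v s ∧
      HasDerivWithinAt v (p s) (Icc s₀ T) s ∧
      HasDerivWithinAt p (B * v s - (A + exp (-κ * s) * G (v s)) * p s) (Icc s₀ T) s := by
  set Q := y / x + |A| + B + 1 with hQ
  have hyx : 0 ≤ y / x := by positivity
  have hQ0 : 0 ≤ Q := by positivity
  have hu : log x ≤ log x + Q * (T - s₀) := by nlinarith
  set W : ℝ × ℝ × ℝ → ℝ × ℝ := fun z =>
    (z.2.2, B - z.2.2 ^ 2 - (A + exp (-κ * z.1) * G (exp z.2.1)) * z.2.2) with hWdef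
  have hW : ContDiff ℝ 1 W := by
    have h1 : ContDiff ℝ 1 fun z : ℝ × ℝ × ℝ => G (exp z.2.1) :=
      hGexp.comp (contDiff_fst.comp contDiff_snd)
    have h2 : ContDiff ℝ 1 fun z : ℝ × ℝ × ℝ => exp (-κ * z.1) := by fun_prop
    have h3 : ContDiff ℝ 1 fun z : ℝ × ℝ × ℝ => z.2.2 := by fun_prop
    exact h3.prodMk ((contDiff_const.sub (h3.pow 2)).sub
      ((contDiff_const.add (h2.mul h1)).mul h3))
  obtain ⟨z, hz0, hz⟩ := hW.exists_forall_hasDerivWithinAt_projIcc hT hu hQ0 (log x, y / x)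
  have hz1 : ∀ s ∈ Icc s₀ T, HasDerivWithinAt (fun s => (z s).1)
      (projIcc 0 Q hQ0 (z s).2 : ℝ) (Icc s₀ T) s := fun s hs =>
    (hasFDerivAt_fst (𝕜 := ℝ) (p := z s)).comp_hasDerivWithinAt s (hz s hs)
  have hz2 := fun s hs =>
    (hasFDerivAt_snd (𝕜 := ℝ) (p := z s)).comp_hasDerivWithinAt s (hz s hs)
  have hIci : ∀ s ∈ Ico s₀ T, Icc s₀ T ∈ nhdsWithin s (Ici s) := fun s hs =>
    Icc_mem_nhdsGE_of_mem hs
  have hq0 : ∀ s ∈ Icc s₀ T, -(z s).2 ≤ 0 := by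
    refine image_le_of_deriv_right_lt_deriv_boundary' (f := fun s => -(z s).2)
      (fun s hs => (hz2 s hs).neg.continuousWithinAt)
      (fun s hs => (hz2 s (Ico_subset_Icc_self hs)).neg.mono_of_mem_nhdsWithin (hIci s hs))
      (by simp [hz0, hyx]) continuousOn_const (fun s _ => hasDerivWithinAt_const _ _ _)
      fun s hs h0 => ?_
    have h0' : (z s).2 = 0 := by linarith
    simp [hWdef, h0', hB]
  have hqQ : ∀ s ∈ Icc s₀ T, (z s).2 ≤ Q := by
    refine image_le_of_deriv_right_lt_deriv_boundary' (f := fun s => (z s).2)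
      (fun s hs => (hz2 s hs).continuousWithinAt)
      (fun s hs => (hz2 s (Ico_subset_Icc_self hs)).mono_of_mem_nhdsWithin (hIci s hs))
      ?_ continuousOn_const (fun s _ => hasDerivWithinAt_const _ _ _)
      fun s hs h0 => ?_
    · simp only [hz0, hQ]
      linarith [abs_nonneg A]
    · simp only [hWdef, h0, projIcc_of_mem hQ0 (right_mem_Icc.2 hQ0),
        ContinuousLinearMap.coe_snd']
      have hg := mul_nonneg (mul_pos (exp_pos (-κ * s))
        (hGpos _ (exp_pos (projIcc (log x) (log x + Q * (T - s₀)) hu (z s).1 : ℝ)))).le hQ0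
      have h1 : B + 1 ≤ Q + A := by linarith [neg_abs_le A]
      have h2 : 1 ≤ Q := by linarith [abs_nonneg A]
      nlinarith
  have hqcl : ∀ s ∈ Icc s₀ T, (projIcc 0 Q hQ0 (z s).2 : ℝ) = (z s).2 := fun s hs => by
    rw [projIcc_of_mem hQ0 ⟨by linarith [hq0 s hs], hqQ s hs⟩]
  have hu0 : ∀ s ∈ Icc s₀ T, log x ≤ (z s).1 := by
    refine fun s hs => image_le_of_deriv_right_le_deriv_boundary (f := fun _ => log x)
      (f' := fun _ => 0) (B := fun s => (z s).1) continuousOn_const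
      (fun s _ => hasDerivWithinAt_const _ _ _) (by simp [hz0])
      (fun s hs => (hz1 s hs).continuousWithinAt)
      (fun s hs => (hz1 s (Ico_subset_Icc_self hs)).mono_of_mem_nhdsWithin (hIci s hs))
      (fun s _ => (Subtype.coe_prop (projIcc 0 Q hQ0 (z s).2)).1) hs
  have hu1 : ∀ s ∈ Icc s₀ T, (z s).1 ≤ log x + Q * (s - s₀) := by
    refine fun s hs => image_le_of_deriv_right_le_deriv_boundary (f := fun s => (z s).1)
      (B := fun s => log x + Q * (s - s₀)) (B' := fun _ => Q)
      (fun s hs => (hz1 s hs).continuousWithinAt)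
      (fun s hs => (hz1 s (Ico_subset_Icc_self hs)).mono_of_mem_nhdsWithin (hIci s hs))
      (by simp [hz0]) (by fun_prop)
      (fun s _ => ?_)
      (fun s _ => (Subtype.coe_prop (projIcc 0 Q hQ0 (z s).2)).2) hs
    simpa using ((((hasDerivAt_id s).sub_const s₀).const_mul Q).const_add (log x)).hasDerivWithinAt
  have hucl : ∀ s ∈ Icc s₀ T,
      (projIcc (log x) (log x + Q * (T - s₀)) hu (z s).1 : ℝ) = (z s).1 := fun s hs => by
    rw [projIcc_of_mem hu ⟨hu0 s hs, (hu1 s hs).trans (by nlinarith [hs.2])⟩]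
  refine ⟨fun s => exp (z s).1, fun s => (z s).2 * exp (z s).1, by simp [hz0, exp_log hx], ?_,
    fun s hs => ⟨exp_pos _, ?_, ?_⟩⟩
  · simp [hz0, exp_log hx, hx.ne']
  · exact (hz1 s hs).exp.congr_deriv (by rw [hqcl s hs, mul_comm])
  · have h1 := (hz2 s hs).mul (hz1 s hs).exp
    refine h1.congr_deriv ?_
    simp only [hWdef, hqcl s hs, hucl s hs, ContinuousLinearMap.coe_snd', Function.comp_apply]
    ring

theorem hasDerivAt_ite_le {f g f' g' : ℝ → ℝ} {a T : ℝ} (hf : ∀ s ≤ a, HasDerivAt f (f' s) s)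
    (hg : ∀ s ∈ Icc a T, HasDerivWithinAt g (g' s) (Icc a T) s) (h : f a = g a)
    (h' : f' a = g' a) {s : ℝ} (hs : s < T) :
    HasDerivAt (fun s => if s ≤ a then f s else g s) (if s ≤ a then f' s else g' s) s := by
  rcases lt_trichotomy s a with hsa | rfl | hsa
  · rw [if_pos hsa.le]
    refine (hf s hsa.le).congr_of_eventuallyEq ?_
    filter_upwards [Iio_mem_nhds hsa] with x hx using if_pos (le_of_lt hx)
  · rw [if_pos le_rfl, ← hasDerivWithinAt_univ, ← Iic_union_Ici (a := s)]
    refine HasDerivWithinAt.union ?_ ?_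
    · exact (hf s le_rfl).hasDerivWithinAt.congr (fun x hx => if_pos hx) (if_pos le_rfl)
    · rw [h']
      refine ((hg s ⟨le_rfl, hs.le⟩).mono_of_mem_nhdsWithin (Icc_mem_nhdsGE hs)).congr
        (fun x hx => ?_) (by simp [h])
      rcases eq_or_lt_of_le (mem_Ici.1 hx) with rfl | hx
      · simp [h]
      · exact if_neg hx.not_ge
  · rw [if_neg hsa.not_ge]
    refine ((hg s ⟨hsa.le, hs.le⟩).hasDerivAt (Icc_mem_nhds hsa hs)).congr_of_eventuallyEq ?_
    filter_upwards [Ioi_mem_nhds hsa] with x hx using if_neg (not_le.2 hx)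

theorem exists_isProfileOn {κ A B v₀ : ℝ} {G H : ℝ → ℝ} (hκ : 0 < κ) (hB : 0 < B) (hv₀ : 0 < v₀)
    (hH : ∀ x > 0, HasDerivAt H (G x) x) (hGc : ContinuousOn G (Ioi 0))
    (hGexp : ContDiff ℝ 1 fun u => G (exp u)) (hGpos : ∀ x > 0, 0 < G x) (T : ℝ) :
    ∃ v p, IsProfileOn κ A B G v₀ T v p := by
  obtain ⟨T₀, v, p, h⟩ := exists_isProfileOn_local (A := A) (B := B) hκ hv₀ hH hGc hGpos
  obtain ⟨s₀, hs₀, hp₀⟩ := h.exists_deriv_nonneg hκ hB hv₀ hGc hGpos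
  rcases le_total T s₀ with hT | hT
  · exact ⟨v, p, h.mono (hT.trans hs₀.le)⟩
  obtain ⟨w, q, hw, hq, hwq⟩ := exists_hasDerivWithinAt_profile (κ := κ) (A := A) hB hGexp hGpos
    hT (h.pos s₀ hs₀) hp₀
  refine ⟨fun s => if s ≤ s₀ then v s else w s, fun s => if s ≤ s₀ then p s else q s,
    fun s hs => ?_, fun s hs => ?_, fun s hs => ?_, ?_⟩
  · split_ifs with hss
    · exact h.pos s (hss.trans_lt hs₀)
    · exact (hwq s ⟨(not_le.1 hss).le, hs.le⟩).1
  · exact hasDerivAt_ite_le (fun s hs => h.hasDerivAt s (hs.trans_lt hs₀))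
      (fun s hs => (hwq s hs).2.1) hw.symm hq.symm hs
  · refine (hasDerivAt_ite_le (fun s hs => h.hasDerivAt_deriv s (hs.trans_lt hs₀))
      (fun s hs => (hwq s hs).2.2) hq.symm ?_ hs).congr_deriv ?_
    · rw [hw, hq]
    · split_ifs <;> rfl
  · refine h.tendsto.congr' ?_
    filter_upwards [eventually_le_atBot s₀] with s hs using (if_pos hs).symm

theorem exists_forall_isProfileOn {κ A B v₀ : ℝ} {G H : ℝ → ℝ} (hκ : 0 < κ) (hB : 0 < B)
    (hv₀ : 0 < v₀) (hH : ∀ x > 0, HasDerivAt H (G x) x) (hGc : ContinuousOn G (Ioi 0))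
    (hGexp : ContDiff ℝ 1 fun u => G (exp u)) (hGpos : ∀ x > 0, 0 < G x) :
    ∃ v p, ∀ T, IsProfileOn κ A B G v₀ T v p := by
  choose v p h using exists_isProfileOn (A := A) hκ hB hv₀ hH hGc hGexp hGpos
  have heq : ∀ {S T s : ℝ}, S ≤ T → s < S → v T s = v S s := fun hST hs =>
    ((h _).mono hST).eqOn (h _) hκ hv₀ hH hGc hGpos hs
  have hpeq : ∀ {S T s : ℝ}, S ≤ T → s < S → p T s = p S s := fun {S T s} hST hs => by
    refine ((h T).hasDerivAt s (hs.trans_le hST)).unique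
      (((h S).hasDerivAt s hs).congr_of_eventuallyEq ?_)
    filter_upwards [Iio_mem_nhds hs] with x hx using heq hST hx
  have key : ∀ {T s : ℝ}, s < T → v (s + 1) s = v T s ∧ p (s + 1) s = p T s := fun {T s} hs => by
    rcases le_total (s + 1) T with hT | hT
    · exact ⟨(heq hT (lt_add_one s)).symm, (hpeq hT (lt_add_one s)).symm⟩
    · exact ⟨heq hT hs, hpeq hT hs⟩
  refine ⟨fun s => v (s + 1) s, fun s => p (s + 1) s, fun T => ⟨fun s hs => ?_, fun s hs => ?_,
    fun s hs => ?_, ?_⟩⟩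
  · exact (h _).pos s (lt_add_one s)
  · refine (((h T).hasDerivAt s hs).congr_of_eventuallyEq ?_).congr_deriv (key hs).2.symm
    filter_upwards [Iio_mem_nhds hs] with x hx using (key hx).1
  · refine (((h T).hasDerivAt_deriv s hs).congr_of_eventuallyEq ?_).congr_deriv ?_
    · filter_upwards [Iio_mem_nhds hs] with x hx using (key hx).2
    · rw [(key hs).1, (key hs).2]
  · refine (h T).tendsto.congr' ?_
    filter_upwards [eventually_lt_atBot T] with s hs using (key hs).1.symm

/-- The coefficient of the drift term in the equation satisfied by `f ^ m / m`. -/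
noncomputable def diffusionCoeff (m β x : ℝ) : ℝ :=
  β * (m * x) ^ (1 / m - 1)

section diffusionCoeff

variable {m β : ℝ}

theorem diffusionCoeff_pos (hm : 0 < m) (hβ : 0 < β) {x : ℝ} (hx : 0 < x) :
    0 < diffusionCoeff m β x := by
  unfold diffusionCoeff; positivity

theorem hasDerivAt_diffusionCoeff_primitive (hm : 0 < m) {x : ℝ} (hx : 0 < x) :
    HasDerivAt (fun x => β * (m * x) ^ (1 / m)) (diffusionCoeff m β x) x := by
  have h := (((hasDerivAt_id x).const_mul m).rpow_const (p := 1 / m)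
    (Or.inl (mul_pos hm hx).ne')).const_mul β
  refine h.congr_deriv ?_
  simp only [diffusionCoeff, id]
  field_simp

theorem continuousOn_diffusionCoeff (hm : 0 < m) : ContinuousOn (diffusionCoeff m β) (Ioi 0) := by
  unfold diffusionCoeff
  exact continuousOn_const.mul ((continuousOn_const.mul continuousOn_id).rpow_const
    fun x hx => Or.inl (mul_pos hm hx).ne')

theorem contDiff_diffusionCoeff_exp (hm : 0 < m) :
    ContDiff ℝ 1 fun u => diffusionCoeff m β (exp u) := by
  unfold diffusionCoeff
  exact contDiff_const.mul ((contDiff_const.mul contDiff_exp).rpow_const_of_ne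
    fun u => (mul_pos hm (exp_pos u)).ne')

theorem exp_mul_diffusionCoeff (hm : 0 < m) (hβ : 0 < β) {α κ : ℝ}
    (hκ : (1 - m) * α = (2 + κ) * β) (s : ℝ) {x : ℝ} (hx : 0 < x) :
    exp s ^ 2 * diffusionCoeff m β x
      = exp (-κ * s) * diffusionCoeff m β (exp (m * (α / β) * s) * x) := by
  have h1 : m * (exp (m * (α / β) * s) * x) = exp (m * (α / β) * s) * (m * x) := by ring
  have h2 : -κ * s + m * (α / β) * s * (1 / m - 1) = s + s := by
    field_simp
    linear_combination s * hκ
  rw [diffusionCoeff, diffusionCoeff, h1, mul_rpow (exp_pos _).le (mul_pos hm hx).le, ← exp_mul,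
    pow_two, ← exp_add, ← h2, exp_add]
  ring

/-- The lower order terms of the equation in terms of `w = f ^ m / m`. -/
theorem lower_order_eq (hm : 0 < m) (hβ : 0 < β) (α : ℝ) {f w : ℝ → ℝ} {r w' : ℝ} (hw : 0 < w r)
    (hfw : f =ᶠ[nhds r] fun x => (m * w x) ^ (1 / m)) (h : HasDerivAt w w' r) :
    α * f r + β * r * deriv f r
      = diffusionCoeff m β (w r) * (m * (α / β) * w r + r * w') := by
  have hmw : 0 < m * w r := mul_pos hm hw
  have hd := (((h.const_mul m).rpow_const (p := 1 / m) (Or.inl hmw.ne')).congr_of_eventuallyEq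
    hfw).deriv
  have hp : (m * w r) ^ (1 / m) = (m * w r) ^ (1 / m - 1) * (m * w r) := by
    rw [rpow_sub_one hmw.ne']
    field_simp
  rw [hd, hfw.eq_of_nhds, diffusionCoeff, hp]
  field_simp

end diffusionCoeff

theorem rpow_div_eq_iff {m x y : ℝ} (hm : 0 < m) (hx : 0 < x) (hy : 0 < y) :
    x ^ m / m = y ↔ x = (m * y) ^ (1 / m) := by
  constructor
  · rintro rfl
    rw [mul_div_cancel₀ _ hm.ne', ← rpow_mul hx.le, mul_one_div_cancel hm.ne', rpow_one]
  · rintro rfl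
    rw [← rpow_mul (mul_pos hm hy).le, one_div_mul_cancel hm.ne', rpow_one,
      mul_div_cancel_left₀ _ hm.ne']

/-- Passing to the variable `s = log r` and rescaling turns a self-similar profile into a solution
of an equation with constant linear part. -/
theorem FDESol.isProfileOn {n : ℕ} {m α β η κ : ℝ} {f : ℝ → ℝ} (hf : FDESol n m α β η f)
    (hm : 0 < m) (hβ : 0 < β) (hη : 0 < η) (hκ : (1 - m) * α = (2 + κ) * β) (T : ℝ) :
    IsProfileOn κ (n - 2 - 2 * (m * (α / β))) (m * (α / β) * (n - 2 - m * (α / β)))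
      (diffusionCoeff m β) (η ^ m / m) T
      (fun s => exp (m * (α / β) * s) * (f (exp s) ^ m / m))
      (fun s => exp (m * (α / β) * s) * (m * (α / β) * (f (exp s) ^ m / m)
        + exp s * deriv (fun r => f r ^ m / m) (exp s))) := by
  obtain ⟨hpos, hC, hode, hlim⟩ := hf
  set w : ℝ → ℝ := fun r => f r ^ m / m with hw
  set a := m * (α / β) with ha
  have hwpos : ∀ r > 0, 0 < w r := fun r hr => div_pos (rpow_pos_of_pos (hpos r hr) _) hm
  have hw1 : ∀ r > 0, HasDerivAt w (deriv w r) r := fun r hr =>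
    ((hC.contDiffAt (Ioi_mem_nhds hr)).differentiableAt two_ne_zero).hasDerivAt
  have hC' : ContDiffOn ℝ 1 (deriv w) (Ioi 0) :=
    (contDiffOn_succ_iff_deriv_of_isOpen (n := 1) isOpen_Ioi).1 hC |>.2.2
  have hw2 : ∀ r > 0, HasDerivAt (deriv w) (deriv (deriv w) r) r := fun r hr =>
    ((hC'.contDiffAt (Ioi_mem_nhds hr)).differentiableAt one_ne_zero).hasDerivAt
  have hφ : ∀ s, HasDerivAt (fun s => w (exp s)) (exp s * deriv w (exp s)) s := fun s =>
    ((hw1 _ (exp_pos s)).comp s (Real.hasDerivAt_exp s)).congr_deriv (mul_comm _ _)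
  have hφ' : ∀ s, HasDerivAt (fun s => exp s * deriv w (exp s))
      (exp s * deriv w (exp s) + exp s ^ 2 * deriv (deriv w) (exp s)) s := fun s =>
    ((Real.hasDerivAt_exp s).mul ((hw2 _ (exp_pos s)).comp s (Real.hasDerivAt_exp s))).congr_deriv
      (by simp only [Function.comp_apply]; ring)
  have hE := IsProfileOn.hasDerivAt_exp_mul a
  refine ⟨fun s _ => mul_pos (exp_pos _) (hwpos _ (exp_pos s)), fun s _ => ?_, fun s _ => ?_, ?_⟩
  · exact ((hE s).mul (hφ s)).congr_deriv (by ring)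
  · refine ((hE s).mul (((hφ s).const_mul a).add (hφ' s))).congr_deriv ?_
    have hr := exp_pos s
    have hlow := lower_order_eq (f := f) hm hβ α (hwpos _ hr) ?_ (hw1 _ hr)
    · have h0 := hode _ hr
      rw [add_assoc, hlow] at h0
      have h1 := exp_mul_diffusionCoeff hm hβ hκ s (hwpos _ hr)
      have h2 : exp s ^ 2 * deriv (deriv w) (exp s) = -(((n : ℝ) - 1) * (exp s * deriv w (exp s)))
          - exp s ^ 2 * diffusionCoeff m β (w (exp s))
            * (a * w (exp s) + exp s * deriv w (exp s)) := by
        have hne := hr.ne'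
        have h3 : exp s ^ 2 * (((n : ℝ) - 1) / exp s * deriv w (exp s))
            = ((n : ℝ) - 1) * (exp s * deriv w (exp s)) := by field_simp
        linear_combination exp s ^ 2 * h0 - h3
      rw [h1] at h2
      simp only [Pi.add_apply]
      linear_combination exp (a * s) * h2
    · filter_upwards [Ioi_mem_nhds hr] with x hx
      exact (rpow_div_eq_iff hm (hpos x hx) (hwpos x hx)).1 rfl
  · have h1 : Tendsto (fun s => (exp s ^ (α / β) * f (exp s)) ^ m / m) atBot
        (nhds (η ^ m / m)) :=
      ((hlim.comp tendsto_exp_atBot_nhdsGT).rpow_const (Or.inl hη.ne')).div_const m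
    refine h1.congr fun s => ?_
    rw [mul_rpow (rpow_nonneg (exp_pos s).le _) (hpos _ (exp_pos s)).le, ← exp_mul, ← exp_mul,
      show s * (α / β) * m = a * s by rw [ha]; ring, mul_div_assoc]

theorem IsProfileOn.exists_fdeSol {n : ℕ} {m α β η κ : ℝ} {v p : ℝ → ℝ}
    (h : ∀ T, IsProfileOn κ (n - 2 - 2 * (m * (α / β))) (m * (α / β) * (n - 2 - m * (α / β)))
      (diffusionCoeff m β) (η ^ m / m) T v p)
    (hm : 0 < m) (hβ : 0 < β) (hη : 0 < η) (hκ : (1 - m) * α = (2 + κ) * β) :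
    ∃ f, FDESol n m α β η f := by
  set a := m * (α / β) with ha
  have hv : ∀ s, 0 < v s := fun s => (h (s + 1)).pos s (lt_add_one s)
  have hv1 : ∀ s, HasDerivAt v (p s) s := fun s => (h (s + 1)).hasDerivAt s (lt_add_one s)
  have hv2 := fun s => (h (s + 1)).hasDerivAt_deriv s (lt_add_one s)
  have hvc : Continuous v := continuous_iff_continuousAt.2 fun s => (hv1 s).continuousAt
  have hpc : Continuous p := continuous_iff_continuousAt.2 fun s => (hv2 s).continuousAt
  have hGc : Continuous fun s => diffusionCoeff m β (v s) :=
    (continuousOn_diffusionCoeff hm).comp_continuous hvc hv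
  have hpC : ContDiff ℝ 1 p := by
    refine contDiff_one_iff_deriv.2 ⟨fun s => (hv2 s).differentiableAt, ?_⟩
    rw [funext fun s => (hv2 s).deriv]
    fun_prop
  have hvC : ContDiff ℝ 2 v := by
    refine (contDiff_succ_iff_deriv (n := 1)).2
      ⟨fun s => (hv1 s).differentiableAt, by simp, ?_⟩
    rwa [funext fun s => (hv1 s).deriv]
  set w : ℝ → ℝ := fun r => exp (-a * log r) * v (log r) with hw
  set w₁ : ℝ → ℝ := fun r => exp (-a * log r) * (p (log r) - a * v (log r)) / r with hw₁
  have hwpos : ∀ r, 0 < w r := fun r => mul_pos (exp_pos _) (hv _)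
  have hE : ∀ r > 0, HasDerivAt (fun r => exp (-a * log r)) (-a * exp (-a * log r) / r) r :=
    fun r hr => ((IsProfileOn.hasDerivAt_exp_mul (-a) (log r)).comp r
      (Real.hasDerivAt_log hr.ne')).congr_deriv (by ring)
  have hwd : ∀ r > 0, HasDerivAt w (w₁ r) r := fun r hr =>
    ((hE r hr).mul ((hv1 _).comp r (Real.hasDerivAt_log hr.ne'))).congr_deriv (by
      simp only [hw₁, Function.comp_apply]; field_simp; ring)
  have hwd₁ : ∀ r > 0, HasDerivAt w₁ (-((n : ℝ) - 1) / r * w₁ r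
      - diffusionCoeff m β (w r) * (a * w r + r * w₁ r)) r := fun r hr => by
    have hl := Real.hasDerivAt_log hr.ne'
    refine (((hE r hr).mul (((hv2 _).comp r hl).sub (((hv1 _).comp r hl).const_mul a))).div
      (hasDerivAt_id r) hr.ne').congr_deriv ?_
    have h1 := exp_mul_diffusionCoeff hm hβ hκ (log r) (hwpos r)
    have h2 : exp (a * log r) * w r = v (log r) := by
      rw [hw]
      dsimp only
      rw [← mul_assoc, ← exp_add]
      simp
    rw [← ha, h2, exp_log hr] at h1
    have h3 : a * w r + r * w₁ r = exp (-a * log r) * p (log r) := by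
      simp only [hw, hw₁]; field_simp; ring
    rw [h3]
    simp only [hw₁, Function.comp_apply, Pi.sub_apply, Pi.mul_apply, id]
    generalize exp (-κ * log r) = c at h1 ⊢
    field_simp
    linear_combination p (log r) * h1
  have hdw : ∀ r > 0, deriv w =ᶠ[nhds r] w₁ := fun r hr => by
    filter_upwards [Ioi_mem_nhds hr] with x hx using (hwd x hx).deriv
  have hfw : (fun r => ((m * w r) ^ (1 / m)) ^ m / m) = w := funext fun r =>
    (rpow_div_eq_iff hm (rpow_pos_of_pos (mul_pos hm (hwpos r)) _) (hwpos r)).2 rfl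
  refine ⟨fun r => (m * w r) ^ (1 / m), fun r _ => rpow_pos_of_pos (mul_pos hm (hwpos r)) _,
    ?_, fun r hr => ?_, ?_⟩
  · rw [hfw]
    have hlog : ContDiffOn ℝ 2 log (Ioi 0) := contDiffOn_log.mono fun x hx => ne_of_gt hx
    exact (contDiff_exp.comp_contDiffOn (contDiffOn_const.mul hlog)).mul
      (hvC.comp_contDiffOn hlog)
  · have hr' : 0 < r := hr
    rw [hfw, (hdw r hr).deriv_eq, (hwd₁ r hr).deriv, (hdw r hr).eq_of_nhds, add_assoc,
      lower_order_eq hm hβ α (hwpos r) (EventuallyEq.refl _ _) (hwd r hr), ← ha]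
    ring
  · have hl := (h 0).tendsto.comp tendsto_log_nhdsGT_zero
    have h1 : Tendsto (fun r => (m * v (log r)) ^ (1 / m)) (nhdsWithin 0 (Ioi 0))
        (nhds ((m * (η ^ m / m)) ^ (1 / m))) :=
      (hl.const_mul m).rpow_const (Or.inl (by positivity))
    rw [← (rpow_div_eq_iff hm hη (by positivity)).1 rfl] at h1
    refine h1.congr' ?_
    filter_upwards [self_mem_nhdsWithin] with r hr
    have h2 : m * w r = exp (-a * log r) * (m * v (log r)) := by rw [hw]; ring
    rw [h2, mul_rpow (exp_pos _).le (mul_pos hm (hv _)).le, ← exp_mul, rpow_def_of_pos hr,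
      ← mul_assoc, ← exp_add]
    have h3 : log r * (α / β) + -a * log r * (1 / m) = 0 := by
      rw [ha]; field_simp; ring
    rw [h3, exp_zero, one_mul]

theorem stmt1 (n : ℕ) (m ρ1 η β α : ℝ)
    (hn : 3 ≤ n) (hm0 : 0 < m) (hm1 : m < ((n : ℝ) - 2) / (n : ℝ))
    (hρ1 : 0 < ρ1) (hη : 0 < η)
    (hβ : m * ρ1 / ((n : ℝ) - 2 - (n : ℝ) * m) < β)
    (hα : α = (2 * β + ρ1) / (1 - m)) :
    ∃ f : ℝ → ℝ, FDESol n m α β η f ∧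
      ∀ f' : ℝ → ℝ, FDESol n m α β η f' → Set.EqOn f' f (Set.Ioi 0) := by
  have hn' : (3 : ℝ) ≤ n := by exact_mod_cast hn
  rw [lt_div_iff₀ (by linarith)] at hm1
  have hd : 0 < (n : ℝ) - 2 - n * m := by linarith
  have hm1' : 0 < 1 - m := by nlinarith
  have hβ0 : 0 < β := lt_trans (by positivity) hβ
  rw [div_lt_iff₀ hd] at hβ
  have hκ : 0 < ρ1 / β := by positivity
  have hακ : (1 - m) * α = (2 + ρ1 / β) * β := by
    rw [hα]; field_simp
  have hα0 : 0 < α := by rw [hα]; positivity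
  have hB : 0 < m * (α / β) * (n - 2 - m * (α / β)) := by
    refine mul_pos (by positivity) ?_
    have h1 : (n : ℝ) - 2 - m * (α / β)
        = (β * (n - 2 - n * m) - m * ρ1) / (β * (1 - m)) := by
      rw [hα]; field_simp; ring
    rw [h1]
    exact div_pos (by linarith) (by positivity)
  have hv₀ : 0 < η ^ m / m := by positivity
  have hH := fun x (hx : x > 0) => hasDerivAt_diffusionCoeff_primitive (β := β) hm0 hx
  have hGc := continuousOn_diffusionCoeff (β := β) hm0
  have hGpos := fun x (hx : x > 0) => diffusionCoeff_pos hm0 hβ0 hx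
  obtain ⟨v, p, hvp⟩ := exists_forall_isProfileOn (A := n - 2 - 2 * (m * (α / β))) hκ hB hv₀ hH hGc
    (contDiff_diffusionCoeff_exp hm0) hGpos
  obtain ⟨f, hf⟩ := IsProfileOn.exists_fdeSol hvp hm0 hβ0 hη hακ
  refine ⟨f, hf, fun f' hf' r hr => ?_⟩
  have heq := (hf'.isProfileOn hm0 hβ0 hη hακ (log r + 1)).eqOn
    (hf.isProfileOn hm0 hβ0 hη hακ (log r + 1)) hκ hv₀ hH hGc hGpos
    (mem_Iio.2 (lt_add_one (log r)))
  simp only [exp_log hr] at heq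
  have heq' := mul_left_cancel₀ (exp_pos _).ne' heq
  have hfr := div_pos (rpow_pos_of_pos (hf.1 r hr) m) hm0
  rw [(rpow_div_eq_iff hm0 (hf'.1 r hr) hfr).1 heq',
    ← (rpow_div_eq_iff hm0 (hf.1 r hr) hfr).1 rfl]
end

section
/- There exists a unique positive function g on (0,∞) such that r ↦ g'(r)/g(r) is continuously differentiable on (0,∞), (g'/g)'(r) + ((n-1)/r)·(g'(r)/g(r)) + α0·g(r) + β0·r·g'(r) = 0 for all r > 0, lim_{r→0+} r^{α0/β0}·g(r) = η, and, with q(r) = r^{α0/β0}·g(r) and h(s) = e^s·q'(e^s)/q(e^s), the bound 0 < h(s)·e^{-(ρ1/β0)s} ≤ C0/η holds for all s ∈ ℝ. -/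
open Real Set Filter

/-- `h(s) = e^s q'(e^s) / q(e^s)` where `q(r) = r^{α0/β0} g(r)`. -/
noncomputable def Hfun (α0 β0 : ℝ) (g : ℝ → ℝ) (s : ℝ) : ℝ :=
  Real.exp s * deriv (fun r => r ^ (α0 / β0) * g r) (Real.exp s) /
    (Real.exp s ^ (α0 / β0) * g (Real.exp s))

/-- radially symmetric solution of `Δ log g + α0 g + β0 x·∇g = 0` on `(0,∞)`
with `lim_{r→0+} r^{α0/β0} g(r) = η`. -/
def LogSol (n : ℕ) (α0 β0 η : ℝ) (g : ℝ → ℝ) : Prop :=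
  (∀ r ∈ Set.Ioi (0 : ℝ), 0 < g r) ∧
  ContDiffOn ℝ 1 (fun r => deriv g r / g r) (Set.Ioi 0) ∧
  (∀ r ∈ Set.Ioi (0 : ℝ),
    deriv (fun r' => deriv g r' / g r') r
      + (((n : ℝ) - 1) / r) * (deriv g r / g r)
      + α0 * g r + β0 * r * deriv g r = 0) ∧
  Filter.Tendsto (fun r => r ^ (α0 / β0) * g r) (nhdsWithin 0 (Set.Ioi 0)) (nhds η)

/-- the bound `0 < h(s) e^{-(ρ1/β0) s} ≤ C0/η` for all `s ∈ ℝ`. -/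
def LogHBound (α0 β0 ρ1 η C0 : ℝ) (g : ℝ → ℝ) : Prop :=
  ∀ s : ℝ, 0 < Hfun α0 β0 g s * Real.exp (-(ρ1 / β0) * s) ∧
    Hfun α0 β0 g s * Real.exp (-(ρ1 / β0) * s) ≤ C0 / η

open MeasureTheory in
/-- The primitive of a function that is integrable on left half-lines. -/
theorem hasDerivAt_setIntegral_Iic {u : ℝ → ℝ} (hu : Continuous u)
    (hi : ∀ s, IntegrableOn u (Iic s)) (s : ℝ) :
    HasDerivAt (fun s => ∫ t in Iic s, u t) (u s) s := by
  have hF : (fun s => ∫ t in Iic s, u t) = fun s => (∫ t in Iic 0, u t) + ∫ t in (0:ℝ)..s, u t := by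
    ext x
    rw [← intervalIntegral.integral_Iic_sub_Iic (hi 0) (hi x)]
    ring
  rw [hF]
  exact (hu.integral_hasStrictDerivAt 0 s).hasDerivAt.const_add _

/-- The bounded solution of `h' = 1 - f h`. -/
noncomputable def relaxation (f : ℝ → ℝ) (s : ℝ) : ℝ :=
  ∫ t in Iic s, exp (-∫ σ in t..s, f σ)

section Relaxation

variable {b γ : ℝ} {f : ℝ → ℝ}

theorem mul_sub_le_integral_exp (hb : 0 ≤ b) (hγ : 0 ≤ γ) {t s : ℝ} (hts : t ≤ s) :
    b * exp (-γ * s) * (s - t) ≤ ∫ σ in t..s, b * exp (-γ * σ) := by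
  have h : ∫ _σ in t..s, b * exp (-γ * s) ≤ ∫ σ in t..s, b * exp (-γ * σ) := by
    apply intervalIntegral.integral_mono_on hts
    · simp
    · exact (by fun_prop : Continuous fun σ => b * exp (-γ * σ)).intervalIntegrable _ _
    · intro σ hσ
      have := hσ.2
      gcongr b * exp ?_
      nlinarith
  rw [intervalIntegral.integral_const, smul_eq_mul] at h
  linarith

theorem integral_exp_le_integral (hf : Continuous f) (hfb : ∀ σ, b * exp (-γ * σ) ≤ f σ)
    {t s : ℝ} (hts : t ≤ s) :
    ∫ σ in t..s, b * exp (-γ * σ) ≤ ∫ σ in t..s, f σ :=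
  intervalIntegral.integral_mono_on hts
    ((by fun_prop : Continuous fun σ => b * exp (-γ * σ)).intervalIntegrable _ _)
    (hf.intervalIntegrable _ _) fun σ _ => hfb σ

theorem continuous_integral_left (hf : Continuous f) (s : ℝ) :
    Continuous fun t => ∫ σ in t..s, f σ := by
  have : (fun t => ∫ σ in t..s, f σ) = fun t => -∫ σ in s..t, f σ := by
    ext t; rw [intervalIntegral.integral_symm]
  rw [this]
  exact (intervalIntegral.continuous_primitive (fun _ _ => hf.intervalIntegrable _ _) s).neg

theorem integrableOn_exp_mul_sub {c : ℝ} (hc : 0 < c) (s : ℝ) :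
    MeasureTheory.IntegrableOn (fun t => exp (-(c * (s - t)))) (Iic s) := by
  refine ((integrableOn_exp_mul_Iic hc s).const_mul (exp (-(c * s)))).congr
    (Eventually.of_forall fun t => ?_)
  simp only [← exp_add]
  ring_nf

theorem integral_exp_mul_sub {c : ℝ} (hc : 0 < c) (s : ℝ) :
    ∫ t in Iic s, exp (-(c * (s - t))) = 1 / c := by
  have : ∀ t, exp (-(c * (s - t))) = exp (-(c * s)) * exp (c * t) := fun t => by
    rw [← exp_add]; ring_nf
  simp_rw [this, MeasureTheory.integral_const_mul, integral_exp_mul_Iic hc, mul_div_assoc',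
    ← exp_add]
  simp

theorem exp_neg_integral_le (hb : 0 < b) (hγ : 0 < γ) (hf : Continuous f)
    (hfb : ∀ σ, b * exp (-γ * σ) ≤ f σ) {t s : ℝ} (hts : t ≤ s) :
    exp (-∫ σ in t..s, f σ) ≤ exp (-(b * exp (-γ * s) * (s - t))) := by
  have h1 := mul_sub_le_integral_exp hb.le hγ.le hts
  have h2 := integral_exp_le_integral hf hfb hts
  exact exp_le_exp.2 (by linarith)

theorem integrableOn_exp_neg_integral (hb : 0 < b) (hγ : 0 < γ) (hf : Continuous f)
    (hfb : ∀ σ, b * exp (-γ * σ) ≤ f σ) (s : ℝ) :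
    MeasureTheory.IntegrableOn (fun t => exp (-∫ σ in t..s, f σ)) (Iic s) := by
  have hc : 0 < b * exp (-γ * s) := by positivity
  refine (integrableOn_exp_mul_sub hc s).mono'
    (continuous_integral_left hf s).neg.rexp.aestronglyMeasurable ?_
  filter_upwards [MeasureTheory.ae_restrict_mem measurableSet_Iic] with t ht
  rw [norm_of_nonneg (exp_pos _).le]
  exact exp_neg_integral_le hb hγ hf hfb ht

theorem relaxation_le (hb : 0 < b) (hγ : 0 < γ) (hf : Continuous f)
    (hfb : ∀ σ, b * exp (-γ * σ) ≤ f σ) (s : ℝ) : relaxation f s ≤ exp (γ * s) / b := by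
  have hc : 0 < b * exp (-γ * s) := by positivity
  calc relaxation f s ≤ ∫ t in Iic s, exp (-(b * exp (-γ * s) * (s - t))) :=
        MeasureTheory.setIntegral_mono_on (integrableOn_exp_neg_integral hb hγ hf hfb s)
          (integrableOn_exp_mul_sub hc s) measurableSet_Iic
          fun t ht => exp_neg_integral_le hb hγ hf hfb ht
    _ = exp (γ * s) / b := by
        rw [integral_exp_mul_sub hc, neg_mul, exp_neg]
        field_simp

theorem relaxation_pos (hb : 0 < b) (hγ : 0 < γ) (hf : Continuous f)
    (hfb : ∀ σ, b * exp (-γ * σ) ≤ f σ) (s : ℝ) : 0 < relaxation f s := by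
  unfold relaxation
  rw [MeasureTheory.setIntegral_pos_iff_support_of_nonneg_ae
    (Eventually.of_forall fun t => (exp_pos _).le) (integrableOn_exp_neg_integral hb hγ hf hfb s)]
  have : Function.support (fun t => exp (-∫ σ in t..s, f σ)) = univ := by
    ext t; simp [(exp_pos _).ne']
  simp [this]

theorem exp_neg_integral_eq (hf : Continuous f) (t s : ℝ) :
    exp (-∫ σ in t..s, f σ) = exp (-∫ σ in 0..s, f σ) * exp (∫ σ in 0..t, f σ) := by
  rw [← intervalIntegral.integral_interval_sub_left (hf.intervalIntegrable 0 s)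
    (hf.intervalIntegrable 0 t), ← exp_add]
  ring_nf

theorem integrableOn_exp_integral (hb : 0 < b) (hγ : 0 < γ) (hf : Continuous f)
    (hfb : ∀ σ, b * exp (-γ * σ) ≤ f σ) (s : ℝ) :
    MeasureTheory.IntegrableOn (fun t => exp (∫ σ in 0..t, f σ)) (Iic s) := by
  refine ((integrableOn_exp_neg_integral hb hγ hf hfb s).const_mul
    (exp (∫ σ in 0..s, f σ))).congr (Eventually.of_forall fun t => ?_)
  simp only [exp_neg_integral_eq hf t s]
  rw [← mul_assoc, ← exp_add]
  simp

theorem relaxation_eq (hf : Continuous f) (s : ℝ) :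
    relaxation f s = exp (-∫ σ in 0..s, f σ) * ∫ t in Iic s, exp (∫ σ in 0..t, f σ) := by
  rw [relaxation, ← MeasureTheory.integral_const_mul]
  exact congrArg _ <| funext fun t => exp_neg_integral_eq hf t s

theorem hasDerivAt_relaxation (hb : 0 < b) (hγ : 0 < γ) (hf : Continuous f)
    (hfb : ∀ σ, b * exp (-γ * σ) ≤ f σ) (s : ℝ) :
    HasDerivAt (relaxation f) (1 - f s * relaxation f s) s := by
  have hF : HasDerivAt (fun s => ∫ σ in 0..s, f σ) (f s) s :=
    (hf.integral_hasStrictDerivAt 0 s).hasDerivAt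
  have hI := hasDerivAt_setIntegral_Iic
    (intervalIntegral.continuous_primitive (fun _ _ => hf.intervalIntegrable _ _) 0).rexp
    (integrableOn_exp_integral hb hγ hf hfb) s
  have h := hF.neg.exp.mul hI
  rw [show relaxation f = _ from funext (relaxation_eq hf)]
  refine h.congr_deriv ?_
  have : exp (-∫ σ in 0..s, f σ) * exp (∫ σ in 0..s, f σ) = 1 := by rw [← exp_add]; simp
  simp only [Pi.neg_apply]
  linear_combination this

theorem abs_relaxation_sub_le {f₁ f₂ : ℝ → ℝ} {C : ℝ} (hb : 0 < b) (hγ : 0 < γ) (hC : 0 ≤ C)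
    (hf₁ : Continuous f₁) (hf₂ : Continuous f₂) (hfb₁ : ∀ σ, b * exp (-γ * σ) ≤ f₁ σ)
    (hfb₂ : ∀ σ, b * exp (-γ * σ) ≤ f₂ σ) (s : ℝ)
    (h : ∀ σ ≤ s, |f₁ σ - f₂ σ| ≤ C * (b * exp (-γ * σ))) :
    |relaxation f₁ s - relaxation f₂ s| ≤ C * (2 * exp (γ * s) / b) := by
  have hc : 0 < b * exp (-γ * s) / 2 := by positivity
  have hi₁ := integrableOn_exp_neg_integral hb hγ hf₁ hfb₁ s
  have hi₂ := integrableOn_exp_neg_integral hb hγ hf₂ hfb₂ s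
  have key : ∀ t ∈ Iic s, ‖exp (-∫ σ in t..s, f₁ σ) - exp (-∫ σ in t..s, f₂ σ)‖
      ≤ C * exp (-(b * exp (-γ * s) / 2 * (s - t))) := by
    intro t ht
    have hJ := mul_sub_le_integral_exp hb.le hγ.le (mem_Iic.1 ht)
    have hJ₁ := integral_exp_le_integral hf₁ hfb₁ (mem_Iic.1 ht)
    have hJ₂ := integral_exp_le_integral hf₂ hfb₂ (mem_Iic.1 ht)
    have hd : |(∫ σ in t..s, f₁ σ) - ∫ σ in t..s, f₂ σ| ≤ C * ∫ σ in t..s, b * exp (-γ * σ) := by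
      rw [← intervalIntegral.integral_sub (hf₁.intervalIntegrable _ _) (hf₂.intervalIntegrable _ _),
        ← intervalIntegral.integral_const_mul]
      refine (intervalIntegral.abs_integral_le_integral_abs ht).trans ?_
      exact intervalIntegral.integral_mono_on ht
        ((hf₁.sub hf₂).abs.intervalIntegrable _ _)
        ((by fun_prop : Continuous fun σ => C * (b * exp (-γ * σ))).intervalIntegrable _ _)
        fun σ hσ => h σ hσ.2
    have hJ0 : 0 ≤ b * exp (-γ * s) * (s - t) := by
      have := sub_nonneg.2 (mem_Iic.1 ht)
      positivity
    generalize (∫ σ in t..s, b * exp (-γ * σ)) = J at *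
    generalize (∫ σ in t..s, f₁ σ) = x at *
    generalize (∫ σ in t..s, f₂ σ) = y at *
    have hexp : ∀ x y, J ≤ x → x ≤ y → exp (-x) - exp (-y) ≤ exp (-J) * (y - x) := by
      intro x y hx hxy
      have h1 : exp (-y) = exp (-x) * exp (x - y) := by rw [← exp_add]; ring_nf
      have h2 := add_one_le_exp (x - y)
      have h3 : exp (-x) ≤ exp (-J) := exp_le_exp.2 (by linarith)
      have h4 := exp_pos (-x)
      nlinarith
    have hxy : |exp (-x) - exp (-y)| ≤ exp (-J) * |x - y| := by
      rcases le_total x y with hle | hle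
      · rw [abs_of_nonneg (sub_nonneg.2 (exp_le_exp.2 (by linarith))), abs_sub_comm,
          abs_of_nonneg (sub_nonneg.2 hle)]
        exact hexp x y hJ₁ hle
      · rw [abs_sub_comm, abs_of_nonneg (sub_nonneg.2 (exp_le_exp.2 (by linarith))),
          abs_of_nonneg (sub_nonneg.2 hle)]
        exact hexp y x hJ₂ hle
    have hJe : J * exp (-J) ≤ exp (-(J / 2)) := by
      have h1 : exp (-J) = exp (-(J / 2)) * exp (-(J / 2)) := by rw [← exp_add]; ring_nf
      have h2 : exp (-(J / 2)) * exp (J / 2) = 1 := by rw [← exp_add]; simp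
      have h3 := quadratic_le_exp_of_nonneg (show 0 ≤ J / 2 by linarith)
      have h4 : J ≤ exp (J / 2) := by nlinarith [sq_nonneg (J / 2 - 1)]
      have h5 := exp_pos (-(J / 2))
      rw [h1]
      nlinarith
    have hJc : exp (-(J / 2)) ≤ exp (-(b * exp (-γ * s) / 2 * (s - t))) :=
      exp_le_exp.2 (by linarith)
    calc |exp (-x) - exp (-y)| ≤ exp (-J) * (C * J) := hxy.trans (by gcongr)
      _ = C * (J * exp (-J)) := by ring
      _ ≤ _ := by gcongr; exact hJe.trans hJc
  unfold relaxation
  rw [← MeasureTheory.integral_sub hi₁ hi₂, ← Real.norm_eq_abs]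
  refine (MeasureTheory.norm_integral_le_of_norm_le
    ((integrableOn_exp_mul_sub hc s).const_mul C)
    ((MeasureTheory.ae_restrict_iff' measurableSet_Iic).2 (Eventually.of_forall key))).trans ?_
  rw [MeasureTheory.integral_const_mul, integral_exp_mul_sub hc, neg_mul, exp_neg]
  apply le_of_eq
  field_simp

/-- A solution of `h' = k - f h` that stays bounded near `-∞` is `k` times the relaxation. -/
theorem eq_mul_relaxation (hb : 0 < b) (hγ : 0 < γ) (hf : Continuous f)
    (hfb : ∀ σ, b * exp (-γ * σ) ≤ f σ) {h : ℝ → ℝ} {k M : ℝ}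
    (hh : ∀ s, HasDerivAt h (k - f s * h s) s) (hM : ∀ s ≤ 0, |h s| ≤ M) (s : ℝ) :
    h s = k * relaxation f s := by
  have hF : ∀ s, HasDerivAt (fun s => ∫ σ in 0..s, f σ) (f s) s := fun s =>
    (hf.integral_hasStrictDerivAt 0 s).hasDerivAt
  have hd : ∀ s, HasDerivAt (fun s => h s * exp (∫ σ in 0..s, f σ))
      (k * exp (∫ σ in 0..s, f σ)) s := fun s =>
    ((hh s).mul (hF s).exp).congr_deriv (by ring)
  have hlim : Tendsto (fun s => h s * exp (∫ σ in 0..s, f σ)) atBot (nhds 0) := by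
    have hFb : Tendsto (fun s => ∫ σ in 0..s, f σ) atBot atBot := by
      refine tendsto_atBot_mono' atBot (f₁ := fun s => b * s) ?_
        (tendsto_id.const_mul_atBot hb)
      filter_upwards [eventually_le_atBot 0] with t ht
      have h1 := mul_sub_le_integral_exp hb.le hγ.le ht
      have h2 := integral_exp_le_integral hf hfb ht
      rw [intervalIntegral.integral_symm]
      rw [mul_zero, exp_zero] at h1
      linarith
    have hE := (tendsto_exp_atBot.comp hFb).const_mul M
    rw [mul_zero] at hE
    refine squeeze_zero_norm' ?_ hE
    filter_upwards [eventually_le_atBot 0] with t ht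
    rw [norm_mul, norm_of_nonneg (exp_pos _).le]
    exact mul_le_mul_of_nonneg_right (hM t ht) (exp_pos _).le
  have := MeasureTheory.integral_Iic_of_hasDerivAt_of_tendsto' (a := s) (fun x _ => hd x)
    ((integrableOn_exp_integral hb hγ hf hfb s).const_mul k) hlim
  rw [MeasureTheory.integral_const_mul, sub_zero] at this
  rw [relaxation_eq hf, mul_left_comm, this, mul_left_comm, ← exp_add]
  simp

end Relaxation

/-- `ζ = log (q / η)` and `h = ζ'` in the variable `s = log r`: the profile equation becomes
`h' = k - (m + b e^{-γ s + ζ}) h`. -/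
structure IsLogProfile (m b γ k : ℝ) (ζ h : ℝ → ℝ) : Prop where
  hasDerivAt : ∀ s, HasDerivAt ζ (h s) s
  hasDerivAt' : ∀ s, HasDerivAt h (k - (m + b * exp (-γ * s + ζ s)) * h s) s
  tendsto : Tendsto ζ atBot (nhds 0)
  pos : ∀ s, 0 < h s
  le : ∀ s, h s ≤ k / b * exp (γ * s)

/-- The coefficient `m + b e^{-γ s + ζ}`, with `ζ` clipped to `[0, P e^{γ s}]`. -/
noncomputable def clippedRate (m b γ P : ℝ) (ζ : ℝ → ℝ) (s : ℝ) : ℝ :=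
  m + b * exp (-γ * s + max 0 (min (ζ s) (P * exp (γ * s))))

/-- The integral operator whose fixed points are the logarithmic profiles. -/
noncomputable def profileMap (m b γ k : ℝ) (ζ : ℝ → ℝ) (s : ℝ) : ℝ :=
  ∫ t in Iic s, k * relaxation (clippedRate m b γ (k / b / γ) ζ) t

/-- The weight for which `profileMap` is a contraction. -/
noncomputable def profileWeight (P γ s : ℝ) : ℝ :=
  exp (4 * exp (P * exp (γ * s)))

section ProfileMap

variable {m b γ k P : ℝ} {ζ ζ₁ ζ₂ : ℝ → ℝ}

theorem continuous_clippedRate (hζ : Continuous ζ) : Continuous (clippedRate m b γ P ζ) := by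
  unfold clippedRate
  fun_prop

theorem le_clippedRate (hm : 0 ≤ m) (hb : 0 < b) (σ : ℝ) :
    b * exp (-γ * σ) ≤ clippedRate m b γ P ζ σ := by
  have h : exp (-γ * σ) ≤ exp (-γ * σ + max 0 (min (ζ σ) (P * exp (γ * σ)))) :=
    exp_le_exp.2 (by linarith [le_max_left 0 (min (ζ σ) (P * exp (γ * σ)))])
  unfold clippedRate
  nlinarith

theorem clippedRate_eq {s : ℝ} (h0 : 0 ≤ ζ s) (h1 : ζ s ≤ P * exp (γ * s)) :
    clippedRate m b γ P ζ s = m + b * exp (-γ * s + ζ s) := by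
  rw [clippedRate, min_eq_left h1, max_eq_right h0]

theorem abs_exp_sub_exp_le {x y M : ℝ} (hx : x ≤ M) (hy : y ≤ M) :
    |exp x - exp y| ≤ exp M * |x - y| := by
  have key : ∀ x y, x ≤ y → y ≤ M → exp y - exp x ≤ exp M * (y - x) := by
    intro x y hxy hy
    have h1 : exp x = exp y * exp (x - y) := by rw [← exp_add]; ring_nf
    have h2 := add_one_le_exp (x - y)
    have h3 := exp_le_exp.2 hy
    nlinarith [exp_pos y]
  rcases le_total x y with h | h
  · rw [abs_sub_comm, abs_sub_comm x, abs_of_nonneg (sub_nonneg.2 (exp_le_exp.2 h)),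
      abs_of_nonneg (sub_nonneg.2 h)]
    exact key x y h hy
  · rw [abs_of_nonneg (sub_nonneg.2 (exp_le_exp.2 h)), abs_of_nonneg (sub_nonneg.2 h)]
    exact key y x h hx

theorem abs_clippedRate_sub_le (hb : 0 < b) (hP : 0 ≤ P) (σ : ℝ) :
    |clippedRate m b γ P ζ₁ σ - clippedRate m b γ P ζ₂ σ| ≤
      exp (P * exp (γ * σ)) * |ζ₁ σ - ζ₂ σ| * (b * exp (-γ * σ)) := by
  have hM : 0 ≤ P * exp (γ * σ) := by positivity
  unfold clippedRate
  set M := P * exp (γ * σ)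
  have h1 := abs_exp_sub_exp_le (max_le hM (min_le_right (ζ₁ σ) M))
    (max_le hM (min_le_right (ζ₂ σ) M))
  have h2 : |max 0 (min (ζ₁ σ) M) - max 0 (min (ζ₂ σ) M)| ≤ |ζ₁ σ - ζ₂ σ| := by
    refine (abs_max_sub_max_le_max _ _ _ _).trans ?_
    rw [sub_self, abs_zero, max_eq_right (abs_nonneg _)]
    refine (abs_min_sub_min_le_max _ _ _ _).trans ?_
    simp
  rw [exp_add, exp_add, show ∀ x y : ℝ, m + b * (exp (-γ * σ) * x) - (m + b * (exp (-γ * σ) * y))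
    = (x - y) * (b * exp (-γ * σ)) by intros; ring, abs_mul,
    abs_of_pos (show 0 < b * exp (-γ * σ) by positivity)]
  gcongr
  exact h1.trans (by gcongr)

theorem profileWeight_mono (hP : 0 ≤ P) (hγ : 0 ≤ γ) : Monotone (profileWeight P γ) := by
  intro x y hxy
  unfold profileWeight
  gcongr

theorem profileWeight_pos (s : ℝ) : 0 < profileWeight P γ s := exp_pos _

theorem le_profileWeight (s : ℝ) : P * exp (γ * s) ≤ profileWeight P γ s := by
  unfold profileWeight
  have h1 := add_one_le_exp (P * exp (γ * s))
  have h2 := add_one_le_exp (4 * exp (P * exp (γ * s)))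
  linarith [exp_pos (P * exp (γ * s))]

theorem continuous_profileWeight : Continuous (profileWeight P γ) := by
  unfold profileWeight
  fun_prop

theorem integrableOn_mul_exp (hγ : 0 < γ) (c s : ℝ) :
    MeasureTheory.IntegrableOn (fun t => c * exp (γ * t)) (Iic s) :=
  (integrableOn_exp_mul_Iic hγ s).const_mul c

theorem integrableOn_of_abs_le_mul_exp (hγ : 0 < γ) {u : ℝ → ℝ} (hu : Continuous u) {c s : ℝ}
    (h : ∀ t ≤ s, |u t| ≤ c * exp (γ * t)) : MeasureTheory.IntegrableOn u (Iic s) := by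
  refine (integrableOn_mul_exp hγ c s).mono' hu.aestronglyMeasurable ?_
  filter_upwards [MeasureTheory.ae_restrict_mem measurableSet_Iic] with t ht using h t ht

theorem integrableOn_deriv_profileWeight (hP : 0 ≤ P) (hγ : 0 < γ) (s : ℝ) :
    MeasureTheory.IntegrableOn
      (fun t => 4 * (P * γ) * exp (γ * t) * exp (P * exp (γ * t)) * profileWeight P γ t)
      (Iic s) := by
  have hw := continuous_profileWeight (P := P) (γ := γ)
  refine integrableOn_of_abs_le_mul_exp hγ (by fun_prop)
    (c := 4 * (P * γ) * exp (P * exp (γ * s)) * profileWeight P γ s) fun t ht => ?_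
  have h1 := profileWeight_mono hP hγ.le ht
  have h0 := profileWeight_pos (P := P) (γ := γ) t
  have h2 : exp (P * exp (γ * t)) ≤ exp (P * exp (γ * s)) := by gcongr
  rw [abs_of_nonneg (by positivity)]
  calc _ = 4 * (P * γ) * exp (γ * t) * (exp (P * exp (γ * t)) * profileWeight P γ t) := by ring
    _ ≤ 4 * (P * γ) * exp (γ * t) * (exp (P * exp (γ * s)) * profileWeight P γ s) := by gcongr
    _ = _ := by ring

theorem integral_deriv_profileWeight_le (hP : 0 ≤ P) (hγ : 0 < γ) (s : ℝ) :
    ∫ t in Iic s, 4 * (P * γ) * exp (γ * t) * exp (P * exp (γ * t)) * profileWeight P γ t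
      ≤ profileWeight P γ s := by
  have hlim : Tendsto (profileWeight P γ) atBot (nhds (exp (4 * exp (P * 0)))) := by
    unfold profileWeight
    have : Tendsto (fun s => exp (γ * s)) atBot (nhds 0) :=
      tendsto_exp_atBot.comp (tendsto_id.const_mul_atBot hγ)
    exact ((this.const_mul P).rexp.const_mul 4).rexp
  have hd : ∀ t, HasDerivAt (profileWeight P γ)
      (4 * (P * γ) * exp (γ * t) * exp (P * exp (γ * t)) * profileWeight P γ t) t := by
    intro t
    have := (((((hasDerivAt_id t).const_mul γ).exp.const_mul P).exp).const_mul 4).exp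
    refine this.congr_deriv ?_
    simp only [profileWeight, id]
    ring
  rw [MeasureTheory.integral_Iic_of_hasDerivAt_of_tendsto' (fun t _ => hd t)
    (integrableOn_deriv_profileWeight hP hγ s) hlim]
  linarith [exp_pos (4 * exp (P * 0))]

theorem hasDerivAt_relaxation_clippedRate (hm : 0 ≤ m) (hb : 0 < b) (hγ : 0 < γ)
    (hζ : Continuous ζ) (s : ℝ) :
    HasDerivAt (fun s => k * relaxation (clippedRate m b γ P ζ) s)
      (k - clippedRate m b γ P ζ s * (k * relaxation (clippedRate m b γ P ζ) s)) s :=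
  ((hasDerivAt_relaxation hb hγ (continuous_clippedRate hζ)
    (le_clippedRate hm hb) s).const_mul k).congr_deriv (by ring)

theorem continuous_relaxation_clippedRate (hm : 0 ≤ m) (hb : 0 < b) (hγ : 0 < γ)
    (hζ : Continuous ζ) :
    Continuous fun s => k * relaxation (clippedRate m b γ P ζ) s :=
  continuous_iff_continuousAt.2 fun s =>
    (hasDerivAt_relaxation_clippedRate hm hb hγ hζ s).continuousAt

theorem relaxation_clippedRate_pos (hm : 0 ≤ m) (hb : 0 < b) (hγ : 0 < γ) (hk : 0 < k)
    (hζ : Continuous ζ) (s : ℝ) :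
    0 < k * relaxation (clippedRate m b γ P ζ) s :=
  mul_pos hk (relaxation_pos hb hγ (continuous_clippedRate hζ) (le_clippedRate hm hb) s)

theorem relaxation_clippedRate_le (hm : 0 ≤ m) (hb : 0 < b) (hγ : 0 < γ) (hk : 0 < k)
    (hζ : Continuous ζ) (s : ℝ) :
    k * relaxation (clippedRate m b γ P ζ) s ≤ k / b * exp (γ * s) := by
  rw [div_mul_eq_mul_div, mul_div_assoc]
  gcongr
  exact relaxation_le hb hγ (continuous_clippedRate hζ) (le_clippedRate hm hb) s

theorem integrableOn_relaxation_clippedRate (hm : 0 ≤ m) (hb : 0 < b) (hγ : 0 < γ) (hk : 0 < k)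
    (hζ : Continuous ζ) (s : ℝ) :
    MeasureTheory.IntegrableOn (fun s => k * relaxation (clippedRate m b γ P ζ) s) (Iic s) :=
  integrableOn_of_abs_le_mul_exp hγ (continuous_relaxation_clippedRate hm hb hγ hζ)
    fun t _ => by
      rw [abs_of_pos (relaxation_clippedRate_pos hm hb hγ hk hζ t)]
      exact relaxation_clippedRate_le hm hb hγ hk hζ t

theorem hasDerivAt_profileMap (hm : 0 ≤ m) (hb : 0 < b) (hγ : 0 < γ) (hk : 0 < k)
    (hζ : Continuous ζ) (s : ℝ) :
    HasDerivAt (profileMap m b γ k ζ)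
      (k * relaxation (clippedRate m b γ (k / b / γ) ζ) s) s :=
  hasDerivAt_setIntegral_Iic (continuous_relaxation_clippedRate hm hb hγ hζ)
    (integrableOn_relaxation_clippedRate hm hb hγ hk hζ) s

theorem continuous_profileMap (hm : 0 ≤ m) (hb : 0 < b) (hγ : 0 < γ) (hk : 0 < k)
    (hζ : Continuous ζ) : Continuous (profileMap m b γ k ζ) :=
  continuous_iff_continuousAt.2 fun s => (hasDerivAt_profileMap hm hb hγ hk hζ s).continuousAt

theorem profileMap_nonneg (hm : 0 ≤ m) (hb : 0 < b) (hγ : 0 < γ) (hk : 0 < k)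
    (hζ : Continuous ζ) (s : ℝ) : 0 ≤ profileMap m b γ k ζ s :=
  MeasureTheory.integral_nonneg fun t => (relaxation_clippedRate_pos hm hb hγ hk hζ t).le

theorem profileMap_le (hm : 0 ≤ m) (hb : 0 < b) (hγ : 0 < γ) (hk : 0 < k)
    (hζ : Continuous ζ) (s : ℝ) :
    profileMap m b γ k ζ s ≤ k / b / γ * exp (γ * s) := by
  calc profileMap m b γ k ζ s ≤ ∫ t in Iic s, k / b * exp (γ * t) :=
        MeasureTheory.setIntegral_mono (integrableOn_relaxation_clippedRate hm hb hγ hk hζ s)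
          (integrableOn_mul_exp hγ _ s) (relaxation_clippedRate_le hm hb hγ hk hζ)
    _ = _ := by
        rw [MeasureTheory.integral_const_mul, integral_exp_mul_Iic hγ]
        ring

theorem abs_profileMap_sub_le (hm : 0 ≤ m) (hb : 0 < b) (hγ : 0 < γ) (hk : 0 < k)
    (hζ₁ : Continuous ζ₁) (hζ₂ : Continuous ζ₂) {D : ℝ} (hD : 0 ≤ D)
    (h : ∀ s, |ζ₁ s - ζ₂ s| ≤ D * profileWeight (k / b / γ) γ s) (s : ℝ) :
    |profileMap m b γ k ζ₁ s - profileMap m b γ k ζ₂ s| ≤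
      D / 2 * profileWeight (k / b / γ) γ s := by
  have hP : 0 ≤ k / b / γ := by positivity
  have hrel : ∀ t, ‖k * relaxation (clippedRate m b γ (k / b / γ) ζ₁) t
      - k * relaxation (clippedRate m b γ (k / b / γ) ζ₂) t‖ ≤
      D / 2 * (4 * (k / b / γ * γ) * exp (γ * t) * exp (k / b / γ * exp (γ * t))
        * profileWeight (k / b / γ) γ t) := by
    intro t
    have hw := profileWeight_pos (P := k / b / γ) (γ := γ) t
    have := abs_relaxation_sub_le (C := exp (k / b / γ * exp (γ * t)) *
      (D * profileWeight (k / b / γ) γ t)) hb hγ (by positivity)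
      (continuous_clippedRate hζ₁) (continuous_clippedRate hζ₂)
      (le_clippedRate (P := k / b / γ) hm hb) (le_clippedRate (P := k / b / γ) hm hb) t
      (fun σ hσ => (abs_clippedRate_sub_le hb hP σ).trans (by
        have h1 : |ζ₁ σ - ζ₂ σ| ≤ D * profileWeight (k / b / γ) γ t :=
          (h σ).trans (by gcongr; exact profileWeight_mono hP hγ.le hσ)
        gcongr))
    rw [← mul_sub, norm_mul, norm_of_nonneg hk.le, norm_eq_abs]
    refine (mul_le_mul_of_nonneg_left this hk.le).trans (le_of_eq ?_)
    field_simp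
    ring
  unfold profileMap
  rw [← MeasureTheory.integral_sub (integrableOn_relaxation_clippedRate hm hb hγ hk hζ₁ s)
    (integrableOn_relaxation_clippedRate hm hb hγ hk hζ₂ s), ← norm_eq_abs]
  refine (MeasureTheory.norm_integral_le_of_norm_le
    ((integrableOn_deriv_profileWeight hP hγ s).const_mul (D / 2))
    (Eventually.of_forall hrel)).trans ?_
  rw [MeasureTheory.integral_const_mul]
  gcongr
  exact integral_deriv_profileWeight_le hP hγ s

open scoped BoundedContinuousFunction in
theorem exists_profileMap_eq (hm : 0 ≤ m) (hb : 0 < b) (hγ : 0 < γ) (hk : 0 < k) :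
    ∃ ζ, Continuous ζ ∧ profileMap m b γ k ζ = ζ := by
  set φ := profileWeight (k / b / γ) γ
  have hφc : Continuous φ := continuous_profileWeight
  have hφ0 : ∀ s, 0 < φ s := profileWeight_pos
  have hc : ∀ v : ℝ →ᵇ ℝ, Continuous fun s => φ s * v s := fun v => hφc.mul v.continuous
  let T : (ℝ →ᵇ ℝ) → (ℝ →ᵇ ℝ) := fun v =>
    BoundedContinuousFunction.ofNormedAddCommGroup
      (fun s => profileMap m b γ k (fun s => φ s * v s) s / φ s)
      ((continuous_profileMap hm hb hγ hk (hc v)).div hφc fun s => (hφ0 s).ne') 1 fun s => by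
        rw [norm_of_nonneg (div_nonneg (profileMap_nonneg hm hb hγ hk (hc v) s) (hφ0 s).le),
          div_le_one (hφ0 s)]
        exact (profileMap_le hm hb hγ hk (hc v) s).trans (le_profileWeight s)
  have hT : ContractingWith (1 / 2) T := by
    refine ⟨by rw [← NNReal.coe_lt_coe]; norm_num,
      LipschitzWith.of_dist_le_mul fun v w => ?_⟩
    rw [BoundedContinuousFunction.dist_le (by positivity)]
    intro s
    have hvw : ∀ s, |φ s * v s - φ s * w s| ≤ dist v w * φ s := fun s => by
      rw [← mul_sub, abs_mul, abs_of_pos (hφ0 s), mul_comm]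
      exact mul_le_mul_of_nonneg_right (v.dist_coe_le_dist (g := w) s) (hφ0 s).le
    have := abs_profileMap_sub_le hm hb hγ hk (hc v) (hc w) dist_nonneg hvw s
    change |_ / φ s - _ / φ s| ≤ _
    rw [← sub_div, abs_div, abs_of_pos (hφ0 s), div_le_iff₀ (hφ0 s)]
    refine this.trans (le_of_eq ?_)
    push_cast
    ring
  refine ⟨_, hc (hT.fixedPoint T), ?_⟩
  ext s
  have := DFunLike.congr_fun hT.fixedPoint_isFixedPt s
  change profileMap m b γ k _ s / φ s = _ at this
  rw [div_eq_iff (hφ0 s).ne'] at this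
  rw [this, mul_comm]

theorem profileMap_fixedPoint_unique (hm : 0 ≤ m) (hb : 0 < b) (hγ : 0 < γ) (hk : 0 < k)
    (hζ₁ : Continuous ζ₁) (hζ₂ : Continuous ζ₂)
    (h₁ : profileMap m b γ k ζ₁ = ζ₁) (h₂ : profileMap m b γ k ζ₂ = ζ₂) : ζ₁ = ζ₂ := by
  have key : ∀ j : ℕ, ∀ s, |ζ₁ s - ζ₂ s| ≤ (1 / 2) ^ j * profileWeight (k / b / γ) γ s := by
    intro j
    induction j with
    | zero =>
      intro s
      have a1 := profileMap_nonneg hm hb hγ hk hζ₁ s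
      have a2 := profileMap_nonneg hm hb hγ hk hζ₂ s
      have b1 := profileMap_le hm hb hγ hk hζ₁ s
      have b2 := profileMap_le hm hb hγ hk hζ₂ s
      have := le_profileWeight (P := k / b / γ) (γ := γ) s
      rw [h₁] at a1 b1
      rw [h₂] at a2 b2
      rw [abs_le]
      constructor <;> linarith
    | succ j ih =>
      intro s
      have := abs_profileMap_sub_le hm hb hγ hk hζ₁ hζ₂ (by positivity) ih s
      rw [h₁, h₂] at this
      rwa [pow_succ, mul_one_div]
  ext s
  have hlim : Tendsto (fun j : ℕ => (1 / 2 : ℝ) ^ j * profileWeight (k / b / γ) γ s) atTop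
      (nhds (0 * profileWeight (k / b / γ) γ s)) :=
    (tendsto_pow_atTop_nhds_zero_of_lt_one (by norm_num) (by norm_num)).mul_const _
  have := ge_of_tendsto' hlim fun j => key j s
  rw [zero_mul] at this
  exact sub_eq_zero.1 (abs_nonpos_iff.1 this)

theorem exists_isLogProfile (hm : 0 ≤ m) (hb : 0 < b) (hγ : 0 < γ) (hk : 0 < k) :
    ∃ ζ h, IsLogProfile m b γ k ζ h := by
  obtain ⟨ζ, hζ, hfix⟩ := exists_profileMap_eq hm hb hγ hk
  have h0 : ∀ s, 0 ≤ ζ s := fun s => hfix ▸ profileMap_nonneg hm hb hγ hk hζ s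
  have h1 : ∀ s, ζ s ≤ k / b / γ * exp (γ * s) := fun s => by
    have := profileMap_le hm hb hγ hk hζ s
    rwa [hfix] at this
  refine ⟨ζ, fun s => k * relaxation (clippedRate m b γ (k / b / γ) ζ) s,
    fun s => ?_, fun s => ?_, ?_, relaxation_clippedRate_pos hm hb hγ hk hζ,
    relaxation_clippedRate_le hm hb hγ hk hζ⟩
  · have := hasDerivAt_profileMap hm hb hγ hk hζ s
    rwa [hfix] at this
  · have := hasDerivAt_relaxation_clippedRate (k := k) (P := k / b / γ) hm hb hγ hζ s
    rwa [clippedRate_eq (h0 s) (h1 s)] at this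
  · have : Tendsto (fun s => k / b / γ * exp (γ * s)) atBot (nhds (k / b / γ * 0)) :=
      (tendsto_exp_atBot.comp (tendsto_id.const_mul_atBot hγ)).const_mul _
    rw [mul_zero] at this
    exact squeeze_zero h0 h1 this

theorem IsLogProfile.profileMap_eq (hm : 0 ≤ m) (hb : 0 < b) (hγ : 0 < γ) (hk : 0 < k)
    {h : ℝ → ℝ} (H : IsLogProfile m b γ k ζ h) :
    profileMap m b γ k ζ = ζ := by
  have hζ : Continuous ζ := continuous_iff_continuousAt.2 fun s => (H.hasDerivAt s).continuousAt
  have hh : Continuous h := continuous_iff_continuousAt.2 fun s => (H.hasDerivAt' s).continuousAt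
  have hi : ∀ s, MeasureTheory.IntegrableOn h (Iic s) := fun s =>
    integrableOn_of_abs_le_mul_exp hγ hh fun t _ => by
      rw [abs_of_pos (H.pos t)]
      exact H.le t
  have hint : ∀ s, ζ s = ∫ t in Iic s, h t := fun s => by
    rw [MeasureTheory.integral_Iic_of_hasDerivAt_of_tendsto' (fun t _ => H.hasDerivAt t) (hi s)
      H.tendsto, sub_zero]
  have h0 : ∀ s, 0 ≤ ζ s := fun s => by
    rw [hint]
    exact MeasureTheory.integral_nonneg fun t => (H.pos t).le
  have h1 : ∀ s, ζ s ≤ k / b / γ * exp (γ * s) := fun s => by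
    rw [hint]
    refine (MeasureTheory.setIntegral_mono (hi s) (integrableOn_mul_exp hγ _ s) H.le).trans ?_
    rw [MeasureTheory.integral_const_mul, integral_exp_mul_Iic hγ]
    apply le_of_eq
    ring
  have heq : ∀ t, h t = k * relaxation (clippedRate m b γ (k / b / γ) ζ) t := by
    refine eq_mul_relaxation (M := k / b) hb hγ (continuous_clippedRate hζ) (le_clippedRate hm hb)
      (fun s => ?_) fun s hs => ?_
    · rw [clippedRate_eq (h0 s) (h1 s)]
      exact H.hasDerivAt' s
    · rw [abs_of_pos (H.pos s)]
      refine (H.le s).trans (mul_le_of_le_one_right (by positivity) (exp_le_one_iff.2 ?_))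
      nlinarith
  ext s
  rw [hint s]
  simp only [profileMap, ← heq]

theorem IsLogProfile.unique (hm : 0 ≤ m) (hb : 0 < b) (hγ : 0 < γ) (hk : 0 < k)
    {h₁ h₂ : ℝ → ℝ} (H₁ : IsLogProfile m b γ k ζ₁ h₁)
    (H₂ : IsLogProfile m b γ k ζ₂ h₂) : ζ₁ = ζ₂ :=
  profileMap_fixedPoint_unique hm hb hγ hk
    (continuous_iff_continuousAt.2 fun s => (H₁.hasDerivAt s).continuousAt)
    (continuous_iff_continuousAt.2 fun s => (H₂.hasDerivAt s).continuousAt)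
    (H₁.profileMap_eq hm hb hγ hk) (H₂.profileMap_eq hm hb hγ hk)

end ProfileMap

section Profile

variable {n : ℕ} {η ρ1 β0 α0 C0 : ℝ}

/-- The substitution `r = e^s` sends logarithmic profiles to solutions. -/
theorem IsLogProfile.logSol_and_logHBound (hη : 0 < η) (hβ0 : 0 < β0)
    (hα0 : α0 = 2 * β0 + ρ1) (hC0 : C0 = α0 * ((n : ℝ) - 2) / β0 ^ 2) {ζ h : ℝ → ℝ}
    (H : IsLogProfile ((n : ℝ) - 2) (β0 * η) (ρ1 / β0) (((n : ℝ) - 2) * (α0 / β0)) ζ h) :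
    LogSol n α0 β0 η (fun r => η * r ^ (-(α0 / β0)) * exp (ζ (log r))) ∧
      LogHBound α0 β0 ρ1 η C0 (fun r => η * r ^ (-(α0 / β0)) * exp (ζ (log r))) := by
  set g : ℝ → ℝ := fun r => η * r ^ (-(α0 / β0)) * exp (ζ (log r)) with hg
  have hgpos : ∀ r ∈ Ioi (0 : ℝ), 0 < g r := fun r hr => by
    have := rpow_pos_of_pos hr (-(α0 / β0))
    positivity
  have hgd : ∀ r ∈ Ioi (0 : ℝ), HasDerivAt g (g r * ((h (log r) - α0 / β0) / r)) r := by
    intro r hr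
    have hr0 : r ≠ 0 := (mem_Ioi.1 hr).ne'
    have h1 := (Real.hasDerivAt_rpow_const (p := -(α0 / β0)) (Or.inl hr0)).const_mul η
    have h2 := ((H.hasDerivAt (log r)).comp r (Real.hasDerivAt_log hr0)).exp
    refine (h1.mul h2).congr_deriv ?_
    rw [rpow_sub_one hr0]
    simp only [hg, Function.comp_apply]
    field_simp
    ring
  have hdiv : ∀ r ∈ Ioi (0 : ℝ), deriv g r / g r = (h (log r) - α0 / β0) / r := fun r hr => by
    rw [(hgd r hr).deriv, mul_div_cancel_left₀ _ (hgpos r hr).ne']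
  have hq : ∀ r ∈ Ioi (0 : ℝ), r ^ (α0 / β0) * g r = η * exp (ζ (log r)) := fun r hr => by
    have : r ^ (α0 / β0) * r ^ (-(α0 / β0)) = 1 := by
      rw [← rpow_add hr]; simp
    linear_combination (η * exp (ζ (log r))) * this
  have hζ : Continuous ζ := continuous_iff_continuousAt.2 fun s => (H.hasDerivAt s).continuousAt
  have hh : Continuous h := continuous_iff_continuousAt.2 fun s => (H.hasDerivAt' s).continuousAt
  have hh1 : ContDiff ℝ 1 h := by
    rw [contDiff_one_iff_deriv]
    refine ⟨fun s => (H.hasDerivAt' s).differentiableAt, ?_⟩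
    rw [show deriv h = _ from funext fun s => (H.hasDerivAt' s).deriv]
    fun_prop
  refine ⟨⟨hgpos, ?_, fun r hr => ?_, ?_⟩, fun s => ?_⟩
  · refine ContDiffOn.congr (f := fun r => (h (log r) - α0 / β0) / r) ?_ hdiv
    have hne : ∀ r ∈ Ioi (0 : ℝ), r ≠ 0 := fun r hr => (mem_Ioi.1 hr).ne'
    exact ((hh1.comp_contDiffOn (contDiffOn_id.log hne)).sub contDiffOn_const).div
      contDiffOn_id hne
  · have hr0 : r ≠ 0 := (mem_Ioi.1 hr).ne'
    have hev : (fun r' => deriv g r' / g r') =ᶠ[nhds r] fun r => (h (log r) - α0 / β0) / r := by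
      filter_upwards [Ioi_mem_nhds hr] with x hx using hdiv x hx
    have hd := ((((H.hasDerivAt' (log r)).comp r (Real.hasDerivAt_log hr0)).sub_const
      (α0 / β0)).div (hasDerivAt_id r) hr0)
    have hgr : g r = r⁻¹ ^ 2 * (η * exp (-(ρ1 / β0) * log r + ζ (log r))) := by
      have h1 : exp (-(ρ1 / β0) * log r) = r ^ (-(ρ1 / β0)) := by
        rw [rpow_def_of_pos hr, mul_comm]
      have h2 : r ^ (-(α0 / β0)) = r⁻¹ ^ 2 * r ^ (-(ρ1 / β0)) := by
        rw [show -(α0 / β0) = -(ρ1 / β0) - (2 : ℕ) by rw [hα0]; push_cast; field_simp; ring,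
          rpow_sub_natCast hr0, inv_pow]
        field_simp
      rw [exp_add, h1]
      simp only [hg, h2]
      ring
    rw [hev.deriv_eq, hdiv r hr, (hgd r hr).deriv]
    rw [show deriv (fun r => (h (log r) - α0 / β0) / r) r = _ from hd.deriv, hgr]
    simp only [id, Function.comp_apply]
    field_simp
    ring
  · have h1 : Tendsto (fun r => η * exp (ζ (log r))) (nhdsWithin 0 (Ioi 0)) (nhds (η * exp 0)) :=
      ((H.tendsto.comp tendsto_log_nhdsGT_zero).rexp).const_mul η
    rw [exp_zero, mul_one] at h1
    refine h1.congr' ?_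
    filter_upwards [self_mem_nhdsWithin] with r hr using (hq r hr).symm
  · have hs : exp s ∈ Ioi (0 : ℝ) := exp_pos s
    have hH : Hfun α0 β0 g s = h s := by
      have hev : (fun r => r ^ (α0 / β0) * g r) =ᶠ[nhds (exp s)] fun r => η * exp (ζ (log r)) := by
        filter_upwards [Ioi_mem_nhds hs] with x hx using hq x hx
      have hd := ((H.hasDerivAt (log (exp s))).comp (exp s)
        (Real.hasDerivAt_log (exp_pos s).ne')).exp.const_mul η
      rw [Hfun, hev.deriv_eq, hq _ hs,
        show deriv (fun r => η * exp (ζ (log r))) (exp s) = _ from hd.deriv]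
      simp only [Function.comp_apply, log_exp]
      field_simp
    have hC : C0 / η = ((n : ℝ) - 2) * (α0 / β0) / (β0 * η) := by
      rw [hC0]; field_simp
    rw [hH, hC]
    refine ⟨mul_pos (H.pos s) (exp_pos _), ?_⟩
    rw [neg_mul, exp_neg, ← div_eq_mul_inv, div_le_iff₀ (exp_pos _)]
    exact H.le s

/-- The substitution `s = log r` sends solutions to logarithmic profiles. -/
theorem LogSol.isLogProfile (hη : 0 < η) (hβ0 : 0 < β0)
    (hα0 : α0 = 2 * β0 + ρ1) (hC0 : C0 = α0 * ((n : ℝ) - 2) / β0 ^ 2) {g : ℝ → ℝ}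
    (hg : LogSol n α0 β0 η g) (hb : LogHBound α0 β0 ρ1 η C0 g) :
    IsLogProfile ((n : ℝ) - 2) (β0 * η) (ρ1 / β0) (((n : ℝ) - 2) * (α0 / β0))
      (fun s => log (exp s ^ (α0 / β0) * g (exp s) / η)) (Hfun α0 β0 g) := by
  obtain ⟨hpos, hcd, hode, hlim⟩ := hg
  have hHpos : ∀ s, 0 < Hfun α0 β0 g s := fun s =>
    (mul_pos_iff_of_pos_right (exp_pos _)).1 (hb s).1
  have hqd : ∀ s, DifferentiableAt ℝ (fun r => r ^ (α0 / β0) * g r) (exp s) := fun s => by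
    by_contra hnd
    have := hHpos s
    rw [Hfun, deriv_zero_of_not_differentiableAt hnd] at this
    simp at this
  have hgd : ∀ r ∈ Ioi (0 : ℝ), DifferentiableAt ℝ g r := fun r hr => by
    have h1 := hqd (log r)
    rw [exp_log hr] at h1
    have h2 : DifferentiableAt ℝ (fun r : ℝ => r ^ (-(α0 / β0))) r :=
      (Real.hasDerivAt_rpow_const (Or.inl (mem_Ioi.1 hr).ne')).differentiableAt
    refine (h2.mul h1).congr_of_eventuallyEq ?_
    filter_upwards [Ioi_mem_nhds hr] with x hx
    have : x ^ (-(α0 / β0)) * x ^ (α0 / β0) = 1 := by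
      rw [← rpow_add hx]; simp
    simp only [Pi.mul_apply]
    rw [← mul_assoc, this, one_mul]
  have hq0 : ∀ s, 0 < exp s ^ (α0 / β0) * g (exp s) := fun s =>
    mul_pos (rpow_pos_of_pos (exp_pos s) _) (hpos _ (exp_pos s))
  have hH : ∀ s, Hfun α0 β0 g s = α0 / β0 + exp s * (deriv g (exp s) / g (exp s)) := fun s => by
    have h1 := (Real.hasDerivAt_rpow_const (p := α0 / β0) (Or.inl (exp_pos s).ne')).mul
      (hgd _ (exp_pos s)).hasDerivAt
    have hr := rpow_pos_of_pos (exp_pos s) (α0 / β0)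
    have hgp := hpos _ (exp_pos s)
    rw [Hfun, show deriv (fun r => r ^ (α0 / β0) * g r) (exp s) = _ from h1.deriv,
      rpow_sub_one (exp_pos s).ne']
    field_simp
  have hexp : ∀ s, exp (-(ρ1 / β0) * s + log (exp s ^ (α0 / β0) * g (exp s) / η))
      = exp s ^ 2 * g (exp s) / η := fun s => by
    rw [exp_add, exp_log (div_pos (hq0 s) hη), ← exp_mul, ← exp_nat_mul, mul_div_assoc', ← mul_assoc,
      ← exp_add]
    congr 3
    rw [hα0]
    push_cast
    field_simp
    ring
  refine ⟨fun s => ?_, fun s => ?_, ?_, hHpos, fun s => ?_⟩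
  · have h1 := (((hqd s).hasDerivAt.comp s (Real.hasDerivAt_exp s)).div_const η).log
      (div_pos (hq0 s) hη).ne'
    refine h1.congr_deriv ?_
    have := hq0 s
    simp only [Hfun, Function.comp_apply]
    field_simp
  · have hpd : DifferentiableAt ℝ (fun r => deriv g r / g r) (exp s) :=
      (hcd.differentiableOn one_ne_zero).differentiableAt (Ioi_mem_nhds (exp_pos s))
    have h1 := ((Real.hasDerivAt_exp s).mul
      (hpd.hasDerivAt.comp s (Real.hasDerivAt_exp s))).const_add (α0 / β0)
    rw [show Hfun α0 β0 g = _ from funext hH]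
    refine h1.congr_deriv ?_
    have hgp := hpos _ (exp_pos s)
    have ho := hode _ (exp_pos s)
    have hdg : deriv g (exp s) = g (exp s) * (deriv g (exp s) / g (exp s)) := by field_simp
    rw [hexp]
    simp only [Function.comp_apply]
    set p := deriv g (exp s) / g (exp s)
    rw [hdg] at ho
    set D := deriv (fun r => deriv g r / g r) (exp s)
    have hD : D = -((((n : ℝ) - 1) / exp s) * p + α0 * g (exp s)
      + β0 * exp s * (g (exp s) * p)) := by linarith
    rw [hD]
    field_simp
    ring
  · have h1 := ((hlim.comp (tendsto_exp_atBot_nhdsGT)).div_const η).log (by simp [hη.ne'])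
    rw [div_self hη.ne', log_one] at h1
    exact h1
  · have hC : C0 / η = ((n : ℝ) - 2) * (α0 / β0) / (β0 * η) := by
      rw [hC0]; field_simp
    have h1 := (hb s).2
    rw [neg_mul, exp_neg, ← div_eq_mul_inv, div_le_iff₀ (exp_pos _), hC] at h1
    exact h1

end Profile

theorem stmt2 (n : ℕ) (η ρ1 β0 α0 C0 : ℝ)
    (hn : 3 ≤ n) (hη : 0 < η) (hρ1 : 0 < ρ1) (hβ0 : 0 < β0)
    (hα0 : α0 = 2 * β0 + ρ1)
    (hC0 : C0 = α0 * ((n : ℝ) - 2) / β0 ^ 2) :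
    ∃ g : ℝ → ℝ, (LogSol n α0 β0 η g ∧ LogHBound α0 β0 ρ1 η C0 g) ∧
      ∀ g' : ℝ → ℝ, LogSol n α0 β0 η g' ∧ LogHBound α0 β0 ρ1 η C0 g' →
        Set.EqOn g' g (Set.Ioi 0) := by
  have hn2 : (0 : ℝ) < (n : ℝ) - 2 := by
    have : (3 : ℝ) ≤ n := by exact_mod_cast hn
    linarith
  have hb : 0 < β0 * η := by positivity
  have hγ : 0 < ρ1 / β0 := by positivity
  have hk : 0 < ((n : ℝ) - 2) * (α0 / β0) := by
    have : 0 < α0 := by rw [hα0]; positivity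
    positivity
  obtain ⟨ζ, h, H⟩ := exists_isLogProfile hn2.le hb hγ hk
  refine ⟨_, H.logSol_and_logHBound hη hβ0 hα0 hC0, fun g ⟨hg, hgb⟩ r hr => ?_⟩
  have heq := congrFun ((hg.isLogProfile hη hβ0 hα0 hC0 hgb).unique hn2.le hb hγ hk H) (log r)
  have hr' := rpow_pos_of_pos hr (α0 / β0)
  have hgr := hg.1 r hr
  simp only [exp_log (mem_Ioi.1 hr)] at heq
  rw [← heq, exp_log (by positivity), rpow_neg (mem_Ioi.1 hr).le]
  field_simp
end
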